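/- Let N ≥ 1, m > 1, q ∈ (0,1) and σ ≥ 2(1−q)/(m−1). Let a, A, R > 0 satisfy a > σ/(1−q) and A^{m−q} R^{a(m−q)−σ−2} ≤ 1/(am(am+N−2)). Let u_0 ∈ L^∞(ℝ^N) be non-negative with u_0(x) ≤ A|x|^a for a.e. x ∈ B(0,R) and ‖u_0‖_∞ ≤ A R^a. Then every non-negative weak solution u of ∂_t u = Δ(u^m) − |x|^σ u^q with u(0) = u_0 vanishes in finite time: there exists T_e ∈ (0,∞) such that u(t,x) = 0 for a.e. x ∈ ℝ^N and a.e. t ≥ T_e. -/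

import Mathlib

open MeasureTheory Set

noncomputable section

/-- A non-negative weak solution of `∂ₜ u = Δ(uᵐ) − w(x) u^q` on `(0,∞)×ℝᴺ`
with initial condition `u₀`, in the sense of Definition 1.1 of the paper:
`u` is a bounded non-negative measurable function, and there is a measurable
vector field `g` (the weak spatial gradient of `uᵐ`) which is locally square
integrable on `(0,T)×ℝᴺ`, satisfies the weak derivative identity against test
functions in `C_c^1((0,T)×ℝᴺ)`, and satisfies the weak formulation of the
equation against test functions in `C_c^1([0,T)×ℝᴺ)`. -/
def IsWeakSolution (N : ℕ) (m q : ℝ) (w : EuclideanSpace ℝ (Fin N) → ℝ)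
    (u0 : EuclideanSpace ℝ (Fin N) → ℝ)
    (u : ℝ → EuclideanSpace ℝ (Fin N) → ℝ) : Prop :=
  Measurable (Function.uncurry u) ∧
  (∀ t x, 0 ≤ u t x) ∧
  (∃ C : ℝ, ∀ t x, u t x ≤ C) ∧
  ∃ g : ℝ → EuclideanSpace ℝ (Fin N) → EuclideanSpace ℝ (Fin N),
    Measurable (Function.uncurry g) ∧
    ∀ T > (0:ℝ),
      (∀ K : Set (EuclideanSpace ℝ (Fin N)), IsCompact K →
        ∫⁻ s in Ioo (0:ℝ) T, ∫⁻ x in K, ENNReal.ofReal (‖g s x‖ ^ 2) < ⊤) ∧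
      (∀ ζ : ℝ × EuclideanSpace ℝ (Fin N) → ℝ, ContDiff ℝ 1 ζ →
        HasCompactSupport ζ → (∀ s x, s ∉ Ioo (0:ℝ) T → ζ (s, x) = 0) →
        ∀ i : Fin N,
          (∫ s in Ioo (0:ℝ) T, ∫ x,
              (u s x) ^ m * fderiv ℝ ζ (s, x) (0, EuclideanSpace.single i 1))
            = - ∫ s in Ioo (0:ℝ) T, ∫ x, g s x i * ζ (s, x)) ∧
      (∀ ζ : ℝ × EuclideanSpace ℝ (Fin N) → ℝ, ContDiff ℝ 1 ζ →
        HasCompactSupport ζ → (∀ s x, T ≤ s → ζ (s, x) = 0) →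
        ∫ s in Ioo (0:ℝ) T, ∫ x,
            ((u0 x - u s x) * fderiv ℝ ζ (s, x) (1, 0)
              + fderiv ℝ ζ (s, x) (0, g s x)
              + w x * (u s x) ^ q * ζ (s, x)) = 0)

/-- `u₀` is a non-negative function in `L^∞(ℝᴺ)`. -/
def IsBddNonneg (N : ℕ) (u0 : EuclideanSpace ℝ (Fin N) → ℝ) : Prop :=
  Measurable u0 ∧ (∀ x, 0 ≤ u0 x) ∧ ∃ C : ℝ, ∀ x, u0 x ≤ C

/-- The solution `u` vanishes in finite time. -/
def VanishesInFiniteTime (N : ℕ) (u : ℝ → EuclideanSpace ℝ (Fin N) → ℝ) : Prop :=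
  ∃ Te : ℝ, 0 < Te ∧ ∀ᵐ t : ℝ, Te ≤ t → ∀ᵐ x : EuclideanSpace ℝ (Fin N), u t x = 0

/-- The support of `u(t)` is contained in `B(0,R)` for a.e. `t > 0`. -/
def SupportLocalized (N : ℕ) (R : ℝ) (u : ℝ → EuclideanSpace ℝ (Fin N) → ℝ) : Prop :=
  ∀ᵐ t : ℝ, 0 < t → ∀ᵐ x : EuclideanSpace ℝ (Fin N), R ≤ ‖x‖ → u t x = 0


open Filter Topology ENNReal Convolution

theorem transl_L2 {G F : Type*} [NormedAddCommGroup G] [NormedSpace ℝ G] [FiniteDimensional ℝ G]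
    [MeasurableSpace G] [BorelSpace G] (μ : Measure G) [μ.IsAddHaarMeasure]
    [NormedAddCommGroup F] (f : G → F) (hf : MemLp f 2 μ) :
    Tendsto (fun y => eLpNorm (fun p => f (p + y) - f p) 2 μ) (𝓝 0) (𝓝 0) := by
  have : Fact ((1 : ℝ≥0∞) ≤ 2) := ⟨by norm_num⟩
  have hgm : ∀ y : G, MeasurePreserving (fun p : G => p + y) μ μ :=
    fun y => measurePreserving_add_right μ y
  let g : C(G, C(G, G)) := ContinuousMap.curry ⟨fun a : G × G => a.2 + a.1, by fun_prop⟩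
  have hg : Tendsto g (𝓝 0) (𝓝 (g 0)) := g.continuous.tendsto 0
  have h1 := Filter.Tendsto.compMeasurePreservingLp (μ := μ) (ν := μ) (l := 𝓝 (0:G))
    (tendsto_const_nhds (x := hf.toLp f)) hg (fun y => hgm y) (hgm 0) (by norm_num)
  rw [tendsto_iff_edist_tendsto_0] at h1
  refine h1.congr fun y => ?_
  rw [Lp.edist_def]
  apply eLpNorm_congr_ae
  have e0 := Lp.coeFn_compMeasurePreserving (hf.toLp f) (hgm y)
  have e1 := Lp.coeFn_compMeasurePreserving (hf.toLp f) (hgm 0)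
  have e2 := (hgm y).quasiMeasurePreserving.ae_eq hf.coeFn_toLp
  have e3 := (hgm 0).quasiMeasurePreserving.ae_eq hf.coeFn_toLp
  filter_upwards [e0, e1, e2, e3] with p a0 a1 a2 a3
  simp only [Pi.sub_apply]
  refine (congrArg₂ (· - ·) (a0.trans a2) (a1.trans a3)).trans ?_
  simp

theorem sq_lintegral_le {Y : Type*} [MeasurableSpace Y] (ν : Measure Y) [IsProbabilityMeasure ν]
    (h : Y → ℝ≥0∞) (hh : Measurable h) : (∫⁻ y, h y ∂ν) ^ 2 ≤ ∫⁻ y, h y ^ 2 ∂ν := by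
  have := ENNReal.lintegral_mul_le_Lp_mul_Lq ν Real.HolderConjugate.two_two hh.aemeasurable
    (aemeasurable_const (b := (1:ℝ≥0∞)))
  simp at this
  calc (∫⁻ y, h y ∂ν) ^ 2 ≤ ((∫⁻ y, h y ^ 2 ∂ν) ^ (2⁻¹:ℝ)) ^ 2 := by gcongr
    _ = _ := by
      rw [← ENNReal.rpow_natCast, ← ENNReal.rpow_mul]; norm_num

theorem eLpNorm_two_sq {Y F : Type*} [MeasurableSpace Y] [NormedAddCommGroup F] (ν : Measure Y) (f : Y → F) :
    eLpNorm f 2 ν ^ 2 = ∫⁻ y, ‖f y‖ₑ ^ 2 ∂ν := by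
  have := eLpNorm_nnreal_pow_eq_lintegral (μ := ν) (f := f) (p := 2) (by norm_num)
  simpa using this

theorem mollify_L2 {G F : Type*} [NormedAddCommGroup G] [NormedSpace ℝ G] [FiniteDimensional ℝ G]
    [MeasurableSpace G] [BorelSpace G] (μ : Measure G) [μ.IsAddHaarMeasure]
    [NormedAddCommGroup F] [NormedSpace ℝ F] [CompleteSpace F] [MeasurableSpace F] [BorelSpace F]
    [SecondCountableTopology F] (f : G → F) (hfm : Measurable f) (hf : MemLp f 2 μ)
    (φ : ℕ → ContDiffBump (0 : G)) (hφ : Tendsto (fun n => (φ n).rOut) atTop (𝓝 0)) :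
    Tendsto (fun n => eLpNorm
      (fun p => ((φ n).normed μ ⋆[ContinuousLinearMap.lsmul ℝ ℝ, μ] f) p - f p) 2 μ) atTop (𝓝 0) := by
  have htr := transl_L2 μ f hf
  have hloc : LocallyIntegrable f μ := hf.locallyIntegrable (by norm_num)
  rw [ENNReal.tendsto_nhds_zero] at htr ⊢
  intro ε hε
  obtain ⟨δ, hδ, hball⟩ := Metric.eventually_nhds_iff_ball.1 (htr ε hε)
  filter_upwards [hφ.eventually (gt_mem_nhds hδ)] with n hn
  set ρ := (φ n).normed μ with hρ
  have hρc : Continuous ρ := (φ n).continuous_normed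
  set ν := μ.withDensity (fun y => ENNReal.ofReal (ρ y)) with hν
  have hρm : Measurable (fun y => ENNReal.ofReal (ρ y)) := hρc.measurable.ennreal_ofReal
  have : IsProbabilityMeasure ν := ⟨by
    rw [hν, withDensity_apply _ MeasurableSet.univ, Measure.restrict_univ,
      ← ofReal_integral_eq_lintegral_ofReal (φ n).integrable_normed
        (ae_of_all _ (φ n).nonneg_normed), (φ n).integral_normed]; simp⟩
  have hm2 : Measurable (fun a : G × G => ‖f (a.1 - a.2) - f a.1‖ₑ ^ 2) := by fun_prop
  have key : ∀ p, ‖(ρ ⋆[ContinuousLinearMap.lsmul ℝ ℝ, μ] f) p - f p‖ₑ ^ 2 ≤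
      ∫⁻ y, ‖f (p - y) - f p‖ₑ ^ 2 ∂ν := by
    intro p
    refine le_trans ?_ (sq_lintegral_le ν _ (by fun_prop))
    gcongr
    have h1 : (ρ ⋆[ContinuousLinearMap.lsmul ℝ ℝ, μ] f) p - f p
        = ∫ y, ρ y • (f (p - y) - f p) ∂μ := by
      have hce : ConvolutionExistsAt ρ f p (ContinuousLinearMap.lsmul ℝ ℝ) μ :=
        (φ n).hasCompactSupport_normed.convolutionExists_left _ hρc hloc p
      simp only [smul_sub]
      rw [integral_sub]
      · rw [integral_smul_const, (φ n).integral_normed, one_smul]; rfl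
      · exact hce
      · exact (φ n).integrable_normed.smul_const _
    rw [h1, hν, lintegral_withDensity_eq_lintegral_mul _ hρm (by fun_prop)]
    refine (enorm_integral_le_lintegral_enorm _).trans (lintegral_mono fun y => ?_)
    simp only [Pi.mul_apply, enorm_smul]
    rw [Real.enorm_of_nonneg ((φ n).nonneg_normed y)]
  have h2 : eLpNorm (fun p => (ρ ⋆[ContinuousLinearMap.lsmul ℝ ℝ, μ] f) p - f p) 2 μ ^ 2 ≤ ε ^ 2 := by
    rw [eLpNorm_two_sq]
    calc _ ≤ ∫⁻ p, ∫⁻ y, ‖f (p - y) - f p‖ₑ ^ 2 ∂ν ∂μ := lintegral_mono key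
      _ = ∫⁻ y, ∫⁻ p, ‖f (p - y) - f p‖ₑ ^ 2 ∂μ ∂ν := lintegral_lintegral_swap hm2.aemeasurable
      _ ≤ ∫⁻ y, ε ^ 2 ∂ν := by
        apply lintegral_mono_ae
        rw [hν, ae_withDensity_iff hρm]
        refine ae_of_all _ fun y hy => ?_
        have hy' : y ∈ Function.support ρ := by
          intro h0; apply hy; simp [h0]
        rw [hρ, (φ n).support_normed_eq] at hy'
        have : eLpNorm (fun p => f (p + -y) - f p) 2 μ ≤ ε := by
          apply hball
          simp at hy' ⊢
          linarith
        rw [← eLpNorm_two_sq]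
        simp only [← sub_eq_add_neg] at this
        gcongr
      _ = ε ^ 2 := by simp
  exact (ENNReal.pow_le_pow_left_iff two_ne_zero).1 h2

abbrev EE (N : ℕ) := EuclideanSpace ℝ (Fin N)
abbrev PP (N : ℕ) := ℝ × EuclideanSpace ℝ (Fin N)

/-- positive times -/
def Om (N : ℕ) : Set (PP N) := {p | 0 < p.1}

theorem measurableSet_Om (N : ℕ) : MeasurableSet (Om N) := measurableSet_lt measurable_const measurable_fst

theorem int_mul_cc {N : ℕ} {h ψ : PP N → ℝ} (hh : LocallyIntegrable h) (hψ : Continuous ψ)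
    (hc : HasCompactSupport ψ) : Integrable (fun p => h p * ψ p) := by
  have := hh.integrable_smul_left_of_hasCompactSupport hψ hc
  refine this.congr (ae_of_all _ fun p => ?_)
  simp [mul_comm]

theorem int_fd {N : ℕ} {G : PP N → EE N} {ψ : PP N → ℝ} (hG : LocallyIntegrable G)
    (hψ : ContDiff ℝ 1 ψ)
    (hc : HasCompactSupport ψ) : Integrable (fun p => fderiv ℝ ψ p (0, G p)) := by
  have hcf : Continuous (fderiv ℝ ψ) := hψ.continuous_fderiv one_ne_zero
  have h1 : LocallyIntegrable (fun p => ‖G p‖) := fun p => (hG p).norm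
  have h2 := int_mul_cc h1 hcf.norm (hc.fderiv (𝕜 := ℝ)).norm
  refine h2.mono' ?_ (ae_of_all _ fun p => ?_)
  · have : AEStronglyMeasurable (fun p => ((0:ℝ), G p)) := 
      aestronglyMeasurable_const.prodMk hG.aestronglyMeasurable
    exact (ContinuousLinearMap.apply ℝ ℝ).flip.aestronglyMeasurable_comp₂ hcf.aestronglyMeasurable this
  · refine ((fderiv ℝ ψ p).le_opNorm _).trans ?_
    rw [mul_comm]
    simp [Prod.norm_def]

theorem locInt_le {N : ℕ} {h k : PP N → ℝ} (hm : Measurable h) (hk : Continuous k)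
    (hb : ∀ p, |h p| ≤ k p) : LocallyIntegrable h := by
  refine hk.locallyIntegrable.mono hm.aestronglyMeasurable (ae_of_all _ fun p => ?_)
  rw [Real.norm_eq_abs]
  exact (hb p).trans (le_abs_self _)

theorem iter_prod {N : ℕ} {h : PP N → ℝ} (T : ℝ)
    (hi : Integrable ((Om N).indicator h)) (hT : ∀ p : PP N, T ≤ p.1 → h p = 0) :
    ∫ s in Ioo (0:ℝ) T, ∫ x, h (s, x) = ∫ p, (Om N).indicator h p := by
  rw [Measure.volume_eq_prod, integral_prod _ (by rwa [← Measure.volume_eq_prod]), ← integral_indicator measurableSet_Ioo]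
  refine integral_congr_ae (ae_of_all _ fun s => ?_)
  by_cases h0 : 0 < s
  · by_cases h1 : s < T
    · rw [indicator_of_mem (by exact ⟨h0, h1⟩)]
      refine integral_congr_ae (ae_of_all _ fun x => ?_)
      exact (indicator_of_mem (s := Om N) (a := (s, x)) h0 h).symm
    · rw [indicator_of_notMem (by intro h; exact h1 h.2)]
      symm; apply integral_eq_zero_of_ae (ae_of_all _ fun x => ?_)
      simp only [indicator_of_mem (s := Om N) (a := (s, x)) h0 h]
      exact hT _ (not_lt.1 h1)
  · rw [indicator_of_notMem (by intro h; exact h0 h.1)]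
    symm; apply integral_eq_zero_of_ae (ae_of_all _ fun x => ?_)
    exact indicator_of_notMem (s := Om N) (a := (s, x)) h0 h

theorem exists_T {N : ℕ} {ψ : PP N → ℝ} (hc : HasCompactSupport ψ) :
    ∃ T > (0:ℝ), ∀ p : PP N, T ≤ |p.1| → ψ p = 0 ∧ fderiv ℝ ψ p = 0 := by
  obtain ⟨r, hr⟩ := hc.isCompact.isBounded.subset_closedBall (0 : PP N)
  refine ⟨|r| + 1, by positivity, fun p hp => ?_⟩
  have hnot : p ∉ tsupport ψ := by
    intro h
    have := hr h
    simp only [Metric.mem_closedBall, dist_zero_right] at this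
    have h1 : |p.1| ≤ ‖p‖ := by simpa using norm_fst_le p
    have := le_abs_self r
    linarith
  refine ⟨image_eq_zero_of_notMem_tsupport hnot, ?_⟩
  by_contra h
  exact hnot (support_fderiv_subset ℝ h)

theorem g_memLp {N : ℕ} {g : ℝ → EE N → EE N} (hgm : Measurable (Function.uncurry g))
    (hg : ∀ T > (0:ℝ), ∀ K : Set (EE N), IsCompact K →
        ∫⁻ s in Ioo (0:ℝ) T, ∫⁻ x in K, ENNReal.ofReal (‖g s x‖ ^ 2) < ⊤) (r : ℝ) :
    MemLp ((Metric.closedBall (0 : PP N) r).indicator ((Om N).indicator (Function.uncurry g))) 2 := by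
  have hms : Measurable ((Metric.closedBall (0 : PP N) r).indicator
      ((Om N).indicator (Function.uncurry g))) :=
    (hgm.indicator (measurableSet_Om N)).indicator Metric.isClosed_closedBall.measurableSet
  refine ⟨hms.aestronglyMeasurable, ?_⟩
  have h2 := eLpNorm_two_sq volume ((Metric.closedBall (0 : PP N) r).indicator
      ((Om N).indicator (Function.uncurry g)))
  have h3 : eLpNorm ((Metric.closedBall (0 : PP N) r).indicator
      ((Om N).indicator (Function.uncurry g))) 2 volume ^ 2 < ⊤ := by
    rw [h2, Measure.volume_eq_prod, lintegral_prod _ (by fun_prop)]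
    refine lt_of_le_of_lt ?_ (hg (|r| + 1) (by positivity) (Metric.closedBall 0 r)
      (isCompact_closedBall 0 r))
    rw [← lintegral_indicator measurableSet_Ioo]
    refine lintegral_mono fun s => ?_
    by_cases hs : s ∈ Ioo 0 (|r| + 1)
    · rw [indicator_of_mem hs, ← lintegral_indicator Metric.isClosed_closedBall.measurableSet]
      refine lintegral_mono fun x => ?_
      by_cases hx : (s, x) ∈ Metric.closedBall (0 : PP N) r
      · have hx' : x ∈ Metric.closedBall (0 : EE N) r := by
          simp only [Metric.mem_closedBall, dist_zero_right] at hx ⊢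
          exact (norm_snd_le (s, x)).trans hx
        rw [indicator_of_mem hx', indicator_of_mem hx,
          indicator_of_mem (s := Om N) (a := (s, x)) hs.1]
        simp only [Function.uncurry]
        rw [ENNReal.ofReal_pow (norm_nonneg _), ofReal_norm]
      · rw [indicator_of_notMem hx]; simp
    · rw [indicator_of_notMem hs]
      simp only [nonpos_iff_eq_zero]
      refine (lintegral_congr fun x => ?_).trans lintegral_zero
      by_cases hx : (s, x) ∈ Metric.closedBall (0 : PP N) r
      · rw [indicator_of_mem hx, indicator_of_notMem]
        · simp
        · intro h0
          apply hs
          refine ⟨h0, ?_⟩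
          simp only [Metric.mem_closedBall, dist_zero_right] at hx
          have := (norm_fst_le (s, x)).trans hx
          simp only [Real.norm_eq_abs] at this
          have := le_abs_self s
          have := le_abs_self r
          linarith
      · rw [indicator_of_notMem hx]; simp
  by_contra h
  simp only [not_lt, top_le_iff] at h
  rw [h] at h3
  simp at h3

theorem locInt_of_memLp {N : ℕ} {F : Type*} [NormedAddCommGroup F] {G : PP N → F}
    (hG : ∀ r, MemLp ((Metric.closedBall (0 : PP N) r).indicator G) 2) : LocallyIntegrable G := by
  intro p
  refine ⟨Metric.closedBall 0 (‖p‖ + 1), ?_, ?_⟩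
  · refine mem_of_superset (Metric.ball_mem_nhds p one_pos) fun y hy => ?_
    simp only [Metric.mem_closedBall, dist_zero_right, Metric.mem_ball] at hy ⊢
    have := norm_le_norm_add_norm_sub' y p
    rw [dist_eq_norm] at hy
    linarith
  · have h1 := ((hG (‖p‖ + 1)).locallyIntegrable (by norm_num)).integrableOn_isCompact
      (isCompact_closedBall (0 : PP N) (‖p‖ + 1))
    exact h1.congr_fun (fun x hx => indicator_of_mem hx _) Metric.isClosed_closedBall.measurableSet

theorem ws_extract {N : ℕ} {m q : ℝ} {w u0 : EE N → ℝ} {u : ℝ → EE N → ℝ} (hm : 0 < m) (hq : 0 < q)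
    (hw : Continuous w) (hw0 : ∀ x, 0 ≤ w x) (hu0 : IsBddNonneg N u0)
    (hu : IsWeakSolution N m q w u0 u) :
    ∃ g : PP N → EE N, Measurable g ∧ (∀ p ∉ Om N, g p = 0) ∧
      (∀ r, MemLp ((Metric.closedBall (0 : PP N) r).indicator g) 2) ∧
      (∀ ψ : PP N → ℝ, ContDiff ℝ 1 ψ → HasCompactSupport ψ → ∀ i : Fin N,
        ∫ p, (Om N).indicator (fun p => u p.1 p.2 ^ m) p * fderiv ℝ ψ p (0, EuclideanSpace.single i 1)
          = - ∫ p, g p i * ψ p) ∧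
      (∀ ψ : PP N → ℝ, ContDiff ℝ 1 ψ → HasCompactSupport ψ →
        ∫ p, (Om N).indicator (fun p => u p.1 p.2 - u0 p.2) p * fderiv ℝ ψ p (1, 0)
          = ∫ p, (fderiv ℝ ψ p (0, g p)
            + (Om N).indicator (fun p => w p.2 * u p.1 p.2 ^ q) p * ψ p)) := by
  obtain ⟨hum, hupos, ⟨C, hC⟩, g, hgm, hT⟩ := hu
  obtain ⟨hu0m, hu0p, C0, hC0⟩ := hu0
  have humm : Measurable (fun p : PP N => u p.1 p.2) := hum
  have hOm := measurableSet_Om N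
  set G : PP N → EE N := (Om N).indicator (Function.uncurry g) with hG
  have hGL := g_memLp hgm (fun T hT0 => (hT T hT0).1)
  have hGloc : LocallyIntegrable G := locInt_of_memLp hGL
  have hGcomp : ∀ i, LocallyIntegrable (fun p => G p i) := fun i p =>
    let ⟨s, hs, h⟩ := hGloc p
    ⟨s, hs, (EuclideanSpace.proj (𝕜 := ℝ) i).integrable_comp h⟩
  have hCp : ∀ s x, u s x ^ m ≤ C ^ m := fun s x => Real.rpow_le_rpow (hupos s x) (hC s x) hm.le
  have hCq : ∀ s x, u s x ^ q ≤ C ^ q := fun s x => Real.rpow_le_rpow (hupos s x) (hC s x) hq.le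
  have hzloc : LocallyIntegrable ((Om N).indicator (fun p : PP N => u p.1 p.2 ^ m)) := by
    refine locInt_le (k := fun _ => C ^ m) ((humm.pow_const m).indicator hOm) continuous_const fun p => ?_
    have h0 := Real.rpow_nonneg (hupos p.1 p.2) m
    by_cases hp : p ∈ Om N
    · rw [indicator_of_mem hp, abs_of_nonneg h0]; exact hCp _ _
    · rw [indicator_of_notMem hp, abs_zero]; exact h0.trans (hCp _ _)
  have hUloc : LocallyIntegrable ((Om N).indicator (fun p : PP N => u p.1 p.2 - u0 p.2)) := by
    refine locInt_le (k := fun _ => C + C0) ((humm.sub (hu0m.comp measurable_snd)).indicator hOm)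
      continuous_const fun p => ?_
    have h0 := hupos p.1 p.2
    have h1 := hC p.1 p.2
    have h2 := hu0p p.2
    have h3 := hC0 p.2
    by_cases hp : p ∈ Om N
    · rw [indicator_of_mem hp, abs_le]; constructor <;> linarith
    · rw [indicator_of_notMem hp, abs_zero]; linarith
  have hfloc : LocallyIntegrable ((Om N).indicator (fun p : PP N => w p.2 * u p.1 p.2 ^ q)) := by
    refine locInt_le (k := fun p => w p.2 * C ^ q) 
      (((hw.measurable.comp measurable_snd).mul (humm.pow_const q)).indicator hOm)
      (by fun_prop) fun p => ?_
    have h0 := Real.rpow_nonneg (hupos p.1 p.2) q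
    have h1 := mul_le_mul_of_nonneg_left (hCq p.1 p.2) (hw0 p.2)
    have h2 := mul_nonneg (hw0 p.2) h0
    by_cases hp : p ∈ Om N
    · rw [indicator_of_mem hp, abs_of_nonneg h2]; exact h1
    · rw [indicator_of_notMem hp, abs_zero]; exact h2.trans h1
  have hfd : ∀ ψ : PP N → ℝ, ContDiff ℝ 1 ψ → HasCompactSupport ψ → ∀ v, 
      Continuous (fun p => fderiv ℝ ψ p v) ∧ HasCompactSupport (fun p => fderiv ℝ ψ p v) := by
    intro ψ h1 h2 v
    refine ⟨(h1.continuous_fderiv one_ne_zero).clm_apply continuous_const, ?_⟩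
    exact h2.fderiv_apply (𝕜 := ℝ) v
  refine ⟨G, hgm.indicator hOm, fun p hp => indicator_of_notMem hp _, hGL, ?_, ?_⟩
  · intro ψ hψ hψc i
    obtain ⟨T, hT0, hTz⟩ := exists_T hψc
    let χ : ℕ → PP N → ℝ := fun j p => Real.smoothTransition (j * p.1)
    have hχs : ∀ j, ContDiff ℝ 1 (χ j) := fun j => by
      refine Real.smoothTransition.contDiff.comp ?_
      fun_prop
    have hχ1 : ∀ j p, |χ j p| ≤ 1 := fun j p => by
      rw [abs_of_nonneg (Real.smoothTransition.nonneg _)]; exact Real.smoothTransition.le_one _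
    have hχ0 : ∀ j p, p ∉ Om N → χ j p = 0 := fun j p hp =>
      Real.smoothTransition.zero_of_nonpos (mul_nonpos_of_nonneg_of_nonpos (Nat.cast_nonneg j) (not_lt.1 hp))
    have hχlim : ∀ p ∈ Om N, Tendsto (fun j => χ j p) atTop (𝓝 1) := by
      intro p hp
      apply tendsto_const_nhds.congr'
      have hp' : 0 < p.1 := hp
      filter_upwards [eventually_ge_atTop ⌈1 / p.1⌉₊] with j hj
      symm
      apply Real.smoothTransition.one_of_one_le
      have := (Nat.le_ceil (1 / p.1)).trans (Nat.cast_le.2 hj)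
      rwa [div_le_iff₀ hp'] at this
    have hχd : ∀ j p, fderiv ℝ (χ j) p (0, EuclideanSpace.single i 1) = 0 := by
      intro j p
      have h1 : (fun t : ℝ => χ j (p + t • ((0:ℝ), EuclideanSpace.single i (1:ℝ)))) = fun _ => χ j p := by
        funext t; simp [χ]
      have h2 := ((hχs j).differentiable one_ne_zero p).lineDeriv_eq_fderiv
        (v := ((0:ℝ), EuclideanSpace.single i (1:ℝ)))
      rw [← h2, lineDeriv, h1]; simp
    have hd : ∀ j p, fderiv ℝ (fun p => χ j p * ψ p) p (0, EuclideanSpace.single i 1)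
        = χ j p * fderiv ℝ ψ p (0, EuclideanSpace.single i 1) := by
      intro j p
      rw [fderiv_fun_mul ((hχs j).differentiable one_ne_zero p) (hψ.differentiable one_ne_zero p)]
      simp [hχd]
    have hI1 := int_mul_cc hzloc (hfd ψ hψ hψc (0, EuclideanSpace.single i 1)).1
      (hfd ψ hψ hψc (0, EuclideanSpace.single i 1)).2
    have hI2 := int_mul_cc (hGcomp i) hψ.continuous hψc
    have hj : ∀ j, ∫ p, χ j p * ((Om N).indicator (fun p => u p.1 p.2 ^ m) p *
        fderiv ℝ ψ p (0, EuclideanSpace.single i 1)) = - ∫ p, χ j p * (G p i * ψ p) := by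
      intro j
      have hcj : HasCompactSupport (fun p => χ j p * ψ p) := hψc.mul_left
      have hsj : ContDiff ℝ 1 (fun p => χ j p * ψ p) := (hχs j).mul hψ
      have h := (hT T hT0).2.1 (fun p => χ j p * ψ p) hsj hcj
        (by
          intro s x hs
          by_cases h0 : 0 < s
          · have : T ≤ |s| := by
              by_contra h; exact hs ⟨h0, (le_abs_self s).trans_lt (not_le.1 h)⟩
            simp [(hTz (s, x) this).1]
          · simp [hχ0 j (s, x) h0]) i
      simp only [hd] at h
      have e1 : (Om N).indicator (fun p : PP N => u p.1 p.2 ^ m *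
          (χ j p * fderiv ℝ ψ p (0, EuclideanSpace.single i 1))) = 
          fun p => χ j p * ((Om N).indicator (fun p => u p.1 p.2 ^ m) p *
            fderiv ℝ ψ p (0, EuclideanSpace.single i 1)) := by
        funext p
        by_cases hp : p ∈ Om N
        · rw [indicator_of_mem hp, indicator_of_mem hp]; ring
        · rw [indicator_of_notMem hp, indicator_of_notMem hp]; ring
      have e2 : (Om N).indicator (fun p : PP N => g p.1 p.2 i *
          (χ j p * ψ p)) = fun p => χ j p * (G p i * ψ p) := by
        funext p
        by_cases hp : p ∈ Om N
        · rw [indicator_of_mem hp, hG, indicator_of_mem hp]; simp only [Function.uncurry]; ring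
        · rw [indicator_of_notMem hp, hG, indicator_of_notMem hp]; simp
      have b1 := hI1.bdd_mul (c := 1) (hχs j).continuous.aestronglyMeasurable
        (ae_of_all _ fun p => by rw [Real.norm_eq_abs]; exact hχ1 j p)
      have b2 := hI2.bdd_mul (c := 1) (hχs j).continuous.aestronglyMeasurable
        (ae_of_all _ fun p => by rw [Real.norm_eq_abs]; exact hχ1 j p)
      rw [iter_prod (h := fun p : PP N => u p.1 p.2 ^ m *
          (χ j p * fderiv ℝ ψ p (0, EuclideanSpace.single i 1))) T (by rw [e1]; exact b1) (fun p hp => by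
            simp [(hTz p (hp.trans (le_abs_self _))).2]),
        iter_prod (h := fun p : PP N => g p.1 p.2 i *
          (χ j p * ψ p)) T (by rw [e2]; exact b2) (fun p hp => by
            simp [(hTz p (hp.trans (le_abs_self _))).1]), e1, e2] at h
      exact h
    have l1 : Tendsto (fun j => ∫ p, χ j p * ((Om N).indicator (fun p => u p.1 p.2 ^ m) p *
        fderiv ℝ ψ p (0, EuclideanSpace.single i 1))) atTop
        (𝓝 (∫ p, (Om N).indicator (fun p => u p.1 p.2 ^ m) p *
          fderiv ℝ ψ p (0, EuclideanSpace.single i 1))) := by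
      refine tendsto_integral_of_dominated_convergence _ (fun j =>
        (hχs j).continuous.aestronglyMeasurable.mul hI1.aestronglyMeasurable) hI1.norm
        (fun j => ae_of_all _ fun p => ?_) (ae_of_all _ fun p => ?_)
      · rw [norm_mul]
        exact mul_le_of_le_one_left (norm_nonneg _) (by rw [Real.norm_eq_abs]; exact hχ1 j p)
      · by_cases hp : p ∈ Om N
        · simpa using (hχlim p hp).mul_const _
        · simp [indicator_of_notMem hp]
    have l2 : Tendsto (fun j => ∫ p, χ j p * (G p i * ψ p)) atTop
        (𝓝 (∫ p, G p i * ψ p)) := by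
      refine tendsto_integral_of_dominated_convergence _ (fun j =>
        (hχs j).continuous.aestronglyMeasurable.mul hI2.aestronglyMeasurable) hI2.norm
        (fun j => ae_of_all _ fun p => ?_) (ae_of_all _ fun p => ?_)
      · rw [norm_mul]
        exact mul_le_of_le_one_left (norm_nonneg _) (by rw [Real.norm_eq_abs]; exact hχ1 j p)
      · by_cases hp : p ∈ Om N
        · simpa using (hχlim p hp).mul_const _
        · simp [hG, indicator_of_notMem hp]
    refine tendsto_nhds_unique l1 ?_
    simp only [hj]
    exact l2.neg
  · intro ψ hψ hψc
    obtain ⟨T, hT0, hTz⟩ := exists_T hψc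
    have h := (hT T hT0).2.2 ψ hψ hψc (fun s x hs => (hTz (s, x) (hs.trans (le_abs_self s))).1)
    have i1 := int_mul_cc hUloc (hfd ψ hψ hψc (1, 0)).1 (hfd ψ hψ hψc (1, 0)).2
    have i2 := int_fd hGloc hψ hψc
    have i3 := int_mul_cc hfloc hψ.continuous hψc
    have e : (Om N).indicator (fun p : PP N => (u0 p.2 - u p.1 p.2) * fderiv ℝ ψ p (1, 0)
              + fderiv ℝ ψ p (0, g p.1 p.2)
              + w p.2 * (u p.1 p.2) ^ q * ψ p) = fun p => 
          (fderiv ℝ ψ p (0, G p) + (Om N).indicator (fun p => w p.2 * u p.1 p.2 ^ q) p * ψ p)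
          - (Om N).indicator (fun p => u p.1 p.2 - u0 p.2) p * fderiv ℝ ψ p (1, 0) := by
      funext p
      by_cases hp : p ∈ Om N
      · simp only [hG, indicator_of_mem hp, Function.uncurry]; ring
      · have : ((0:ℝ), (0 : EE N)) = 0 := rfl
        simp only [hG, indicator_of_notMem hp, this, map_zero]; ring
    rw [iter_prod (h := fun p : PP N => (u0 p.2 - u p.1 p.2) * fderiv ℝ ψ p (1, 0)
              + fderiv ℝ ψ p (0, g p.1 p.2)
              + w p.2 * (u p.1 p.2) ^ q * ψ p) T (by rw [e]; exact (i2.add i3).sub i1)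
        (fun p hp => by simp [(hTz p (hp.trans (le_abs_self _)))]), e] at h
    have h' := (integral_sub (i2.add i3) i1).symm.trans h
    exact (sub_eq_zero.1 h').symm

instance haarPP (N : ℕ) : (volume : Measure (PP N)).IsAddHaarMeasure :=
  inferInstanceAs ((volume : Measure ℝ).prod (volume : Measure (EE N))).IsAddHaarMeasure

theorem clm_inner {N : ℕ} (L : PP N →L[ℝ] ℝ) (G y : EE N)
    (h : ∀ i : Fin N, L (0, EuclideanSpace.single i 1) = G i) : L (0, y) = inner ℝ G y := by
  have hy : ((0:ℝ), y) = ∑ i, y i • ((0:ℝ), EuclideanSpace.single i (1:ℝ)) := by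
    have : y = ∑ i, y i • EuclideanSpace.single i (1:ℝ) := by
      ext j; simp [Finset.sum_apply, Pi.single_apply]
    apply Prod.ext
    · simp [Prod.fst_sum]
    · simpa [Prod.snd_sum] using this
  rw [hy, map_sum, PiLp.inner_apply]
  refine Finset.sum_congr rfl fun i _ => ?_
  rw [map_smul, h]
  simp

theorem mollify_exists {N : ℕ} {z : PP N → ℝ} {g : PP N → EE N} {M : ℝ} (hzm : Measurable z)
    (hz0 : ∀ p, 0 ≤ z p) (hzM : ∀ p, z p ≤ M) (hgm : Measurable g)
    (hgL : ∀ r, MemLp ((Metric.closedBall (0 : PP N) r).indicator g) 2)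
    (W1 : ∀ ψ : PP N → ℝ, ContDiff ℝ 1 ψ → HasCompactSupport ψ → ∀ i : Fin N,
        ∫ p, z p * fderiv ℝ ψ p (0, EuclideanSpace.single i 1) = - ∫ p, g p i * ψ p) :
    ∃ (Z : ℕ → PP N → ℝ) (G : ℕ → PP N → EE N), (∀ n, ContDiff ℝ 1 (Z n)) ∧ (∀ n p, 0 ≤ Z n p) ∧
      (∀ n p, Z n p ≤ M) ∧ (∀ᵐ p, Tendsto (fun n => Z n p) atTop (𝓝 (z p))) ∧
      (∀ n, Continuous (G n)) ∧ (∀ n p y, fderiv ℝ (Z n) p (0, y) = inner ℝ (G n p) y) ∧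
      ∀ r, Tendsto (fun n => eLpNorm ((Metric.closedBall (0 : PP N) r).indicator
        (fun p => G n p - g p)) 2) atTop (𝓝 0) := by
  have hgloc := locInt_of_memLp hgL
  have hzloc : LocallyIntegrable z := locInt_le (k := fun _ => M) hzm continuous_const fun p => by
    rw [abs_of_nonneg (hz0 p)]; exact hzM p
  let φ : ℕ → ContDiffBump (0 : PP N) := fun n => ⟨1 / (n + 1), 2 / (n + 1), by positivity, by gcongr; norm_num⟩
  have hφ : Tendsto (fun n => (φ n).rOut) atTop (𝓝 0) := by
    have := (tendsto_one_div_add_atTop_nhds_zero_nat (𝕜 := ℝ)).const_mul 2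
    simp only [mul_zero] at this
    refine this.congr fun n => ?_
    simp [φ]; ring
  let ρ : ℕ → PP N → ℝ := fun n => (φ n).normed volume
  have hρs : ∀ n, ContDiff ℝ 1 (ρ n) := fun n => (φ n).contDiff_normed
  have hρc : ∀ n, HasCompactSupport (ρ n) := fun n => (φ n).hasCompactSupport_normed
  refine ⟨fun n => ρ n ⋆[ContinuousLinearMap.lsmul ℝ ℝ, volume] z,
    fun n => ρ n ⋆[ContinuousLinearMap.lsmul ℝ ℝ, volume] g, ?_, ?_, ?_, ?_, ?_, ?_, ?_⟩
  · intro n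
    exact (hρc n).contDiff_convolution_left (n := 1) _ (hρs n) hzloc
  · intro n p
    exact integral_nonneg fun t => mul_nonneg ((φ n).nonneg_normed t) (hz0 _)
  · intro n p
    have hce := (hρc n).convolutionExists_left (ContinuousLinearMap.lsmul ℝ ℝ) (hρs n).continuous hzloc p
    have h1 : (ρ n ⋆[ContinuousLinearMap.lsmul ℝ ℝ, volume] z) p ≤ ∫ t, ρ n t * M := by
      refine integral_mono hce ((φ n).integrable_normed.mul_const M) fun t => ?_
      exact mul_le_mul_of_nonneg_left (hzM _) ((φ n).nonneg_normed t)
    rw [integral_mul_const, (φ n).integral_normed, one_mul] at h1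
    exact h1
  · refine ContDiffBump.ae_convolution_tendsto_right_of_locallyIntegrable (K := 2) hφ
      (Eventually.of_forall fun n => ?_) hzloc
    simp only [φ]; exact le_of_eq (by ring)
  · intro n
    exact (hρc n).continuous_convolution_left _ (hρs n).continuous hgloc
  · intro n p y
    apply clm_inner
    intro i
    have hD := (hρc n).hasFDerivAt_convolution_right (ContinuousLinearMap.lsmul ℝ ℝ).flip hzloc (hρs n) p
    rw [convolution_flip] at hD
    rw [hD.fderiv, convolution_precompR_apply _ hzloc ((hρc n).fderiv (𝕜 := ℝ))
      ((hρs n).continuous_fderiv one_ne_zero)]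
    have hψs : ContDiff ℝ 1 (fun t => ρ n (p - t)) := (hρs n).comp (by fun_prop)
    have hψc : HasCompactSupport (fun t => ρ n (p - t)) :=
      (hρc n).comp_homeomorph (Homeomorph.subLeft p)
    have hw := W1 _ hψs hψc i
    have hfd : ∀ t v, fderiv ℝ (fun t => ρ n (p - t)) t v = - fderiv ℝ (ρ n) (p - t) v := by
      intro t v
      have := ((hρs n).differentiable one_ne_zero (p - t)).hasFDerivAt.comp t
        ((hasFDerivAt_id t).const_sub p)
      rw [show (fun t => ρ n (p - t)) = ρ n ∘ (fun t => p - t) from rfl]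
      erw [this.fderiv]
      simp
    simp only [hfd, mul_neg, integral_neg, neg_inj] at hw
    have hce := (hρc n).convolutionExists_left (ContinuousLinearMap.lsmul ℝ ℝ) (hρs n).continuous hgloc p
    have hce' : Integrable (fun t => ρ n (p - t) • g t) := by
      have := hce.integrable_swap
      simpa using this
    have e1 : ((ρ n ⋆[ContinuousLinearMap.lsmul ℝ ℝ, volume] g) p) i = ∫ t, g t i * ρ n (p - t) := by
      rw [convolution_eq_swap]
      have := (EuclideanSpace.proj (𝕜 := ℝ) i).integral_comp_comm hce'
      simp only [ContinuousLinearMap.lsmul_apply]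
      refine Eq.trans this.symm ?_
      refine integral_congr_ae (ae_of_all _ fun t => ?_)
      simp [mul_comm]
    rw [e1, ← hw]
    refine integral_congr_ae (ae_of_all _ fun t => ?_)
    simp [mul_comm]
  · intro r
    have h1 := mollify_L2 volume _ (hgm.indicator Metric.isClosed_closedBall.measurableSet) (hgL (r + 2)) φ hφ
    refine tendsto_of_tendsto_of_tendsto_of_le_of_le tendsto_const_nhds h1 (fun n => bot_le) fun n => ?_
    refine eLpNorm_mono fun p => ?_
    by_cases hp : p ∈ Metric.closedBall (0 : PP N) r
    · rw [indicator_of_mem hp]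
      apply le_of_eq
      congr 1
      have hp2 : p ∈ Metric.closedBall (0 : PP N) (r + 2) := Metric.closedBall_subset_closedBall (by linarith) hp
      rw [indicator_of_mem hp2]
      congr 1
      refine integral_congr_ae (ae_of_all _ fun t => ?_)
      by_cases ht : ρ n t = 0
      · simp [ht, show (φ n).normed volume t = 0 from ht]
      · have ht' : t ∈ Function.support (ρ n) := ht
        rw [(φ n).support_normed_eq] at ht'
        have h2 : (φ n).rOut ≤ 2 := by
          simp only [φ]
          rw [div_le_iff₀ (by positivity)]
          have : (0:ℝ) ≤ n := Nat.cast_nonneg n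
          linarith
        have : p - t ∈ Metric.closedBall (0 : PP N) (r + 2) := by
          simp only [Metric.mem_closedBall, Metric.mem_ball, dist_zero_right] at hp ht' ⊢
          exact (norm_sub_le p t).trans (by linarith)
        simp only [indicator_of_mem this]
        rfl
    · rw [indicator_of_notMem hp]; simp

theorem cs_int {Y F : Type*} [MeasurableSpace Y] {μ : Measure Y} [NormedAddCommGroup F]
    [InnerProductSpace ℝ F] {a b : Y → F} (ha : MemLp a 2 μ) (hb : MemLp b 2 μ) :
    Integrable (fun y => inner ℝ (a y) (b y)) μ := by
  refine (L2.integrable_inner (𝕜 := ℝ) (ha.toLp a) (hb.toLp b)).congr ?_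
  filter_upwards [ha.coeFn_toLp, hb.coeFn_toLp] with y h1 h2
  rw [h1, h2]

theorem cs_lim {Y F ι : Type*} [MeasurableSpace Y] {μ : Measure Y} [NormedAddCommGroup F]
    [InnerProductSpace ℝ F] {l : Filter ι} {A B : ι → Y → F} {a b : Y → F}
    (hA : ∀ i, MemLp (A i) 2 μ) (hB : ∀ i, MemLp (B i) 2 μ) (ha : MemLp a 2 μ) (hb : MemLp b 2 μ)
    (hAa : Tendsto (fun i => eLpNorm (fun y => A i y - a y) 2 μ) l (𝓝 0))
    (hBb : Tendsto (fun i => eLpNorm (fun y => B i y - b y) 2 μ) l (𝓝 0)) :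
    Tendsto (fun i => ∫ y, inner ℝ (A i y) (B i y) ∂μ) l (𝓝 (∫ y, inner ℝ (a y) (b y) ∂μ)) := by
  have : Fact ((1 : ℝ≥0∞) ≤ 2) := ⟨by norm_num⟩
  have e : ∀ {c d : Y → F} (hc : MemLp c 2 μ) (hd : MemLp d 2 μ),
      ∫ y, inner ℝ (c y) (d y) ∂μ = inner ℝ (hc.toLp c) (hd.toLp d) := by
    intro c d hc hd
    rw [L2.inner_def]
    refine integral_congr_ae ?_
    filter_upwards [hc.coeFn_toLp, hd.coeFn_toLp] with y h1 h2
    rw [h1, h2]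
  rw [e ha hb]
  simp_rw [fun i => e (hA i) (hB i)]
  have t1 : Tendsto (fun i => (hA i).toLp (A i)) l (𝓝 (ha.toLp a)) := by
    rw [tendsto_iff_edist_tendsto_0]
    refine hAa.congr fun i => ?_
    rw [Lp.edist_toLp_toLp]; rfl
  have t2 : Tendsto (fun i => (hB i).toLp (B i)) l (𝓝 (hb.toLp b)) := by
    rw [tendsto_iff_edist_tendsto_0]
    refine hBb.congr fun i => ?_
    rw [Lp.edist_toLp_toLp]; rfl
  exact t1.inner t2

theorem prodL2 {Y F : Type*} [MeasurableSpace Y] {μ : Measure Y} [NormedAddCommGroup F]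
    [NormedSpace ℝ F] {A : ℕ → Y → ℝ} {a : Y → ℝ} {B : ℕ → Y → F} {b : Y → F} {M : ℝ}
    (hA : ∀ n, AEStronglyMeasurable (A n) μ) (ha : AEStronglyMeasurable a μ)
    (hAM : ∀ n y, |A n y| ≤ M) (haM : ∀ y, |a y| ≤ M)
    (hB : ∀ n, MemLp (B n) 2 μ) (hb : MemLp b 2 μ)
    (hAa : ∀ᵐ y ∂μ, Tendsto (fun n => A n y) atTop (𝓝 (a y)))
    (hBb : Tendsto (fun n => eLpNorm (fun y => B n y - b y) 2 μ) atTop (𝓝 0)) :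
    Tendsto (fun n => eLpNorm (fun y => A n y • B n y - a y • b y) 2 μ) atTop (𝓝 0) := by
  have h2 : Tendsto (fun n => eLpNorm (fun y => (A n y - a y) • b y) 2 μ) atTop (𝓝 0) := by
    have hsq : Tendsto (fun n => eLpNorm (fun y => (A n y - a y) • b y) 2 μ ^ 2) atTop (𝓝 0) := by
      simp_rw [eLpNorm_two_sq]
      rw [show (0:ℝ≥0∞) = ∫⁻ y, 0 ∂μ by simp]
      refine tendsto_lintegral_of_dominated_convergence' (fun y => (ENNReal.ofReal (2 * M) * ‖b y‖ₑ) ^ 2)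
        ?_ ?_ ?_ ?_
      · intro n
        exact ((((hA n).sub ha).smul hb.1).enorm).pow_const 2
      · intro n
        refine ae_of_all _ fun y => ?_
        show ‖(A n y - a y) • b y‖ₑ ^ 2 ≤ (ENNReal.ofReal (2 * M) * ‖b y‖ₑ) ^ 2
        rw [enorm_smul]
        gcongr
        rw [Real.enorm_eq_ofReal_abs]
        apply ENNReal.ofReal_le_ofReal
        have := abs_sub (A n y) (a y)
        linarith [hAM n y, haM y]
      · simp_rw [mul_pow]
        rw [lintegral_const_mul' _ _ (by finiteness), ← eLpNorm_two_sq]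
        have := hb.2
        finiteness
      · filter_upwards [hAa] with y hy
        have : Tendsto (fun n => (A n y - a y) • b y) atTop (𝓝 ((a y - a y) • b y)) :=
          (hy.sub_const _).smul_const _
        have h3 := (ENNReal.continuous_pow 2).continuousAt.tendsto.comp this.enorm
        simpa [Function.comp_def] using h3
    have := hsq.ennrpow_const (1/2)
    simp only [one_div] at this
    rw [ENNReal.zero_rpow_of_pos (by norm_num)] at this
    refine this.congr fun n => ?_
    rw [← ENNReal.rpow_natCast, ← ENNReal.rpow_mul]; norm_num
  have h1 : Tendsto (fun n => ENNReal.ofReal M * eLpNorm (fun y => B n y - b y) 2 μ) atTop (𝓝 0) := by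
    simpa using ENNReal.Tendsto.const_mul (a := ENNReal.ofReal M) hBb (Or.inr ENNReal.ofReal_ne_top)
  have h3 := h1.add h2
  simp only [add_zero] at h3
  refine tendsto_of_tendsto_of_tendsto_of_le_of_le tendsto_const_nhds h3 (fun n => bot_le) fun n => ?_
  have e : (fun y => A n y • B n y - a y • b y)
      = (fun y => A n y • (B n y - b y)) + (fun y => (A n y - a y) • b y) := by
    funext y; simp [smul_sub, sub_smul]
  rw [e]
  refine (eLpNorm_add_le ((hA n).smul ((hB n).1.sub hb.1)) (((hA n).sub ha).smul hb.1) (by norm_num)).trans ?_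
  refine add_le_add ?_ le_rfl
  refine eLpNorm_le_mul_eLpNorm_of_ae_le_mul (ae_of_all _ fun y => ?_) 2
  show ‖A n y • (B n y - b y)‖ ≤ _
  rw [norm_smul]
  exact mul_le_mul_of_nonneg_right (hAM n y) (norm_nonneg _)

theorem shift_lim {N : ℕ} {F : Type*} [NormedAddCommGroup F] [MeasurableSpace F] [BorelSpace F]
    {B : ℕ → PP N → F} {b : PP N → F}
    (hB : ∀ n, MemLp (B n) 2) (hb : MemLp b 2)
    (hBb : Tendsto (fun n => eLpNorm (fun y => B n y - b y) 2) atTop (𝓝 0)) :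
    Tendsto (fun z : ℕ × ℝ => eLpNorm (fun p : PP N => B z.1 (p + (z.2, 0)) - b p) 2)
      (atTop ×ˢ 𝓝 0) (𝓝 0) := by
  have t0 : Tendsto (fun τ : ℝ => ((τ, 0) : PP N)) (𝓝 0) (𝓝 0) := by
    have : Continuous (fun τ : ℝ => ((τ, 0) : PP N)) := by fun_prop
    exact this.tendsto 0
  have h1 := ((transl_L2 volume b hb).comp t0).comp (tendsto_snd (f := (atTop : Filter ℕ)))
  have h2 := hBb.comp (tendsto_fst (g := 𝓝 (0:ℝ)))
  have h3 := h2.add h1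
  simp only [add_zero] at h3
  refine tendsto_of_tendsto_of_tendsto_of_le_of_le tendsto_const_nhds h3 (fun n => bot_le) fun z => ?_
  have mp := measurePreserving_add_right (volume : Measure (PP N)) (z.2, 0)
  have e : (fun p : PP N => B z.1 (p + (z.2, 0)) - b p)
    = (fun p => B z.1 (p + (z.2, 0)) - b (p + (z.2, 0))) + (fun p => b (p + (z.2, 0)) - b p) := by
    funext p; simp
  rw [e]
  refine (eLpNorm_add_le ?_ ?_ (by norm_num)).trans ?_
  · exact (((hB z.1).sub hb).1.comp_measurePreserving mp)
  · exact (hb.1.comp_measurePreserving mp).sub hb.1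
  · have := eLpNorm_comp_measurePreserving (p := 2) ((hB z.1).sub hb).1 mp
    exact add_le_add (le_of_eq this) le_rfl

/-- Differentiation under the integral sign with a bounded, compactly supported integrand. -/
theorem deriv_int {N : ℕ} {F F' : ℝ → PP N → ℝ} {τ M r : ℝ}
    (hFm : ∀ t, AEStronglyMeasurable (F t) volume) (hFm' : AEStronglyMeasurable (F' τ) volume)
    (hd : ∀ t p, HasDerivAt (fun t => F t p) (F' t p) t)
    (hM : ∀ p, |F τ p| ≤ M) (hM' : ∀ t ∈ Metric.ball τ 1, ∀ p, |F' t p| ≤ M)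
    (hr : ∀ t ∈ Metric.ball τ 1, ∀ p ∉ Metric.closedBall (0 : PP N) r, F t p = 0 ∧ F' t p = 0) :
    HasDerivAt (fun t => ∫ p, F t p) (∫ p, F' τ p) τ := by
  have hbi : Integrable ((Metric.closedBall (0 : PP N) r).indicator (fun _ => M)) := by
    rw [integrable_indicator_iff Metric.isClosed_closedBall.measurableSet]
    exact integrableOn_const (isCompact_closedBall _ _).measure_ne_top
  have hb : ∀ (k : PP N → ℝ), (∀ p, |k p| ≤ M) → (∀ p ∉ Metric.closedBall (0 : PP N) r, k p = 0) →
      ∀ p, ‖k p‖ ≤ (Metric.closedBall (0 : PP N) r).indicator (fun _ => M) p := by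
    intro k h1 h2 p
    by_cases hp : p ∈ Metric.closedBall (0 : PP N) r
    · rw [indicator_of_mem hp]; exact h1 p
    · rw [indicator_of_notMem hp, h2 p hp]; simp
  have hτ : τ ∈ Metric.ball τ 1 := Metric.mem_ball_self one_pos
  refine (hasDerivAt_integral_of_dominated_loc_of_deriv_le (Metric.ball_mem_nhds τ one_pos)
    (Eventually.of_forall hFm) ?_ hFm' ?_ hbi ?_).2
  · exact hbi.mono' (hFm τ) (ae_of_all _ (hb _ hM fun p hp => (hr τ hτ p hp).1))
  · exact ae_of_all _ fun p t ht => hb _ (hM' t ht) (fun p hp => (hr t ht p hp).2) p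
  · exact ae_of_all _ fun p t _ => hd t p

theorem memLp_shift {N : ℕ} {F : Type*} [NormedAddCommGroup F]
    {b : PP N → F} (hb : MemLp b 2) (τ : ℝ) : MemLp (fun p : PP N => b (p + (τ, 0))) 2 :=
  hb.comp_measurePreserving (measurePreserving_add_right (volume : Measure (PP N)) (τ, 0))

theorem shift_off {N : ℕ} {r τ : ℝ} (hτ : |τ| ≤ 2) {p : PP N}
    (hp : p ∉ Metric.closedBall (0 : PP N) (r + 2)) : p + (τ, 0) ∉ Metric.closedBall (0 : PP N) r := by
  simp only [Metric.mem_closedBall, dist_zero_right, not_le] at hp ⊢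
  have h1 : ‖((τ, 0) : PP N)‖ = |τ| := by simp [Prod.norm_def]
  have h2 := norm_sub_le (p + (τ, 0)) ((τ, 0) : PP N)
  rw [add_sub_cancel_right, h1] at h2
  linarith

theorem steklov_der {N : ℕ} {U f ψ : PP N → ℝ} {g : PP N → EE N}
    {r0 C : ℝ} (hU : Measurable U) (hUC : ∀ p, |U p| ≤ C)
    (W2 : ∀ ψ : PP N → ℝ, ContDiff ℝ 1 ψ → HasCompactSupport ψ →
        ∫ p, U p * fderiv ℝ ψ p (1, 0) = ∫ p, (fderiv ℝ ψ p (0, g p) + f p * ψ p))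
    (hs : ContDiff ℝ 1 ψ) 
    (h0 : ∀ p ∉ Metric.closedBall (0 : PP N) r0, ψ p = 0) (τ : ℝ) (hτ : |τ| ≤ 1) :
    HasDerivAt (fun t => ∫ p, U p * ψ (p + (t, 0)))
      (∫ p, (fderiv ℝ ψ (p + (τ, 0)) (0, g p) + f p * ψ (p + (τ, 0)))) τ := by
  have hC0 : 0 ≤ C := (abs_nonneg _).trans (hUC 0)
  have hcs : HasCompactSupport ψ := HasCompactSupport.intro (isCompact_closedBall _ _) h0
  have hfc : Continuous (fderiv ℝ ψ) := hs.continuous_fderiv one_ne_zero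
  obtain ⟨M1, hM1⟩ := hcs.exists_bound_of_continuous hs.continuous
  obtain ⟨M2, hM2⟩ := (hcs.fderiv (𝕜 := ℝ)).exists_bound_of_continuous hfc
  have hfd0 : ∀ p ∉ Metric.closedBall (0 : PP N) r0, fderiv ℝ ψ p = 0 := by
    intro p hp
    have : ψ =ᶠ[𝓝 p] fun _ => 0 := by
      filter_upwards [Metric.isClosed_closedBall.isOpen_compl.mem_nhds hp] with y hy
      exact h0 y hy
    rw [this.fderiv_eq]; simp
  have key := deriv_int (N := N) (F := fun t p => U p * ψ (p + (t, 0)))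
    (F' := fun t p => U p * fderiv ℝ ψ (p + (t, 0)) (1, 0)) (τ := τ) (M := max (C * M1) (C * M2))
    (r := r0 + 2) ?_ ?_ ?_ ?_ ?_ ?_
  · have hw := W2 (fun p => ψ (p + (τ, 0))) (hs.comp (contDiff_id.add contDiff_const)) ?_
    · simp only [fderiv_comp_add_right] at hw
      rw [hw] at key
      exact key
    · refine HasCompactSupport.intro (isCompact_closedBall (0 : PP N) (r0 + 2)) fun p hp => ?_
      exact h0 _ (shift_off (by linarith) hp)
  · intro t
    exact (hU.mul (hs.continuous.measurable.comp (by fun_prop))).aestronglyMeasurable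
  · have : Continuous (fun p : PP N => fderiv ℝ ψ (p + (τ, 0)) (1, 0)) := by fun_prop
    exact (hU.mul this.measurable).aestronglyMeasurable
  · intro t p
    apply HasDerivAt.const_mul
    have hd := (hs.differentiable one_ne_zero (p + (t, 0))).hasFDerivAt
    have hc : HasDerivAt (fun t : ℝ => p + (t, (0 : EE N))) (1, 0) t :=
      ((hasDerivAt_id t).prodMk (hasDerivAt_const t 0)).const_add p
    exact hd.comp_hasDerivAt t hc
  · intro p
    refine le_trans ?_ (le_max_left _ _)
    rw [abs_mul]
    exact mul_le_mul (hUC p) (hM1 _) (abs_nonneg _) hC0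
  · intro t _ p
    refine le_trans ?_ (le_max_right _ _)
    rw [abs_mul]
    refine mul_le_mul (hUC p) ?_ (abs_nonneg _) hC0
    refine ((fderiv ℝ ψ (p + (t, 0))).le_opNorm _).trans ?_
    have : ‖((1, 0) : PP N)‖ = 1 := by simp [Prod.norm_def]
    rw [this, mul_one]; exact hM2 _
  · intro t ht p hp
    have ht2 : |t| ≤ 2 := by
      rw [Metric.mem_ball, Real.dist_eq] at ht
      have := abs_sub_abs_le_abs_sub t τ
      linarith
    have := shift_off ht2 hp
    simp [h0 _ this, hfd0 _ this]

theorem steklov {N : ℕ} {U f ψ : PP N → ℝ} {g D : PP N → EE N} {ψn : ℕ → PP N → ℝ}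
    {Dn : ℕ → PP N → EE N} {r0 C : ℝ} (hU : Measurable U) (hUC : ∀ p, |U p| ≤ C)
    (hf : ∀ r, MemLp ((Metric.closedBall (0 : PP N) r).indicator f) 2)
    (hg : ∀ r, MemLp ((Metric.closedBall (0 : PP N) r).indicator g) 2)
    (W2 : ∀ ψ : PP N → ℝ, ContDiff ℝ 1 ψ → HasCompactSupport ψ →
        ∫ p, U p * fderiv ℝ ψ p (1, 0) = ∫ p, (fderiv ℝ ψ p (0, g p) + f p * ψ p))
    (hs : ∀ n, ContDiff ℝ 1 (ψn n)) (hDn : ∀ n p y, fderiv ℝ (ψn n) p (0, y) = inner ℝ (Dn n p) y)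
    (h0 : ∀ n, ∀ p ∉ Metric.closedBall (0 : PP N) r0, ψn n p = 0)
    (h1 : ∀ n, ∀ p ∉ Metric.closedBall (0 : PP N) r0, Dn n p = 0)
    (h2 : ∀ p ∉ Metric.closedBall (0 : PP N) r0, ψ p = 0)
    (h3 : ∀ p ∉ Metric.closedBall (0 : PP N) r0, D p = 0)
    (hψnL : ∀ n, MemLp (ψn n) 2) (hDnL : ∀ n, MemLp (Dn n) 2) (hψL : MemLp ψ 2) (hDL : MemLp D 2)
    (hψlim : Tendsto (fun n => eLpNorm (fun p => ψn n p - ψ p) 2) atTop (𝓝 0))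
    (hDlim : Tendsto (fun n => eLpNorm (fun p => Dn n p - D p) 2) atTop (𝓝 0)) :
    Tendsto (fun h : ℝ => ((∫ p, U p * ψ (p + (h, 0))) - ∫ p, U p * ψ p) / h) (𝓝[>] 0)
      (𝓝 ((∫ p, inner ℝ (g p) (D p)) + ∫ p, f p * ψ p)) := by
  have hC0 : 0 ≤ C := (abs_nonneg _).trans (hUC 0)
  have hcs : ∀ n, HasCompactSupport (ψn n) := fun n =>
    HasCompactSupport.intro (isCompact_closedBall _ _) (h0 n)
  have hUL : MemLp ((Metric.closedBall (0 : PP N) (r0 + 2)).indicator U) 2 := by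
    rw [memLp_indicator_iff_restrict Metric.isClosed_closedBall.measurableSet]
    have : IsFiniteMeasure (volume.restrict (Metric.closedBall (0 : PP N) (r0 + 2))) :=
      ⟨by rw [Measure.restrict_apply_univ]; exact (isCompact_closedBall _ _).measure_lt_top⟩
    exact MemLp.of_bound hU.aestronglyMeasurable C (ae_of_all _ hUC)
  -- replacing by cutoffs
  have cutg : ∀ (v : PP N → EE N) (a : PP N → EE N) (τ : ℝ), |τ| ≤ 2 →
      (∀ p ∉ Metric.closedBall (0 : PP N) r0, v p = 0) → ∀ p, inner ℝ (a p) (v (p + (τ, 0))) =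
        inner ℝ ((Metric.closedBall (0 : PP N) (r0 + 2)).indicator a p) (v (p + (τ, 0))) := by
    intro v a τ hτ hv p
    by_cases hp : p ∈ Metric.closedBall (0 : PP N) (r0 + 2)
    · rw [indicator_of_mem hp]
    · rw [hv _ (shift_off hτ hp)]; simp
  have cutf : ∀ (v : PP N → ℝ) (a : PP N → ℝ) (τ : ℝ), |τ| ≤ 2 →
      (∀ p ∉ Metric.closedBall (0 : PP N) r0, v p = 0) → ∀ p, (a p) * (v (p + (τ, 0))) =
        inner ℝ ((Metric.closedBall (0 : PP N) (r0 + 2)).indicator a p) (v (p + (τ, 0))) := by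
    intro v a τ hτ hv p
    by_cases hp : p ∈ Metric.closedBall (0 : PP N) (r0 + 2)
    · rw [indicator_of_mem hp]; simp [mul_comm]
    · rw [hv _ (shift_off hτ hp)]; simp
  set r : ℕ × ℝ → ℝ := fun z =>
    (∫ p, inner ℝ ((Metric.closedBall (0 : PP N) (r0 + 2)).indicator g p) (Dn z.1 (p + (z.2, 0))))
    + ∫ p, inner ℝ ((Metric.closedBall (0 : PP N) (r0 + 2)).indicator f p) (ψn z.1 (p + (z.2, 0))) with hr
  set rinf := (∫ p, inner ℝ (g p) (D p)) + ∫ p, f p * ψ p with hrinf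
  have hz0 : |(0:ℝ)| ≤ 2 := by norm_num
  have hrlim : Tendsto r (atTop ×ˢ 𝓝 0) (𝓝 rinf) := by
    have e1 : rinf = (∫ p, inner ℝ ((Metric.closedBall (0 : PP N) (r0 + 2)).indicator g p) (D p))
        + ∫ p, inner ℝ ((Metric.closedBall (0 : PP N) (r0 + 2)).indicator f p) (ψ p) := by
      rw [hrinf]
      congr 1
      · refine integral_congr_ae (ae_of_all _ fun p => ?_)
        have := cutg D g 0 hz0 h3 p
        rw [show p + ((0:ℝ), (0 : EE N)) = p from add_zero p] at this
        exact this
      · refine integral_congr_ae (ae_of_all _ fun p => ?_)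
        have := cutf ψ f 0 hz0 h2 p
        rw [show p + ((0:ℝ), (0 : EE N)) = p from add_zero p] at this
        exact this
    rw [e1]
    refine Tendsto.add ?_ ?_
    · exact cs_lim (fun _ => hg _) (fun z => memLp_shift (hDnL z.1) z.2) (hg _) hDL
        (by simp) (shift_lim hDnL hDL hDlim)
    · exact cs_lim (fun _ => hf _) (fun z => memLp_shift (hψnL z.1) z.2) (hf _) hψL
        (by simp) (shift_lim hψnL hψL hψlim)
  have hder : ∀ n τ, |τ| ≤ 1 → HasDerivAt (fun t => ∫ p, U p * ψn n (p + (t, 0))) (r (n, τ)) τ := by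
    intro n τ hτ
    have key := steklov_der hU hUC W2 (hs n) (h0 n) τ hτ
    convert key using 1
    simp only [hr]
    rw [← integral_add]
    · refine integral_congr_ae (ae_of_all _ fun p => ?_)
      simp only [hDn]
      rw [← cutf (ψn n) f τ (by linarith) (h0 n), ← cutg (Dn n) g τ (by linarith) (h1 n), real_inner_comm]
    · exact cs_int (hg _) (memLp_shift (hDnL n) τ)
    · exact cs_int (hf _) (memLp_shift (hψnL n) τ)
  have helim : ∀ h, |h| ≤ 2 → Tendsto (fun n => ∫ p, U p * ψn n (p + (h, 0))) atTop
      (𝓝 (∫ p, U p * ψ (p + (h, 0)))) := by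
    intro h hh
    simp_rw [fun n => cutf (ψn n) U h hh (h0 n), cutf ψ U h hh h2]
    refine cs_lim (fun _ => hUL) (fun n => memLp_shift (hψnL n) h) hUL (memLp_shift hψL h) (by simp) ?_
    refine hψlim.congr fun n => ?_
    exact (eLpNorm_comp_measurePreserving ((hψnL n).sub hψL).1
      (measurePreserving_add_right (volume : Measure (PP N)) (h, 0))).symm
  rw [Metric.tendsto_nhds]
  intro ε hε
  have hev := (Metric.tendsto_nhds.1 hrlim) (ε / 2) (half_pos hε)
  obtain ⟨s, hsm, t, htm, hst⟩ := mem_prod_iff.1 hev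
  obtain ⟨δ, hδ, hball⟩ := Metric.mem_nhds_iff.1 htm
  have hmem : Ioo (0:ℝ) (min δ 1) ∈ 𝓝[>] (0:ℝ) := Ioo_mem_nhdsGT (by positivity)
  filter_upwards [hmem] with h hh
  have hh1 : h < 1 := hh.2.trans_le (min_le_right _ _)
  have hhδ : h < δ := hh.2.trans_le (min_le_left _ _)
  have hlim := (helim h (by rw [abs_of_pos hh.1]; linarith)).sub (helim 0 hz0)
  simp only [show ∀ p : PP N, p + ((0:ℝ), (0 : EE N)) = p from fun p => add_zero p] at hlim
  have hle : |((∫ p, U p * ψ (p + (h, 0))) - ∫ p, U p * ψ p) - h * rinf| ≤ ε / 2 * h := by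
    refine le_of_tendsto ((hlim.sub_const (h * rinf)).abs) ?_
    filter_upwards [hsm] with n hn
    have hmv := Convex.norm_image_sub_le_of_norm_hasDerivWithin_le (𝕜 := ℝ) (s := Icc 0 h)
      (f := fun t => (∫ p, U p * ψn n (p + (t, 0))) - t * rinf) (f' := fun t => r (n, t) - rinf)
      (C := ε / 2) (x := 0) (y := h) ?_ ?_ (convex_Icc _ _) ⟨le_rfl, hh.1.le⟩ ⟨hh.1.le, le_rfl⟩
    · simp only [show ∀ p : PP N, p + ((0:ℝ), (0 : EE N)) = p from fun p => add_zero p, zero_mul,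
        sub_zero, Real.norm_eq_abs, abs_of_pos hh.1] at hmv
      rw [show ∀ x y z : ℝ, x - y - z = x - z - y by intros; ring]
      exact hmv
    · intro τ hτ
      have := (hder n τ (by rw [abs_of_nonneg hτ.1]; linarith [hτ.2])).sub
        ((hasDerivAt_id τ).mul_const rinf)
      simp only [one_mul] at this
      exact this.hasDerivWithinAt
    · intro τ hτ
      have : (n, τ) ∈ s ×ˢ t := ⟨hn, hball (by
        rw [Metric.mem_ball, Real.dist_eq, sub_zero, abs_of_nonneg hτ.1]; linarith [hτ.2])⟩
      exact (le_of_lt (hst this))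
  rw [Real.dist_eq]
  have e : ((∫ p, U p * ψ (p + (h, 0))) - ∫ p, U p * ψ p) / h - rinf
      = (((∫ p, U p * ψ (p + (h, 0))) - ∫ p, U p * ψ p) - h * rinf) / h := by
    have := hh.1.ne'; field_simp
  rw [e, abs_div, abs_of_pos hh.1, div_lt_iff₀ hh.1]
  refine hle.trans_lt ?_
  have := hh.1
  gcongr
  linarith

theorem pos_pow_deriv (n : ℕ) (y : ℝ) :
    HasDerivAt (fun y : ℝ => (max y 0) ^ (n + 2)) ((n + 2) * (max y 0) ^ (n + 1)) y := by
  have hne : ∀ y : ℝ, y ≠ 0 →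
      HasDerivAt (fun y : ℝ => (max y 0) ^ (n + 2)) ((n + 2) * (max y 0) ^ (n + 1)) y := by
    intro y hy
    rcases lt_or_gt_of_ne hy with h | h
    · have : (fun y : ℝ => (max y 0) ^ (n + 2)) =ᶠ[𝓝 y] fun _ => 0 := by
        filter_upwards [gt_mem_nhds h] with z hz
        simp [max_eq_right (le_of_lt hz)]
      rw [max_eq_right h.le]
      simpa using (hasDerivAt_const y (0:ℝ)).congr_of_eventuallyEq this
    · have : (fun y : ℝ => (max y 0) ^ (n + 2)) =ᶠ[𝓝 y] fun y => y ^ (n + 2) := by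
        filter_upwards [lt_mem_nhds h] with z hz
        simp [max_eq_left (le_of_lt hz)]
      rw [max_eq_left h.le]
      have h2 := (hasDerivAt_pow (n + 2) y).congr_of_eventuallyEq this
      simpa using h2
  by_cases hy : y = 0
  · subst hy
    refine hasDerivAt_of_hasDerivAt_of_ne (g := fun y => (n + 2) * (max y 0) ^ (n + 1)) (fun y hy => hne y hy) ?_ ?_
    · fun_prop
    · fun_prop
  · exact hne y hy

theorem pos_pow_contDiff (n : ℕ) : ContDiff ℝ 1 (fun y : ℝ => (max y 0) ^ (n + 2)) := by
  rw [contDiff_one_iff_deriv]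
  refine ⟨fun y => (pos_pow_deriv n y).differentiableAt, ?_⟩
  have : deriv (fun y : ℝ => (max y 0) ^ (n + 2)) = fun y : ℝ => ((n:ℝ) + 2) * (max y 0) ^ (n + 1) :=
    funext fun y => (pos_pow_deriv n y).deriv
  rw [this]; fun_prop

/-- The square of the positive part. -/
def bet (y : ℝ) : ℝ := (max y 0) ^ 2
def bet' (y : ℝ) : ℝ := 2 * max y 0
def Gam (y : ℝ) : ℝ := (max y 0) ^ 3 / 3

theorem bet_deriv (y : ℝ) : HasDerivAt bet (bet' y) y := by
  have := pos_pow_deriv 0 y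
  simp at this
  exact this

theorem Gam_deriv (y : ℝ) : HasDerivAt Gam (bet y) y := by
  have := (pos_pow_deriv 1 y).div_const 3
  have e : bet y = (((1:ℕ):ℝ) + 2) * (max y 0) ^ (1 + 1) / 3 := by unfold bet; push_cast; ring
  rw [e]; exact this

theorem bet_contDiff : ContDiff ℝ 1 bet := pos_pow_contDiff 0
theorem bet'_cont : Continuous bet' := by unfold bet'; fun_prop
theorem bet_cont : Continuous bet := by unfold bet; fun_prop
theorem Gam_cont : Continuous Gam := by unfold Gam; fun_prop
theorem Gam_contDiff : ContDiff ℝ 1 Gam := (pos_pow_contDiff 1).div_const 3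
theorem bet_nonneg (y : ℝ) : 0 ≤ bet y := by unfold bet; positivity
theorem bet'_nonneg (y : ℝ) : 0 ≤ bet' y := by unfold bet'; positivity
theorem Gam_nonneg (y : ℝ) : 0 ≤ Gam y := by unfold Gam; positivity
theorem bet_of_nonpos {y : ℝ} (h : y ≤ 0) : bet y = 0 := by simp [bet, max_eq_right h]
theorem bet'_of_nonpos {y : ℝ} (h : y ≤ 0) : bet' y = 0 := by simp [bet', max_eq_right h]
theorem Gam_of_nonpos {y : ℝ} (h : y ≤ 0) : Gam y = 0 := by simp [Gam, max_eq_right h]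
theorem bet_mono : Monotone bet := by
  intro x y h; unfold bet; gcongr
theorem bet'_mono : Monotone bet' := by
  intro x y h; unfold bet'; gcongr
theorem Gam_mono : Monotone Gam := by
  intro x y h; unfold Gam; gcongr

def BB (m V r : ℝ) : ℝ := ∫ ρ in (0:ℝ)..r, bet (ρ ^ m - V)
def DD (m V r : ℝ) : ℝ := ∫ ρ in (0:ℝ)..r, bet' (ρ ^ m - V)


theorem rpow_cont {m : ℝ} (hm : 1 < m) : Continuous (fun ρ : ℝ => ρ ^ m) := Real.continuous_rpow_const (by linarith)

theorem BB_cont {m : ℝ} (hm : 1 < m) : Continuous (fun z : ℝ × ℝ => BB m z.1 z.2) := by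
  have h := rpow_cont hm
  refine intervalIntegral.continuous_parametric_intervalIntegral_of_continuous (f := fun z : ℝ × ℝ => fun ρ : ℝ => bet (ρ ^ m - z.1)) ?_ continuous_snd
  exact bet_cont.comp ((h.comp continuous_snd).sub (continuous_fst.comp continuous_fst))

theorem DD_cont {m : ℝ} (hm : 1 < m) : Continuous (fun z : ℝ × ℝ => DD m z.1 z.2) := by
  have h := rpow_cont hm
  refine intervalIntegral.continuous_parametric_intervalIntegral_of_continuous (f := fun z : ℝ × ℝ => fun ρ : ℝ => bet' (ρ ^ m - z.1)) ?_ continuous_snd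
  exact bet'_cont.comp ((h.comp continuous_snd).sub (continuous_fst.comp continuous_fst))

theorem bet_int {m : ℝ} (hm : 1 < m) (V a b : ℝ) : IntervalIntegrable (fun ρ : ℝ => bet (ρ ^ m - V)) volume a b :=
  (bet_cont.comp ((rpow_cont hm).sub continuous_const)).intervalIntegrable _ _

theorem bet'_int {m : ℝ} (hm : 1 < m) (V a b : ℝ) : IntervalIntegrable (fun ρ : ℝ => bet' (ρ ^ m - V)) volume a b :=
  (bet'_cont.comp ((rpow_cont hm).sub continuous_const)).intervalIntegrable _ _

theorem BB_convex {m : ℝ} (hm : 1 < m) {V a b : ℝ} (ha : 0 ≤ a) (hb : 0 ≤ b) :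
    BB m V a - BB m V b ≤ (a - b) * bet (a ^ m - V) := by
  have e : BB m V a - BB m V b = ∫ ρ in b..a, bet (ρ ^ m - V) :=
    intervalIntegral.integral_interval_sub_left (bet_int hm _ _ _) (bet_int hm _ _ _)
  rw [e]
  rcases le_total b a with h | h
  · have := intervalIntegral.integral_mono_on h (bet_int hm V b a)
      (intervalIntegrable_const (c := bet (a ^ m - V))) (fun ρ hρ => by
        apply bet_mono
        have := Real.rpow_le_rpow (hb.trans hρ.1) hρ.2 (by linarith : 0 ≤ m)
        linarith)
    simpa using this
  · rw [intervalIntegral.integral_symm]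
    have := intervalIntegral.integral_mono_on h 
      (intervalIntegrable_const (c := bet (a ^ m - V))) (bet_int hm V a b) (fun ρ hρ => by
        apply bet_mono
        have := Real.rpow_le_rpow ha hρ.1 (by linarith : 0 ≤ m)
        linarith)
    simp at this
    linarith

theorem BB_nonneg {m : ℝ} {V r : ℝ} (hr : 0 ≤ r) : 0 ≤ BB m V r :=
  intervalIntegral.integral_nonneg hr fun _ _ => bet_nonneg _

theorem DD_nonneg {m : ℝ} {V r : ℝ} (hr : 0 ≤ r) : 0 ≤ DD m V r :=
  intervalIntegral.integral_nonneg hr fun _ _ => bet'_nonneg _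

theorem BB_zero {m : ℝ} (hm : 1 < m) {V r : ℝ} (hr : 0 ≤ r) (h : r ^ m ≤ V) : BB m V r = 0 := by
  unfold BB
  rw [intervalIntegral.integral_congr (g := fun _ => (0:ℝ))]
  · simp
  · intro ρ hρ
    rw [uIcc_of_le hr] at hρ
    apply bet_of_nonpos
    have := Real.rpow_le_rpow hρ.1 hρ.2 (by linarith : 0 ≤ m)
    linarith

theorem DD_zero {m : ℝ} (hm : 1 < m) {V r : ℝ} (hr : 0 ≤ r) (h : r ^ m ≤ V) : DD m V r = 0 := by
  unfold DD
  rw [intervalIntegral.integral_congr (g := fun _ => (0:ℝ))]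
  · simp
  · intro ρ hρ
    rw [uIcc_of_le hr] at hρ
    apply bet'_of_nonpos
    have := Real.rpow_le_rpow hρ.1 hρ.2 (by linarith : 0 ≤ m)
    linarith

theorem BB_deriv {m : ℝ} (hm : 1 < m) (V r : ℝ) : HasDerivAt (fun V => BB m V r) (-DD m V r) V := by
  have h := rpow_cont hm
  have hc : Continuous (fun z : ℝ × ℝ => bet' (z.2 ^ m - z.1)) := by
    exact bet'_cont.comp ((h.comp continuous_snd).sub continuous_fst)
  obtain ⟨M, hM⟩ := ((isCompact_closedBall V 1).prod (isCompact_uIcc (a := 0) (b := r))).exists_bound_of_continuousOn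
    hc.continuousOn
  have := (intervalIntegral.hasDerivAt_integral_of_dominated_loc_of_deriv_le (μ := volume) (a := 0) (b := r)
    (F := fun V ρ => bet (ρ ^ m - V)) (F' := fun V ρ => - bet' (ρ ^ m - V)) (x₀ := V)
    (s := Metric.ball V 1) (bound := fun _ => M) (Metric.ball_mem_nhds V one_pos) ?_ (bet_int hm V 0 r) ?_ ?_ ?_ ?_).2
  · unfold BB DD
    rw [← intervalIntegral.integral_neg]
    exact this
  · exact Eventually.of_forall fun V => (bet_cont.comp (h.sub continuous_const)).aestronglyMeasurable
  · exact (bet'_cont.comp (h.sub continuous_const)).neg.aestronglyMeasurable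
  · refine ae_of_all _ fun ρ hρ V' hV' => ?_
    rw [norm_neg]
    exact hM (V', ρ) ⟨Metric.ball_subset_closedBall hV', uIoc_subset_uIcc hρ⟩
  · exact intervalIntegrable_const
  · refine ae_of_all _ fun ρ _ V' _ => ?_
    have := (bet_deriv (ρ ^ m - V')).comp V' ((hasDerivAt_id V').const_sub (ρ ^ m))
    rw [mul_neg_one] at this
    exact this

theorem Gam_le_BB {m : ℝ} (hm : 1 < m) {V u C : ℝ} (hV : 0 ≤ V) (hu : 0 ≤ u) (huC : u ≤ C) :
    Gam (u ^ m - V) ≤ m * C ^ (m - 1) * BB m V u := by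
  have h := rpow_cont hm
  have h' : Continuous (fun ρ : ℝ => ρ ^ (m - 1)) := Real.continuous_rpow_const (by linarith)
  have hc : Continuous (fun ρ : ℝ => bet (ρ ^ m - V) * (m * ρ ^ (m - 1))) :=
    (bet_cont.comp (h.sub continuous_const)).mul (continuous_const.mul h')
  have e := intervalIntegral.integral_eq_sub_of_hasDerivAt (a := 0) (b := u)
    (f := fun ρ : ℝ => Gam (ρ ^ m - V)) (f' := fun ρ : ℝ => bet (ρ ^ m - V) * (m * ρ ^ (m - 1)))
    (fun ρ _ => by
      have := (Gam_deriv (ρ ^ m - V)).comp ρ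
        ((Real.hasDerivAt_rpow_const (x := ρ) (p := m) (Or.inr hm.le)).sub_const V)
      exact this) (hc.intervalIntegrable _ _)
  have h0 : Gam ((0:ℝ) ^ m - V) = 0 := by
    apply Gam_of_nonpos
    rw [Real.zero_rpow (by linarith)]; linarith
  rw [h0, sub_zero] at e
  rw [← e, BB, ← intervalIntegral.integral_const_mul]
  refine intervalIntegral.integral_mono_on hu (hc.intervalIntegrable _ _) ((bet_int hm V 0 u).const_mul _) fun ρ hρ => ?_
  rw [mul_comm]
  refine mul_le_mul_of_nonneg_right ?_ (bet_nonneg _)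
  have : ρ ^ (m - 1) ≤ C ^ (m - 1) := Real.rpow_le_rpow hρ.1 (hρ.2.trans huC) (by linarith)
  gcongr

theorem DD_le_bet {m : ℝ} (hm : 1 < m) {v u : ℝ} (hv : 0 ≤ v) (hu : 0 ≤ u) :
    m * v ^ (m - 1) * DD m (v ^ m) u ≤ bet (u ^ m - v ^ m) := by
  have h := rpow_cont hm
  have h' : Continuous (fun ρ : ℝ => ρ ^ (m - 1)) := Real.continuous_rpow_const (by linarith)
  have hc : Continuous (fun ρ : ℝ => bet' (ρ ^ m - v ^ m) * (m * ρ ^ (m - 1))) :=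
    (bet'_cont.comp (h.sub continuous_const)).mul (continuous_const.mul h')
  have e := intervalIntegral.integral_eq_sub_of_hasDerivAt (a := 0) (b := u)
    (f := fun ρ : ℝ => bet (ρ ^ m - v ^ m)) (f' := fun ρ : ℝ => bet' (ρ ^ m - v ^ m) * (m * ρ ^ (m - 1)))
    (fun ρ _ => by
      have := (bet_deriv (ρ ^ m - v ^ m)).comp ρ
        ((Real.hasDerivAt_rpow_const (x := ρ) (p := m) (Or.inr hm.le)).sub_const (v ^ m))
      exact this) (hc.intervalIntegrable _ _)
  have h0 : bet ((0:ℝ) ^ m - v ^ m) = 0 := by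
    apply bet_of_nonpos
    rw [Real.zero_rpow (by linarith)]
    have : 0 ≤ v ^ m := by positivity
    linarith
  rw [h0, sub_zero] at e
  rw [← e, DD, ← intervalIntegral.integral_const_mul]
  refine intervalIntegral.integral_mono_on hu ((bet'_int hm _ 0 u).const_mul _) (hc.intervalIntegrable _ _) fun ρ hρ => ?_
  rw [mul_comm]
  by_cases hρv : v ≤ ρ
  · refine mul_le_mul_of_nonneg_left ?_ (bet'_nonneg _)
    have : v ^ (m - 1) ≤ ρ ^ (m - 1) := Real.rpow_le_rpow hv hρv (by linarith)
    gcongr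
  · have : bet' (ρ ^ m - v ^ m) = 0 := by
      apply bet'_of_nonpos
      have := Real.rpow_le_rpow hρ.1 (not_le.1 hρv).le (by linarith : 0 ≤ m)
      linarith
    rw [this]; simp

theorem fderiv_off {N : ℕ} {F : Type*} [NormedAddCommGroup F] [NormedSpace ℝ F] {ψ : PP N → F} {r : ℝ}
    (h0 : ∀ p ∉ Metric.closedBall (0 : PP N) r, ψ p = 0) :
    ∀ p ∉ Metric.closedBall (0 : PP N) r, fderiv ℝ ψ p = 0 := by
  intro p hp
  have : ψ =ᶠ[𝓝 p] fun _ => 0 := by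
    filter_upwards [Metric.isClosed_closedBall.isOpen_compl.mem_nhds hp] with y hy
    exact h0 y hy
  rw [this.fderiv_eq]; simp

theorem int_bdd {N : ℕ} {F : PP N → ℝ} {M r : ℝ} (hF : Measurable F) (hM : ∀ p, |F p| ≤ M)
    (h0 : ∀ p ∉ Metric.closedBall (0 : PP N) r, F p = 0) : Integrable F := by
  have hbi : Integrable ((Metric.closedBall (0 : PP N) r).indicator (fun _ => M)) := by
    rw [integrable_indicator_iff Metric.isClosed_closedBall.measurableSet]
    exact integrableOn_const (isCompact_closedBall _ _).measure_ne_top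
  refine hbi.mono' hF.aestronglyMeasurable (ae_of_all _ fun p => ?_)
  by_cases hp : p ∈ Metric.closedBall (0 : PP N) r
  · rw [indicator_of_mem hp]; exact hM p
  · rw [indicator_of_notMem hp, h0 p hp]; simp

theorem bdd_two {N : ℕ} {H : PP N → ℝ → ℝ} {C r : ℝ}
    (hH : Continuous (fun z : PP N × ℝ => H z.1 z.2))
    (h0 : ∀ p ∉ Metric.closedBall (0 : PP N) r, ∀ x, H p x = 0) :
    ∃ M, ∀ p, ∀ x ∈ Icc 0 C, |H p x| ≤ M := by
  obtain ⟨M, hM⟩ := ((isCompact_closedBall (0 : PP N) r).prod (isCompact_Icc (a := 0) (b := C))).exists_bound_of_continuousOn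
    hH.continuousOn
  refine ⟨max M 0, fun p x hx => ?_⟩
  by_cases hp : p ∈ Metric.closedBall (0 : PP N) r
  · exact (hM (p, x) ⟨hp, hx⟩).trans (le_max_left _ _)
  · rw [h0 p hp]; simp

theorem time_deriv {N : ℕ} {m C r0 : ℝ} (hm : 1 < m) {v V Φ : PP N → ℝ}
    (hv : Measurable v) (hv0 : ∀ p, 0 ≤ v p) (hvC : ∀ p, v p ≤ C)
    (hV : ContDiff ℝ 1 V) (hΦ : ContDiff ℝ 1 Φ)
    (hΦr : ∀ p ∉ Metric.closedBall (0 : PP N) r0, Φ p = 0) :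
    HasDerivAt (fun t : ℝ => ∫ p, (Om N).indicator (fun p => BB m (V (p + (t, 0))) (v p) * Φ (p + (t, 0))) p)
      (∫ p, (Om N).indicator (fun p => BB m (V p) (v p) * fderiv ℝ Φ p (1, 0)
      - DD m (V p) (v p) * fderiv ℝ V p (1, 0) * Φ p) p) 0 := by
  have hC : 0 ≤ C := (hv0 0).trans (hvC 0)
  have hmO := measurableSet_Om N
  have hfΦ := fderiv_off hΦr
  have hcV := hV.continuous
  have hcΦ := hΦ.continuous
  have hcV' : Continuous (fun p => fderiv ℝ V p (1, 0)) := (hV.continuous_fderiv one_ne_zero).clm_apply continuous_const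
  have hcΦ' : Continuous (fun p => fderiv ℝ Φ p (1, 0)) := (hΦ.continuous_fderiv one_ne_zero).clm_apply continuous_const
  set H : PP N → ℝ → ℝ := fun p x => BB m (V p) x * Φ p with hH
  set H' : PP N → ℝ → ℝ := fun p x => BB m (V p) x * fderiv ℝ Φ p (1, 0)
      - DD m (V p) x * fderiv ℝ V p (1, 0) * Φ p with hH'
  have hBc : Continuous (fun z : PP N × ℝ => BB m (V z.1) z.2) :=
    (BB_cont hm).comp ((hcV.comp continuous_fst).prodMk continuous_snd)
  have hDc : Continuous (fun z : PP N × ℝ => DD m (V z.1) z.2) :=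
    (DD_cont hm).comp ((hcV.comp continuous_fst).prodMk continuous_snd)
  have hHc : Continuous (fun z : PP N × ℝ => H z.1 z.2) := hBc.mul (hcΦ.comp continuous_fst)
  have hHc' : Continuous (fun z : PP N × ℝ => H' z.1 z.2) :=
    (hBc.mul (hcΦ'.comp continuous_fst)).sub
      ((hDc.mul (hcV'.comp continuous_fst)).mul (hcΦ.comp continuous_fst))
  have hHz : ∀ p ∉ Metric.closedBall (0 : PP N) r0, ∀ x, H p x = 0 := by
    intro p hp x; simp [hH, hΦr p hp]
  have hHz' : ∀ p ∉ Metric.closedBall (0 : PP N) r0, ∀ x, H' p x = 0 := by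
    intro p hp x; simp [hH', hΦr p hp, hfΦ p hp]
  obtain ⟨M1, hM1⟩ := bdd_two hHc hHz
  obtain ⟨M2, hM2⟩ := bdd_two hHc' hHz'
  have hM10 : 0 ≤ M1 := (abs_nonneg _).trans (hM1 0 0 ⟨le_rfl, hC⟩)
  have hM20 : 0 ≤ M2 := (abs_nonneg _).trans (hM2 0 0 ⟨le_rfl, hC⟩)
  have hvI : ∀ p, v p ∈ Icc 0 C := fun p => ⟨hv0 p, hvC p⟩
  have ind_le : ∀ (k : PP N → ℝ) (M : ℝ), 0 ≤ M → (∀ p, |k p| ≤ M) → ∀ p, |(Om N).indicator k p| ≤ M := by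
    intro k M hM hk p
    by_cases hp : p ∈ Om N
    · rw [indicator_of_mem hp]; exact hk p
    · rw [indicator_of_notMem hp]; simpa using hM
  -- measurability of F t
  have hsh : ∀ t : ℝ, Measurable (fun p : PP N => p + (t, (0 : EE N))) := fun t => by fun_prop
  have hFm : ∀ t : ℝ, Measurable ((Om N).indicator (fun p => H (p + (t, 0)) (v p))) := fun t =>
    (hHc.measurable.comp ((hsh t).prodMk hv)).indicator hmO
  have hFm' : ∀ t : ℝ, Measurable ((Om N).indicator (fun p => H' (p + (t, 0)) (v p))) := fun t =>
    (hHc'.measurable.comp ((hsh t).prodMk hv)).indicator hmO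
  have hadd0 : ∀ p : PP N, p + ((0:ℝ), (0 : EE N)) = p := fun p => add_zero p
  have hY : HasDerivAt (fun t => ∫ p, (Om N).indicator (fun p => H (p + (t, 0)) (v p)) p)
      (∫ p, (Om N).indicator (fun p => H' (p + ((0:ℝ), 0)) (v p)) p) 0 := by
    refine deriv_int (M := max M1 M2) (r := r0 + 2) (F' := fun t p => (Om N).indicator (fun p => H' (p + (t, 0)) (v p)) p)
      (fun t => (hFm t).aestronglyMeasurable) (hFm' 0).aestronglyMeasurable ?_ ?_ ?_ ?_
    · intro t p
      by_cases hp : p ∈ Om N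
      · simp only [indicator_of_mem hp]
        have hc : HasDerivAt (fun t : ℝ => p + (t, (0 : EE N))) (1, 0) t :=
          ((hasDerivAt_id t).prodMk (hasDerivAt_const t 0)).const_add p
        have d1 := ((hV.differentiable one_ne_zero (p + (t, 0))).hasFDerivAt).comp_hasDerivAt t hc
        have d2 := ((hΦ.differentiable one_ne_zero (p + (t, 0))).hasFDerivAt).comp_hasDerivAt t hc
        have d3 := (BB_deriv hm (V (p + (t, 0))) (v p)).comp t d1
        have d4 := d3.mul d2
        have e : H' (p + (t, 0)) (v p) = -DD m (V (p + (t, 0))) (v p) * fderiv ℝ V (p + (t, 0)) (1, 0)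
            * (Φ ∘ fun t : ℝ => p + (t, (0 : EE N))) t + ((fun V => BB m V (v p)) ∘ V ∘ fun t : ℝ => p + (t, (0 : EE N))) t
            * fderiv ℝ Φ (p + (t, 0)) (1, 0) := by
          simp only [hH', Function.comp]; ring
        rw [e]
        exact d4
      · simp only [indicator_of_notMem hp]
        exact hasDerivAt_const _ _
    · exact ind_le _ _ (hM10.trans (le_max_left _ _)) fun p => (hM1 _ _ (hvI p)).trans (le_max_left _ _)
    · intro t _
      exact ind_le _ _ (hM10.trans (le_max_left _ _)) fun p => (hM2 _ _ (hvI p)).trans (le_max_right _ _)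
    · intro t ht p hp
      have ht2 : |t| ≤ 2 := by
        rw [Metric.mem_ball, Real.dist_eq, sub_zero] at ht
        linarith
      have := shift_off ht2 hp
      by_cases hpO : p ∈ Om N
      · simp only [indicator_of_mem hpO]
        exact ⟨hHz _ this _, hHz' _ this _⟩
      · simp [indicator_of_notMem hpO]
  simp only [hadd0] at hY
  exact hY

theorem time_conv {N : ℕ} {m C r0 s0 h : ℝ} (hm : 1 < m) {v V Φ : PP N → ℝ} {u0 : EE N → ℝ}
    (hv : Measurable v) (hv0 : ∀ p, 0 ≤ v p) (hvC : ∀ p, v p ≤ C)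
    (hu : Measurable u0) (hu0 : ∀ x, 0 ≤ u0 x) (huC : ∀ x, u0 x ≤ C)
    (hV : ContDiff ℝ 1 V) (hV0 : ∀ p, 0 ≤ V p) (hΦ : ContDiff ℝ 1 Φ) (hΦ0 : ∀ p, 0 ≤ Φ p)
    (hΦr : ∀ p ∉ Metric.closedBall (0 : PP N) r0, Φ p = 0) (hs0 : 0 < s0)
    (hinit : ∀ᵐ p : PP N, p.1 ∈ Icc 0 s0 → u0 p.2 ^ m ≤ V p)
    (hh0 : 0 < h) (hhs : h < s0) :
    (∫ p, (Om N).indicator (fun p => v p - u0 p.2) p *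
        (bet ((Om N).indicator (fun p => v p ^ m) (p + (h, 0)) - V (p + (h, 0))) * Φ (p + (h, 0))))
      - ∫ p, (Om N).indicator (fun p => v p - u0 p.2) p *
        (bet ((Om N).indicator (fun p => v p ^ m) p - V p) * Φ p) ≤ 
    (∫ p, (Om N).indicator (fun p => BB m (V (p + (h, 0))) (v p) * Φ (p + (h, 0))) p)
     - ∫ p, (Om N).indicator (fun p => BB m (V p) (v p) * Φ p) p := by
  have hC : 0 ≤ C := (hv0 0).trans (hvC 0)
  have hmO := measurableSet_Om N
  have hfΦ := fderiv_off hΦr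
  have hcV := hV.continuous
  have hcΦ := hΦ.continuous
  have hcV' : Continuous (fun p => fderiv ℝ V p (1, 0)) := (hV.continuous_fderiv one_ne_zero).clm_apply continuous_const
  have hcΦ' : Continuous (fun p => fderiv ℝ Φ p (1, 0)) := (hΦ.continuous_fderiv one_ne_zero).clm_apply continuous_const
  set H : PP N → ℝ → ℝ := fun p x => BB m (V p) x * Φ p with hH
  set H' : PP N → ℝ → ℝ := fun p x => BB m (V p) x * fderiv ℝ Φ p (1, 0)
      - DD m (V p) x * fderiv ℝ V p (1, 0) * Φ p with hH'
  have hBc : Continuous (fun z : PP N × ℝ => BB m (V z.1) z.2) :=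
    (BB_cont hm).comp ((hcV.comp continuous_fst).prodMk continuous_snd)
  have hDc : Continuous (fun z : PP N × ℝ => DD m (V z.1) z.2) :=
    (DD_cont hm).comp ((hcV.comp continuous_fst).prodMk continuous_snd)
  have hHc : Continuous (fun z : PP N × ℝ => H z.1 z.2) := hBc.mul (hcΦ.comp continuous_fst)
  have hHc' : Continuous (fun z : PP N × ℝ => H' z.1 z.2) :=
    (hBc.mul (hcΦ'.comp continuous_fst)).sub
      ((hDc.mul (hcV'.comp continuous_fst)).mul (hcΦ.comp continuous_fst))
  have hHz : ∀ p ∉ Metric.closedBall (0 : PP N) r0, ∀ x, H p x = 0 := by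
    intro p hp x; simp [hH, hΦr p hp]
  have hHz' : ∀ p ∉ Metric.closedBall (0 : PP N) r0, ∀ x, H' p x = 0 := by
    intro p hp x; simp [hH', hΦr p hp, hfΦ p hp]
  obtain ⟨M1, hM1⟩ := bdd_two hHc hHz
  obtain ⟨M2, hM2⟩ := bdd_two hHc' hHz'
  have hM10 : 0 ≤ M1 := (abs_nonneg _).trans (hM1 0 0 ⟨le_rfl, hC⟩)
  have hM20 : 0 ≤ M2 := (abs_nonneg _).trans (hM2 0 0 ⟨le_rfl, hC⟩)
  have hvI : ∀ p, v p ∈ Icc 0 C := fun p => ⟨hv0 p, hvC p⟩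
  have ind_le : ∀ (k : PP N → ℝ) (M : ℝ), 0 ≤ M → (∀ p, |k p| ≤ M) → ∀ p, |(Om N).indicator k p| ≤ M := by
    intro k M hM hk p
    by_cases hp : p ∈ Om N
    · rw [indicator_of_mem hp]; exact hk p
    · rw [indicator_of_notMem hp]; simpa using hM
  -- measurability of F t
  have hsh : ∀ t : ℝ, Measurable (fun p : PP N => p + (t, (0 : EE N))) := fun t => by fun_prop
  have hFm : ∀ t : ℝ, Measurable ((Om N).indicator (fun p => H (p + (t, 0)) (v p))) := fun t =>
    (hHc.measurable.comp ((hsh t).prodMk hv)).indicator hmO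
  have hFm' : ∀ t : ℝ, Measurable ((Om N).indicator (fun p => H' (p + (t, 0)) (v p))) := fun t =>
    (hHc'.measurable.comp ((hsh t).prodMk hv)).indicator hmO
  have hadd0 : ∀ p : PP N, p + ((0:ℝ), (0 : EE N)) = p := fun p => add_zero p
  set U : PP N → ℝ := (Om N).indicator (fun p => v p - u0 p.2) with hUdef
  set ψ : PP N → ℝ := fun p => bet ((Om N).indicator (fun p => v p ^ m) p - V p) * Φ p with hψ
  have hvm : Measurable ((Om N).indicator (fun p => v p ^ m)) := (hv.pow_const m).indicator hmO
  have hUm : Measurable U := (hv.sub (hu.comp measurable_snd)).indicator hmO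
  have hψm : Measurable ψ := (bet_cont.measurable.comp (hvm.sub hcV.measurable)).mul hcΦ.measurable
  have hUb : ∀ p, |U p| ≤ C := ind_le _ _ hC fun p => by
    rw [abs_le]; constructor <;> linarith [hv0 p, hvC p, hu0 p.2, huC p.2]
  obtain ⟨MΦ, hMΦ⟩ := (HasCompactSupport.intro (isCompact_closedBall _ _) hΦr).exists_bound_of_continuous hcΦ
  have hvmC : ∀ p, (Om N).indicator (fun p => v p ^ m) p ≤ C ^ m := by
    intro p
    have : (0:ℝ) ≤ C ^ m := by positivity
    have := ind_le (fun p => v p ^ m) (C ^ m) this (fun p => by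
      rw [abs_of_nonneg (Real.rpow_nonneg (hv0 p) m)]
      exact Real.rpow_le_rpow (hv0 p) (hvC p) (by linarith)) p
    exact (le_abs_self _).trans this
  have hψb : ∀ p, |ψ p| ≤ bet (C ^ m) * MΦ := by
    intro p
    rw [hψ, abs_mul]
    refine mul_le_mul ?_ (hMΦ p) (abs_nonneg _) (bet_nonneg _)
    rw [abs_of_nonneg (bet_nonneg _)]
    exact bet_mono (by linarith [hvmC p, hV0 p])
  have hψz : ∀ p ∉ Metric.closedBall (0 : PP N) r0, ψ p = 0 := fun p hp => by simp [hψ, hΦr p hp]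
  -- shifts
  have hsub : ∀ p : PP N, p + ((h:ℝ), (0 : EE N)) - (h, 0) = p := fun p => add_sub_cancel_right _ _
  have e1 : ∫ p, U p * ψ (p + (h, 0)) = ∫ p, U (p - (h, 0)) * ψ p := by
    have := integral_add_right_eq_self (μ := (volume : Measure (PP N))) (fun p => U (p - (h, 0)) * ψ p) (h, 0)
    simp only [hsub] at this
    exact this
  have e2 : ∫ p, (Om N).indicator (fun p => H (p + (h, 0)) (v p)) p
      = ∫ p, (Om N).indicator (fun _ => H p (v (p - (h, 0)))) (p - (h, 0)) := by
    have := integral_add_right_eq_self (μ := (volume : Measure (PP N)))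
      (fun p => (Om N).indicator (fun _ => H p (v (p - (h, 0)))) (p - (h, 0))) (h, 0)
    simp only [hsub] at this
    rw [← this]
    refine integral_congr_ae (ae_of_all _ fun p => ?_)
    by_cases hp : p ∈ Om N
    · simp only [indicator_of_mem hp]
    · simp only [indicator_of_notMem hp]
  have hshm : Measurable (fun p : PP N => p - (h, (0 : EE N))) := by fun_prop
  have i1 : Integrable (fun p => U (p - (h, 0)) * ψ p) :=
    int_bdd (M := C * (bet (C ^ m) * MΦ)) (r := r0) ((hUm.comp hshm).mul hψm) (fun p => by
      rw [abs_mul]; exact mul_le_mul (hUb _) (hψb _) (abs_nonneg _) hC) (fun p hp => by simp [hψz p hp])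
  have i2 : Integrable (fun p => U p * ψ p) :=
    int_bdd (M := C * (bet (C ^ m) * MΦ)) (r := r0) (hUm.mul hψm) (fun p => by
      rw [abs_mul]; exact mul_le_mul (hUb _) (hψb _) (abs_nonneg _) hC) (fun p hp => by simp [hψz p hp])
  have hk : (fun p => (Om N).indicator (fun _ => H p (v (p - (h, 0)))) (p - (h, 0)))
      = (((fun p : PP N => p - (h, (0 : EE N))) ⁻¹' (Om N)).indicator (fun p => H p (v (p - (h, 0))))) := by
    funext p
    by_cases hp : p - (h, (0 : EE N)) ∈ Om N
    · rw [indicator_of_mem hp, indicator_of_mem (show p ∈ (fun p : PP N => p - (h, (0 : EE N))) ⁻¹' (Om N) from hp)]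
    · rw [indicator_of_notMem hp, indicator_of_notMem (show p ∉ (fun p : PP N => p - (h, (0 : EE N))) ⁻¹' (Om N) from hp)]
  have i3 : Integrable (fun p => (Om N).indicator (fun _ => H p (v (p - (h, 0)))) (p - (h, 0))) := by
    refine int_bdd (M := M1) (r := r0) ?_ ?_ ?_
    · rw [hk]
      exact (hHc.measurable.comp (measurable_id.prodMk (hv.comp hshm))).indicator (hshm hmO)
    · intro p
      by_cases hp : p - (h, (0 : EE N)) ∈ Om N
      · rw [indicator_of_mem hp]; exact hM1 _ _ (hvI _)
      · rw [indicator_of_notMem hp]; simpa using hM10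
    · intro p hp
      by_cases hp' : p - (h, (0 : EE N)) ∈ Om N
      · rw [indicator_of_mem hp']; exact hHz p hp _
      · rw [indicator_of_notMem hp']
  have i4 : Integrable (fun p => (Om N).indicator (fun p => H p (v p)) p) := by
    refine int_bdd (M := M1) (r := r0) ?_ ?_ ?_
    · have := hFm 0
      simpa only [hadd0] using this
    · exact ind_le _ _ hM10 fun p => hM1 _ _ (hvI p)
    · intro p hp
      by_cases hp' : p ∈ Om N
      · rw [indicator_of_mem hp']; exact hHz p hp _
      · rw [indicator_of_notMem hp']
  rw [e1, e2, ← integral_sub i1 i2, ← integral_sub i3 i4]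
  refine integral_mono_ae (i1.sub i2) (i3.sub i4) ?_
  filter_upwards [hinit] with p hp
  by_cases hpO : p ∈ Om N
  · have hp1 : 0 < p.1 := hpO
    simp only [hUdef, hψ, indicator_of_mem hpO]
    by_cases hph : p - (h, (0 : EE N)) ∈ Om N
    · simp only [indicator_of_mem hph, hH]
      have := BB_convex hm (V := V p) (hv0 p) (hv0 (p - (h, 0)))
      have := mul_le_mul_of_nonneg_right this (hΦ0 p)
      have e3 : (p - (h, (0 : EE N))).2 = p.2 := by simp
      rw [e3]
      nlinarith
    · simp only [indicator_of_notMem hph, hH]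
      have hph' : ¬ (0 < p.1 - h) := by simpa only [Om, mem_setOf_eq, Prod.fst_sub] using hph
      have h0 := BB_zero hm (hu0 p.2) (hp ⟨hp1.le, by linarith⟩)
      have := BB_convex hm (V := V p) (hv0 p) (hu0 p.2)
      have := mul_le_mul_of_nonneg_right this (hΦ0 p)
      rw [h0] at this
      nlinarith
  · have hp1 : ¬ 0 < p.1 := hpO
    have hph : p - (h, (0 : EE N)) ∉ Om N := by
      intro h'
      have : 0 < p.1 - h := by simpa only [Om, mem_setOf_eq, Prod.fst_sub] using h'
      linarith
    have hz : ψ p = 0 := by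
      simp only [hψ, indicator_of_notMem hpO]
      rw [bet_of_nonpos (by linarith [hV0 p]), zero_mul]
    simp [hz, indicator_of_notMem hph, indicator_of_notMem hpO]

theorem time_part {N : ℕ} {m C r0 s0 rr : ℝ} (hm : 1 < m) {v V Φ : PP N → ℝ} {u0 : EE N → ℝ}
    (hv : Measurable v) (hv0 : ∀ p, 0 ≤ v p) (hvC : ∀ p, v p ≤ C)
    (hu : Measurable u0) (hu0 : ∀ x, 0 ≤ u0 x) (huC : ∀ x, u0 x ≤ C)
    (hV : ContDiff ℝ 1 V) (hV0 : ∀ p, 0 ≤ V p) (hΦ : ContDiff ℝ 1 Φ) (hΦ0 : ∀ p, 0 ≤ Φ p)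
    (hΦr : ∀ p ∉ Metric.closedBall (0 : PP N) r0, Φ p = 0) (hs0 : 0 < s0)
    (hinit : ∀ᵐ p : PP N, p.1 ∈ Icc 0 s0 → u0 p.2 ^ m ≤ V p)
    (hlim : Tendsto (fun h : ℝ => ((∫ p, (Om N).indicator (fun p => v p - u0 p.2) p *
        (bet ((Om N).indicator (fun p => v p ^ m) (p + (h, 0)) - V (p + (h, 0))) * Φ (p + (h, 0))))
      - ∫ p, (Om N).indicator (fun p => v p - u0 p.2) p *
        (bet ((Om N).indicator (fun p => v p ^ m) p - V p) * Φ p)) / h) (𝓝[>] 0) (𝓝 rr)) :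
    rr ≤ ∫ p, (Om N).indicator (fun p => BB m (V p) (v p) * fderiv ℝ Φ p (1, 0)
      - DD m (V p) (v p) * fderiv ℝ V p (1, 0) * Φ p) p := by
  have hY := time_deriv hm hv hv0 hvC hV hΦ hΦr
  have hYl := hY.tendsto_slope_zero_right
  refine le_of_tendsto_of_tendsto hlim hYl ?_
  have hmem : Ioo (0:ℝ) s0 ∈ 𝓝[>] (0:ℝ) := Ioo_mem_nhdsGT hs0
  filter_upwards [hmem] with h hh
  rw [smul_eq_mul, zero_add, inv_mul_eq_div]
  refine div_le_div_of_nonneg_right ?_ hh.1.le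
  have hadd0 : ∀ p : PP N, p + ((0:ℝ), (0 : EE N)) = p := fun p => add_zero p
  simp only [hadd0]
  exact time_conv hm hv hv0 hvC hu hu0 huC hV hV0 hΦ hΦ0 hΦr hs0 hinit hh.1 hh.2

theorem memLp_ball_of_cont {N : ℕ} {F : Type*} [NormedAddCommGroup F] [SecondCountableTopology F]
    {X : PP N → F} (hX : Continuous X)
    (r : ℝ) : MemLp ((Metric.closedBall (0 : PP N) r).indicator X) 2 := by
  rw [memLp_indicator_iff_restrict Metric.isClosed_closedBall.measurableSet]
  have : IsFiniteMeasure (volume.restrict (Metric.closedBall (0 : PP N) r)) :=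
    ⟨by rw [Measure.restrict_apply_univ]; exact (isCompact_closedBall _ _).measure_lt_top⟩
  obtain ⟨M, hM⟩ := (isCompact_closedBall (0 : PP N) r).exists_bound_of_continuousOn hX.continuousOn
  refine MemLp.of_bound hX.aestronglyMeasurable M ?_
  filter_upwards [ae_restrict_mem Metric.isClosed_closedBall.measurableSet] with p hp
  exact hM p hp

theorem memLp_smul_bdd {Y F : Type*} [MeasurableSpace Y] {μ : Measure Y} [NormedAddCommGroup F]
    [NormedSpace ℝ F] {a : Y → ℝ} {b : Y → F} {M : ℝ} (ha : AEStronglyMeasurable a μ)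
    (haM : ∀ y, |a y| ≤ M) (hb : MemLp b 2 μ) : MemLp (fun y => a y • b y) 2 μ := by
  refine hb.of_le_mul (c := M) (ha.smul hb.1) (ae_of_all _ fun y => ?_)
  rw [norm_smul]
  exact mul_le_mul_of_nonneg_right (haM y) (norm_nonneg _)

set_option maxHeartbeats 1600000 in
theorem energy_limit {N : ℕ} {U f z V Y Φ Λ : PP N → ℝ} {g X Ξ : PP N → EE N} {C M r0 : ℝ}
    (hU : Measurable U) (hUC : ∀ p, |U p| ≤ C)
    (hf : ∀ r, MemLp ((Metric.closedBall (0 : PP N) r).indicator f) 2)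
    (hzm : Measurable z) (hz0 : ∀ p, 0 ≤ z p) (hzM : ∀ p, z p ≤ M) (hgm : Measurable g)
    (hg : ∀ r, MemLp ((Metric.closedBall (0 : PP N) r).indicator g) 2)
    (W1 : ∀ ψ : PP N → ℝ, ContDiff ℝ 1 ψ → HasCompactSupport ψ → ∀ i : Fin N,
        ∫ p, z p * fderiv ℝ ψ p (0, EuclideanSpace.single i 1) = - ∫ p, g p i * ψ p)
    (W2 : ∀ ψ : PP N → ℝ, ContDiff ℝ 1 ψ → HasCompactSupport ψ →
        ∫ p, U p * fderiv ℝ ψ p (1, 0) = ∫ p, (fderiv ℝ ψ p (0, g p) + f p * ψ p))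
    (hV : ContDiff ℝ 1 V) (hV0 : ∀ p, 0 ≤ V p) (hXc : Continuous X)
    (hX : ∀ p y, fderiv ℝ V p (0, y) = inner ℝ (X p) y) (hYc : Continuous Y)
    (hY : ∀ ψ : PP N → ℝ, ContDiff ℝ 1 ψ → HasCompactSupport ψ →
      ∫ p, fderiv ℝ ψ p (0, X p) = - ∫ p, Y p * ψ p)
    (hΦ : ContDiff ℝ 1 Φ) (hΦ0 : ∀ p, 0 ≤ Φ p)
    (hΦr : ∀ p ∉ Metric.closedBall (0 : PP N) r0, Φ p = 0)
    (hΞc : Continuous Ξ) (hΞr : ∀ p ∉ Metric.closedBall (0 : PP N) r0, Ξ p = 0)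
    (hΞ : ∀ p y, fderiv ℝ Φ p (0, y) = inner ℝ (Ξ p) y)
    (hΛc : Continuous Λ) (hΛr : ∀ p ∉ Metric.closedBall (0 : PP N) r0, Λ p = 0)
    (hΛ : ∀ Θ : PP N → ℝ, ContDiff ℝ 1 Θ → ∫ p, fderiv ℝ Θ p (0, Ξ p) = - ∫ p, Θ p * Λ p) :
    ∃ rr, Tendsto (fun h : ℝ => ((∫ p, U p * (bet (z (p + (h, 0)) - V (p + (h, 0))) * Φ (p + (h, 0))))
      - ∫ p, U p * (bet (z p - V p) * Φ p)) / h) (𝓝[>] 0) (𝓝 rr) ∧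
      (∫ p, f p * (bet (z p - V p) * Φ p)) - (∫ p, Y p * (bet (z p - V p) * Φ p))
        - (∫ p, Gam (z p - V p) * Λ p) ≤ rr := by
  obtain ⟨Z, G, hZ1, hZ0, hZM, hZz, hGc, hZG, hGg⟩ := mollify_exists hzm hz0 hzM hgm hg W1
  have hcV := hV.continuous
  have hcΦ := hΦ.continuous
  have hΦcs : HasCompactSupport Φ := HasCompactSupport.intro (isCompact_closedBall _ _) hΦr
  obtain ⟨MΦ, hMΦ⟩ := hΦcs.exists_bound_of_continuous hcΦ
  -- coefficient functions
  have hac : ∀ n, Continuous (fun p => bet (Z n p - V p)) := fun n =>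
    bet_cont.comp ((hZ1 n).continuous.sub hcV)
  have hac' : ∀ n, Continuous (fun p => bet' (Z n p - V p)) := fun n =>
    bet'_cont.comp ((hZ1 n).continuous.sub hcV)
  have ham : Measurable (fun p => bet (z p - V p)) := bet_cont.measurable.comp (hzm.sub hcV.measurable)
  have ham' : Measurable (fun p => bet' (z p - V p)) := bet'_cont.measurable.comp (hzm.sub hcV.measurable)
  have hab : ∀ n p, |bet (Z n p - V p)| ≤ bet M := fun n p => by
    rw [abs_of_nonneg (bet_nonneg _)]; exact bet_mono (by linarith [hZM n p, hV0 p])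
  have hab0 : ∀ p, |bet (z p - V p)| ≤ bet M := fun p => by
    rw [abs_of_nonneg (bet_nonneg _)]; exact bet_mono (by linarith [hzM p, hV0 p])
  have hab' : ∀ n p, |bet' (Z n p - V p)| ≤ bet' M := fun n p => by
    rw [abs_of_nonneg (bet'_nonneg _)]; exact bet'_mono (by linarith [hZM n p, hV0 p])
  have hab0' : ∀ p, |bet' (z p - V p)| ≤ bet' M := fun p => by
    rw [abs_of_nonneg (bet'_nonneg _)]; exact bet'_mono (by linarith [hzM p, hV0 p])
  have hlima : ∀ᵐ p, Tendsto (fun n => bet (Z n p - V p)) atTop (𝓝 (bet (z p - V p))) := by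
    filter_upwards [hZz] with p hp
    exact (bet_cont.tendsto _).comp (hp.sub_const _)
  have hlima' : ∀ᵐ p, Tendsto (fun n => bet' (Z n p - V p)) atTop (𝓝 (bet' (z p - V p))) := by
    filter_upwards [hZz] with p hp
    exact (bet'_cont.tendsto _).comp (hp.sub_const _)
  -- L2 functions
  have hΦL : MemLp Φ 2 := hcΦ.memLp_of_hasCompactSupport hΦcs
  have hΞL : MemLp Ξ 2 := hΞc.memLp_of_hasCompactSupport
    (HasCompactSupport.intro (isCompact_closedBall _ _) hΞr)
  set ξ : PP N → EE N := (Metric.closedBall (0 : PP N) r0).indicator X with hξ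
  set γ : PP N → EE N := fun p => (Metric.closedBall (0 : PP N) r0).indicator g p - ξ p with hγ
  set Γn : ℕ → PP N → EE N := fun n p => (Metric.closedBall (0 : PP N) r0).indicator (G n) p - ξ p with hΓn
  have hξL : MemLp ξ 2 := memLp_ball_of_cont hXc r0
  have hγL : MemLp γ 2 := (hg r0).sub hξL
  have hΓL : ∀ n, MemLp (Γn n) 2 := fun n => (memLp_ball_of_cont (hGc n) r0).sub hξL
  have hΓlim : Tendsto (fun n => eLpNorm (fun p => Γn n p - γ p) 2) atTop (𝓝 0) := by
    refine (hGg r0).congr fun n => ?_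
    congr 1
    funext p
    by_cases hp : p ∈ Metric.closedBall (0 : PP N) r0
    · simp only [hΓn, hγ, indicator_of_mem hp]; abel
    · simp only [hΓn, hγ, indicator_of_notMem hp]; simp
  have hΦm : AEStronglyMeasurable Φ volume := hcΦ.aestronglyMeasurable
  have hΦΓ : ∀ n, MemLp (fun p => Φ p • Γn n p) 2 := fun n => memLp_smul_bdd hΦm hMΦ (hΓL n)
  have hΦγ : MemLp (fun p => Φ p • γ p) 2 := memLp_smul_bdd hΦm hMΦ hγL
  have hΦlim : Tendsto (fun n => eLpNorm (fun p => Φ p • Γn n p - Φ p • γ p) 2) atTop (𝓝 0) :=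
    prodL2 (A := fun _ => Φ) (fun _ => hΦm) hΦm (fun _ => hMΦ) hMΦ hΓL hγL
      (ae_of_all _ fun p => tendsto_const_nhds) hΓlim
  -- the four sequences
  have hψlim : Tendsto (fun n => eLpNorm (fun p => bet (Z n p - V p) * Φ p - bet (z p - V p) * Φ p) 2)
      atTop (𝓝 0) :=
    prodL2 (B := fun _ => Φ) (fun n => (hac n).aestronglyMeasurable) ham.aestronglyMeasurable hab hab0
      (fun _ => hΦL) hΦL hlima (by simp)
  have hQlim : Tendsto (fun n => eLpNorm (fun p => bet (Z n p - V p) • Ξ p - bet (z p - V p) • Ξ p) 2)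
      atTop (𝓝 0) :=
    prodL2 (B := fun _ => Ξ) (fun n => (hac n).aestronglyMeasurable) ham.aestronglyMeasurable hab hab0
      (fun _ => hΞL) hΞL hlima (by simp)
  have hPlim : Tendsto (fun n => eLpNorm (fun p => bet' (Z n p - V p) • (Φ p • Γn n p)
      - bet' (z p - V p) • (Φ p • γ p)) 2) atTop (𝓝 0) :=
    prodL2 (fun n => (hac' n).aestronglyMeasurable) ham'.aestronglyMeasurable hab' hab0'
      hΦΓ hΦγ hlima' hΦlim
  have hψL : ∀ n, MemLp (fun p => bet (Z n p - V p) * Φ p) 2 := fun n =>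
    memLp_smul_bdd (hac n).aestronglyMeasurable (hab n) hΦL
  have hψL0 : MemLp (fun p => bet (z p - V p) * Φ p) 2 := memLp_smul_bdd ham.aestronglyMeasurable hab0 hΦL
  have hQL : ∀ n, MemLp (fun p => bet (Z n p - V p) • Ξ p) 2 := fun n =>
    memLp_smul_bdd (hac n).aestronglyMeasurable (hab n) hΞL
  have hQL0 : MemLp (fun p => bet (z p - V p) • Ξ p) 2 := memLp_smul_bdd ham.aestronglyMeasurable hab0 hΞL
  have hPL : ∀ n, MemLp (fun p => bet' (Z n p - V p) • (Φ p • Γn n p)) 2 := fun n =>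
    memLp_smul_bdd (hac' n).aestronglyMeasurable (hab' n) (hΦΓ n)
  have hPL0 : MemLp (fun p => bet' (z p - V p) • (Φ p • γ p)) 2 :=
    memLp_smul_bdd ham'.aestronglyMeasurable hab0' hΦγ
  set Dn : ℕ → PP N → EE N := fun n p =>
    bet' (Z n p - V p) • (Φ p • Γn n p) + bet (Z n p - V p) • Ξ p with hDn
  set D : PP N → EE N := fun p =>
    bet' (z p - V p) • (Φ p • γ p) + bet (z p - V p) • Ξ p with hD
  have hDnL : ∀ n, MemLp (Dn n) 2 := fun n => (hPL n).add (hQL n)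
  have hDL : MemLp D 2 := hPL0.add hQL0
  have hDlim : Tendsto (fun n => eLpNorm (fun p => Dn n p - D p) 2) atTop (𝓝 0) := by
    have h3 := hPlim.add hQlim
    simp only [add_zero] at h3
    refine tendsto_of_tendsto_of_tendsto_of_le_of_le tendsto_const_nhds h3 (fun n => bot_le) fun n => ?_
    have e : (fun p => Dn n p - D p) = (fun p => bet' (Z n p - V p) • (Φ p • Γn n p)
      - bet' (z p - V p) • (Φ p • γ p)) + (fun p => bet (Z n p - V p) • Ξ p - bet (z p - V p) • Ξ p) := by
      funext p; simp only [hDn, hD, Pi.add_apply]; abel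
    rw [e]
    exact eLpNorm_add_le ((hPL n).sub hPL0).1 ((hQL n).sub hQL0).1 (by norm_num)
  have hdiff : ∀ n p, HasFDerivAt (fun p => Z n p - V p) (fderiv ℝ (Z n) p - fderiv ℝ V p) p := fun n p =>
    ((hZ1 n).differentiable one_ne_zero p).hasFDerivAt.sub (hV.differentiable one_ne_zero p).hasFDerivAt
  have hψs : ∀ n, ContDiff ℝ 1 (fun p => bet (Z n p - V p) * Φ p) := fun n =>
    (bet_contDiff.comp ((hZ1 n).sub hV)).mul hΦ
  have hψD : ∀ n p y, fderiv ℝ (fun p => bet (Z n p - V p) * Φ p) p (0, y) = inner ℝ (Dn n p) y := by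
    intro n p y
    have h1 := ((bet_deriv (Z n p - V p)).comp_hasFDerivAt p (hdiff n p)).mul
      (hΦ.differentiable one_ne_zero p).hasFDerivAt
    erw [h1.fderiv]
    by_cases hp : p ∈ Metric.closedBall (0 : PP N) r0
    · simp only [hDn, hΓn, hξ, indicator_of_mem hp, ContinuousLinearMap.add_apply, ContinuousLinearMap.smul_apply,
        ContinuousLinearMap.sub_apply, hZG, hX, hΞ, inner_add_left, inner_smul_left, inner_sub_left, smul_eq_mul,
        Function.comp, RCLike.conj_to_real]
      ring
    · simp [hDn, hΞ, hΦr p hp, hΞr p hp]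
  have hzero : ∀ n, ∀ p ∉ Metric.closedBall (0 : PP N) r0, bet (Z n p - V p) * Φ p = 0 := fun n p hp => by
    simp [hΦr p hp]
  have hzero0 : ∀ p ∉ Metric.closedBall (0 : PP N) r0, bet (z p - V p) * Φ p = 0 := fun p hp => by
    simp [hΦr p hp]
  have hDnz : ∀ n, ∀ p ∉ Metric.closedBall (0 : PP N) r0, Dn n p = 0 := fun n p hp => by
    simp [hDn, hΦr p hp, hΞr p hp]
  have hDz : ∀ p ∉ Metric.closedBall (0 : PP N) r0, D p = 0 := fun p hp => by
    simp [hD, hΦr p hp, hΞr p hp]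
  refine ⟨_, steklov hU hUC hf hg W2 hψs hψD hzero hDnz hzero0 hDz hψL hDnL hψL0 hDL hψlim hDlim, ?_⟩
  -- (i)
  have hi : ∫ p, inner ℝ (ξ p) (D p) = - ∫ p, Y p * (bet (z p - V p) * Φ p) := by
    have t1 := cs_lim (A := fun _ : ℕ => ξ) (l := atTop) (fun _ => hξL) hDnL hξL hDL (by simp) hDlim
    have t2 := cs_lim (A := fun _ : ℕ => (Metric.closedBall (0 : PP N) r0).indicator Y) (l := atTop)
      (fun _ => memLp_ball_of_cont hYc r0) hψL (memLp_ball_of_cont hYc r0) hψL0 (by simp) hψlim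
    have e : ∀ (a : PP N → ℝ), (∀ p ∉ Metric.closedBall (0 : PP N) r0, a p = 0) →
        ∫ p, inner ℝ ((Metric.closedBall (0 : PP N) r0).indicator Y p) (a p) = ∫ p, Y p * a p := by
      intro a ha
      refine integral_congr_ae (ae_of_all _ fun p => ?_)
      by_cases hp : p ∈ Metric.closedBall (0 : PP N) r0
      · simp [indicator_of_mem hp, mul_comm]
      · simp [ha p hp]
    rw [e _ hzero0] at t2
    simp_rw [fun n => e _ (hzero n)] at t2
    refine tendsto_nhds_unique t1 (t2.neg.congr fun n => ?_)
    rw [← hY _ (hψs n) (HasCompactSupport.intro (isCompact_closedBall _ _) (hzero n))]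
    refine integral_congr_ae (ae_of_all _ fun p => ?_)
    simp only [hψD]
    by_cases hp : p ∈ Metric.closedBall (0 : PP N) r0
    · simp only [hξ, indicator_of_mem hp]; rw [real_inner_comm]
    · simp [hDnz n p hp]
  have hii : 0 ≤ ∫ p, inner ℝ (γ p) (bet' (z p - V p) • (Φ p • γ p)) := by
    refine integral_nonneg fun p => ?_
    simp only [inner_smul_right]
    have := bet'_nonneg (z p - V p)
    have := hΦ0 p
    have := real_inner_self_nonneg (x := γ p)
    simp only [Pi.zero_apply]
    positivity
  have hiii : ∫ p, inner ℝ (γ p) (bet (z p - V p) • Ξ p) = - ∫ p, Gam (z p - V p) * Λ p := by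
    have t1 := cs_lim (l := atTop) hΓL hQL hγL hQL0 hΓlim hQlim
    have hΛi : Integrable Λ := hΛc.integrable_of_hasCompactSupport
      (HasCompactSupport.intro (isCompact_closedBall _ _) hΛr)
    have t2 : Tendsto (fun n => ∫ p, Gam (Z n p - V p) * Λ p) atTop (𝓝 (∫ p, Gam (z p - V p) * Λ p)) := by
      refine tendsto_integral_of_dominated_convergence (fun p => Gam M * |Λ p|) ?_ (hΛi.abs.const_mul _) ?_ ?_
      · intro n
        exact ((Gam_cont.comp ((hZ1 n).continuous.sub hcV)).mul hΛc).aestronglyMeasurable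
      · intro n
        refine ae_of_all _ fun p => ?_
        rw [norm_mul, Real.norm_eq_abs, Real.norm_eq_abs, abs_of_nonneg (Gam_nonneg _)]
        exact mul_le_mul_of_nonneg_right (Gam_mono (by linarith [hZM n p, hV0 p])) (abs_nonneg _)
      · filter_upwards [hZz] with p hp
        exact ((Gam_cont.tendsto _).comp (hp.sub_const _)).mul_const _
    refine tendsto_nhds_unique t1 (t2.neg.congr fun n => ?_)
    have hG := hΛ (fun p => Gam (Z n p - V p)) (Gam_contDiff.comp ((hZ1 n).sub hV))
    rw [← hG]
    refine integral_congr_ae (ae_of_all _ fun p => ?_)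
    have h1 := (Gam_deriv (Z n p - V p)).comp_hasFDerivAt p (hdiff n p)
    show fderiv ℝ (Gam ∘ (fun p => Z n p - V p)) p (0, Ξ p) = _
    rw [h1.fderiv]
    by_cases hp : p ∈ Metric.closedBall (0 : PP N) r0
    · simp only [hΓn, hξ, indicator_of_mem hp, ContinuousLinearMap.smul_apply,
        ContinuousLinearMap.sub_apply, hZG, hX, inner_smul_right, inner_sub_left, smul_eq_mul]
    · simp only [hΞr p hp, Prod.mk_zero_zero, map_zero, smul_zero, inner_zero_right]
  have hsplit : ∫ p, inner ℝ (g p) (D p) = (∫ p, inner ℝ (ξ p) (D p))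
      + (∫ p, inner ℝ (γ p) (bet' (z p - V p) • (Φ p • γ p)))
      + ∫ p, inner ℝ (γ p) (bet (z p - V p) • Ξ p) := by
    rw [← integral_add (cs_int hξL hDL) (cs_int hγL hPL0)]
    have e2 := integral_add ((cs_int hξL hDL).add (cs_int hγL hPL0)) (cs_int hγL hQL0)
    simp only [Pi.add_apply] at e2
    rw [← e2]
    refine integral_congr_ae (ae_of_all _ fun p => ?_)
    simp only
    by_cases hp : p ∈ Metric.closedBall (0 : PP N) r0
    · have : g p = ξ p + γ p := by simp [hγ, indicator_of_mem hp]
      rw [this, inner_add_left, add_assoc, ← inner_add_right]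
    · simp [hDz p hp, hΦr p hp, hΞr p hp]
  rw [hsplit, hi, hiii]
  linarith

theorem int_H {N : ℕ} {H : PP N → ℝ → ℝ} {C r : ℝ} {v : PP N → ℝ}
    (hv : Measurable v) (hv0 : ∀ p, 0 ≤ v p) (hvC : ∀ p, v p ≤ C)
    (hH : Continuous (fun z : PP N × ℝ => H z.1 z.2))
    (h0 : ∀ p ∉ Metric.closedBall (0 : PP N) r, ∀ x, H p x = 0) :
    Integrable ((Om N).indicator (fun p => H p (v p))) := by
  obtain ⟨M, hM⟩ := bdd_two (C := C) hH h0
  have : Integrable (fun p => H p (v p)) :=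
    int_bdd (M := M) (r := r) (hH.measurable.comp (measurable_id.prodMk hv))
      (fun p => hM p _ ⟨hv0 p, hvC p⟩) (fun p hp => h0 p hp _)
  exact this.indicator (measurableSet_Om N)

theorem key_ineq {N : ℕ} {m q C r0 s0 : ℝ} (hm : 1 < m) (hq : 0 < q) {v V Y Φ Λ : PP N → ℝ}
    {w u0 : EE N → ℝ} {g X Ξ : PP N → EE N} (hw : Continuous w)
    (hv : Measurable v) (hv0 : ∀ p, 0 ≤ v p) (hvC : ∀ p, v p ≤ C)
    (hu : Measurable u0) (hu0 : ∀ x, 0 ≤ u0 x) (huC : ∀ x, u0 x ≤ C)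
    (hgm : Measurable g)
    (hg : ∀ r, MemLp ((Metric.closedBall (0 : PP N) r).indicator g) 2)
    (W1 : ∀ ψ : PP N → ℝ, ContDiff ℝ 1 ψ → HasCompactSupport ψ → ∀ i : Fin N,
        ∫ p, (Om N).indicator (fun p => v p ^ m) p * fderiv ℝ ψ p (0, EuclideanSpace.single i 1)
          = - ∫ p, g p i * ψ p)
    (W2 : ∀ ψ : PP N → ℝ, ContDiff ℝ 1 ψ → HasCompactSupport ψ →
        ∫ p, (Om N).indicator (fun p => v p - u0 p.2) p * fderiv ℝ ψ p (1, 0)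
          = ∫ p, (fderiv ℝ ψ p (0, g p) + (Om N).indicator (fun p => w p.2 * v p ^ q) p * ψ p))
    (hV : ContDiff ℝ 1 V) (hV0 : ∀ p, 0 ≤ V p) (hXc : Continuous X)
    (hX : ∀ p y, fderiv ℝ V p (0, y) = inner ℝ (X p) y) (hYc : Continuous Y)
    (hY : ∀ ψ : PP N → ℝ, ContDiff ℝ 1 ψ → HasCompactSupport ψ →
      ∫ p, fderiv ℝ ψ p (0, X p) = - ∫ p, Y p * ψ p)
    (hs0 : 0 < s0) (hinit : ∀ᵐ p : PP N, p.1 ∈ Icc 0 s0 → u0 p.2 ^ m ≤ V p)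
    (hpt : ∀ᵐ p : PP N, p ∈ Om N → 0 ≤ fderiv ℝ V p (1, 0) * DD m (V p) (v p)
      + (w p.2 * v p ^ q - Y p) * bet (v p ^ m - V p))
    (hΦ : ContDiff ℝ 1 Φ) (hΦ0 : ∀ p, 0 ≤ Φ p)
    (hΦr : ∀ p ∉ Metric.closedBall (0 : PP N) r0, Φ p = 0)
    (hΞc : Continuous Ξ) (hΞr : ∀ p ∉ Metric.closedBall (0 : PP N) r0, Ξ p = 0)
    (hΞ : ∀ p y, fderiv ℝ Φ p (0, y) = inner ℝ (Ξ p) y)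
    (hΛc : Continuous Λ) (hΛr : ∀ p ∉ Metric.closedBall (0 : PP N) r0, Λ p = 0)
    (hΛ : ∀ Θ : PP N → ℝ, ContDiff ℝ 1 Θ → ∫ p, fderiv ℝ Θ p (0, Ξ p) = - ∫ p, Θ p * Λ p) :
    - ∫ p, (Om N).indicator (fun p => BB m (V p) (v p) * fderiv ℝ Φ p (1, 0)) p
      ≤ ∫ p, (Om N).indicator (fun p => Gam (v p ^ m - V p) * Λ p) p := by
  have hcm := rpow_cont hm
  have hcq : Continuous (fun ρ : ℝ => ρ ^ q) := Real.continuous_rpow_const hq.le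
  have hC0 : 0 ≤ C := (hv0 0).trans (hvC 0)
  have hcV := hV.continuous
  have hcΦ := hΦ.continuous
  have hmO := measurableSet_Om N
  have hvm : Measurable (fun p => v p ^ m) := hcm.measurable.comp hv
  have hf : ∀ r, MemLp ((Metric.closedBall (0 : PP N) r).indicator
      ((Om N).indicator (fun p => w p.2 * v p ^ q))) 2 := by
    intro r
    have h1 := memLp_ball_of_cont (X := fun p : PP N => w p.2) (hw.comp continuous_snd) r
    have hmf : Measurable (fun p : PP N => w p.2 * v p ^ q) :=
      (hw.measurable.comp measurable_snd).mul (hcq.measurable.comp hv)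
    refine h1.of_le_mul (c := C ^ q) ((hmf.indicator hmO).indicator
      Metric.isClosed_closedBall.measurableSet).aestronglyMeasurable (ae_of_all _ fun p => ?_)
    have hb : v p ^ q ≤ C ^ q := Real.rpow_le_rpow (hv0 p) (hvC p) hq.le
    have hb0 : 0 ≤ v p ^ q := Real.rpow_nonneg (hv0 p) _
    by_cases hp : p ∈ Metric.closedBall (0 : PP N) r
    · rw [indicator_of_mem hp, indicator_of_mem hp]
      by_cases hp' : p ∈ Om N
      · rw [indicator_of_mem hp', norm_mul, Real.norm_of_nonneg hb0, mul_comm]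
        exact mul_le_mul_of_nonneg_right hb (norm_nonneg _)
      · rw [indicator_of_notMem hp', norm_zero]
        exact mul_nonneg (Real.rpow_nonneg hC0 _) (norm_nonneg _)
    · rw [indicator_of_notMem hp, indicator_of_notMem hp, norm_zero, mul_zero]
  obtain ⟨rr, hlim, hle⟩ := energy_limit (U := (Om N).indicator (fun p => v p - u0 p.2))
    (z := (Om N).indicator (fun p => v p ^ m)) (C := C) (M := C ^ m) (r0 := r0) (Λ := Λ) (Ξ := Ξ)
    ((hv.sub (hu.comp measurable_snd)).indicator hmO)
    (fun p => by
      by_cases hp : p ∈ Om N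
      · rw [indicator_of_mem hp, abs_le]
        constructor <;> linarith [hv0 p, hvC p, hu0 p.2, huC p.2]
      · rw [indicator_of_notMem hp, abs_zero]; exact hC0)
    hf (hvm.indicator hmO)
    (fun p => indicator_nonneg (fun p _ => Real.rpow_nonneg (hv0 p) _) p)
    (fun p => by
      by_cases hp : p ∈ Om N
      · rw [indicator_of_mem hp]; exact Real.rpow_le_rpow (hv0 p) (hvC p) (by linarith)
      · rw [indicator_of_notMem hp]; exact Real.rpow_nonneg hC0 _)
    hgm hg W1 W2 hV hV0 hXc hX hYc hY hΦ hΦ0 hΦr hΞc hΞr hΞ hΛc hΛr hΛ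
  have hrr := time_part hm hv hv0 hvC hu hu0 huC hV hV0 hΦ hΦ0 hΦr hs0 hinit hlim
  have hcdV : Continuous (fun p => fderiv ℝ V p (1, 0)) :=
    (hV.continuous_fderiv one_ne_zero).clm_apply continuous_const
  have hcdΦ : Continuous (fun p => fderiv ℝ Φ p (1, 0)) :=
    (hΦ.continuous_fderiv one_ne_zero).clm_apply continuous_const
  have cx : Continuous (fun z : PP N × ℝ => z.2 ^ m - V z.1) :=
    (hcm.comp continuous_snd).sub (hcV.comp continuous_fst)
  have cVx : Continuous (fun z : PP N × ℝ => (V z.1, z.2)) :=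
    (hcV.comp continuous_fst).prodMk continuous_snd
  have cbΦ : Continuous (fun z : PP N × ℝ => bet (z.2 ^ m - V z.1) * Φ z.1) :=
    (bet_cont.comp cx).mul (hcΦ.comp continuous_fst)
  have i1 := int_H (r := r0) (H := fun p x => w p.2 * x ^ q * (bet (x ^ m - V p) * Φ p)) hv hv0 hvC
    (((hw.comp (continuous_snd.comp continuous_fst)).mul (hcq.comp continuous_snd)).mul cbΦ)
    (fun p hp x => by simp only [hΦr p hp, mul_zero])
  have i2 := int_H (r := r0) (H := fun p x => Y p * (bet (x ^ m - V p) * Φ p)) hv hv0 hvC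
    ((hYc.comp continuous_fst).mul cbΦ)
    (fun p hp x => by simp only [hΦr p hp, mul_zero])
  have i4 := int_H (r := r0) (H := fun p x => BB m (V p) x * fderiv ℝ Φ p (1, 0)) hv hv0 hvC
    (((BB_cont hm).comp cVx).mul (hcdΦ.comp continuous_fst))
    (fun p hp x => by simp only [fderiv_off hΦr p hp, zero_apply, mul_zero])
  have i5 := int_H (r := r0) (H := fun p x => DD m (V p) x * fderiv ℝ V p (1, 0) * Φ p) hv hv0 hvC
    ((((DD_cont hm).comp cVx).mul (hcdV.comp continuous_fst)).mul (hcΦ.comp continuous_fst))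
    (fun p hp x => by simp only [hΦr p hp, mul_zero])
  have e1 : ∫ p, (Om N).indicator (fun p => w p.2 * v p ^ q) p *
      (bet ((Om N).indicator (fun p => v p ^ m) p - V p) * Φ p) =
      ∫ p, (Om N).indicator (fun p => w p.2 * v p ^ q * (bet (v p ^ m - V p) * Φ p)) p := by
    refine integral_congr_ae (ae_of_all _ fun p => ?_)
    by_cases hp : p ∈ Om N
    · simp only [indicator_of_mem hp]
    · simp only [indicator_of_notMem hp, zero_mul]
  have e2 : ∫ p, Y p * (bet ((Om N).indicator (fun p => v p ^ m) p - V p) * Φ p) =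
      ∫ p, (Om N).indicator (fun p => Y p * (bet (v p ^ m - V p) * Φ p)) p := by
    refine integral_congr_ae (ae_of_all _ fun p => ?_)
    by_cases hp : p ∈ Om N
    · simp only [indicator_of_mem hp]
    · simp only [indicator_of_notMem hp, bet_of_nonpos (show 0 - V p ≤ 0 by linarith [hV0 p]),
        zero_mul, mul_zero]
  have e3 : ∫ p, Gam ((Om N).indicator (fun p => v p ^ m) p - V p) * Λ p =
      ∫ p, (Om N).indicator (fun p => Gam (v p ^ m - V p) * Λ p) p := by
    refine integral_congr_ae (ae_of_all _ fun p => ?_)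
    by_cases hp : p ∈ Om N
    · simp only [indicator_of_mem hp]
    · simp only [indicator_of_notMem hp, Gam_of_nonpos (show 0 - V p ≤ 0 by linarith [hV0 p]),
        zero_mul]
  have e4 : ∫ p, (Om N).indicator (fun p => BB m (V p) (v p) * fderiv ℝ Φ p (1, 0)
        - DD m (V p) (v p) * fderiv ℝ V p (1, 0) * Φ p) p =
      (∫ p, (Om N).indicator (fun p => BB m (V p) (v p) * fderiv ℝ Φ p (1, 0)) p)
      - ∫ p, (Om N).indicator (fun p => DD m (V p) (v p) * fderiv ℝ V p (1, 0) * Φ p) p := by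
    rw [← integral_sub i4 i5]
    refine integral_congr_ae (ae_of_all _ fun p => ?_)
    by_cases hp : p ∈ Om N
    · simp only [indicator_of_mem hp]
    · simp only [indicator_of_notMem hp, sub_zero]
  have hpos : 0 ≤ ∫ p, ((Om N).indicator (fun p => w p.2 * v p ^ q * (bet (v p ^ m - V p) * Φ p)) p
      - (Om N).indicator (fun p => Y p * (bet (v p ^ m - V p) * Φ p)) p
      + (Om N).indicator (fun p => DD m (V p) (v p) * fderiv ℝ V p (1, 0) * Φ p) p) := by
    refine integral_nonneg_of_ae ?_
    filter_upwards [hpt] with p hp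
    by_cases hp' : p ∈ Om N
    · simp only [indicator_of_mem hp', Pi.zero_apply]
      have := mul_nonneg (hp hp') (hΦ0 p)
      calc 0 ≤ _ := this
        _ = _ := by ring
    · simp only [indicator_of_notMem hp', Pi.zero_apply, sub_zero, add_zero, le_refl]
  have e5 := integral_add (i1.sub i2) i5
  simp only [Pi.sub_apply] at e5
  rw [e5, integral_sub i1 i2] at hpos
  rw [e1, e2, e3] at hle
  rw [e4] at hrr
  linarith

theorem euc_sum {N : ℕ} (L : PP N →L[ℝ] ℝ) (y : EE N) :
    L (0, y) = ∑ i, y i * L (0, EuclideanSpace.single i 1) := by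
  have h1 : (L.comp (ContinuousLinearMap.inr ℝ ℝ (EE N))) y = L (0, y) := by simp
  have h2 : y = ∑ i, y i • (EuclideanSpace.single i (1:ℝ) : EE N) := by
    have := (EuclideanSpace.basisFun (Fin N) ℝ).sum_repr y
    simpa using this.symm
  rw [← h1]
  conv_lhs => rw [h2]
  rw [map_sum]
  refine Finset.sum_congr rfl fun i _ => ?_
  rw [map_smul]; simp

theorem div_ibp {N : ℕ} {X : PP N → EE N} {Y Θ : PP N → ℝ} {L : Fin N → PP N → PP N →L[ℝ] ℝ} {r : ℝ}
    (hXc : Continuous X)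
    (hL : ∀ i p, HasFDerivAt (fun p => X p i) (L i p) p)
    (hLc : ∀ i, Continuous (fun p => L i p (0, EuclideanSpace.single i 1)))
    (hY : ∀ p, Y p = ∑ i, L i p (0, EuclideanSpace.single i 1))
    (hΘ : ContDiff ℝ 1 Θ)
    (hz : (∀ p ∉ Metric.closedBall (0 : PP N) r, Θ p = 0) ∨
      (∀ p ∉ Metric.closedBall (0 : PP N) r, X p = 0)) :
    ∫ p, fderiv ℝ Θ p (0, X p) = - ∫ p, Θ p * Y p := by
  have hXi : ∀ i, Continuous (fun p => X p i) := fun i =>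
    (EuclideanSpace.proj (𝕜 := ℝ) i).continuous.comp hXc
  have hdc : ∀ i, Continuous (fun p => fderiv ℝ Θ p (0, (EuclideanSpace.single i 1 : EE N))) := fun i =>
    (hΘ.continuous_fderiv one_ne_zero).clm_apply continuous_const
  have hz1 : ∀ p ∉ Metric.closedBall (0 : PP N) r, (Θ p = 0 ∧ fderiv ℝ Θ p = 0) ∨
      (X p = 0 ∧ ∀ i, L i p = 0) := by
    intro p hp
    rcases hz with h | h
    · exact Or.inl ⟨h p hp, fderiv_off h p hp⟩
    · refine Or.inr ⟨h p hp, fun i => ?_⟩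
      rw [← (hL i p).fderiv]
      exact fderiv_off (ψ := fun p => X p i) (r := r) (fun p hp => by simp [h p hp]) p hp
  have int : ∀ F : PP N → ℝ, Continuous F → (∀ p ∉ Metric.closedBall (0 : PP N) r, F p = 0) →
      Integrable F := fun F hF h0 =>
    hF.integrable_of_hasCompactSupport (HasCompactSupport.intro (isCompact_closedBall _ _) h0)
  have i1 : ∀ i, Integrable (fun p => X p i * fderiv ℝ Θ p (0, (EuclideanSpace.single i 1 : EE N))) := by
    intro i
    refine int _ ((hXi i).mul (hdc i)) fun p hp => ?_
    rcases hz1 p hp with h | h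
    · simp [h.2]
    · simp [h.1]
  have i2 : ∀ i, Integrable (fun p => L i p (0, EuclideanSpace.single i 1) * Θ p) := by
    intro i
    refine int _ ((hLc i).mul hΘ.continuous) fun p hp => ?_
    rcases hz1 p hp with h | h
    · simp [h.1]
    · simp [h.2]
  have i3 : ∀ i, Integrable (fun p => X p i * Θ p) := by
    intro i
    refine int _ ((hXi i).mul hΘ.continuous) fun p hp => ?_
    rcases hz1 p hp with h | h
    · simp [h.1]
    · simp [h.1]
  have key : ∀ i, ∫ p, X p i * fderiv ℝ Θ p (0, (EuclideanSpace.single i 1 : EE N)) =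
      - ∫ p, L i p (0, EuclideanSpace.single i 1) * Θ p := by
    intro i
    have e : ∀ p, fderiv ℝ (fun p => X p i) p = L i p := fun p => (hL i p).fderiv
    have := integral_mul_fderiv_eq_neg_fderiv_mul_of_integrable (μ := (volume : Measure (PP N)))
      (f := fun p => X p i) (g := Θ) (v := ((0:ℝ), (EuclideanSpace.single i 1 : EE N)))
      (by simpa only [e] using i2 i) (i1 i) (i3 i) (fun p _ => (hL i p).differentiableAt)
      (fun p _ => hΘ.differentiable one_ne_zero p)
    simpa only [e] using this
  have e1 : ∀ p, fderiv ℝ Θ p (0, X p) = ∑ i, X p i * fderiv ℝ Θ p (0, EuclideanSpace.single i 1) :=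
    fun p => euc_sum _ _
  have e2 : ∀ p, Θ p * Y p = ∑ i, L i p (0, EuclideanSpace.single i 1) * Θ p := by
    intro p; rw [hY, mul_comm, Finset.sum_mul]
  simp only [e1, e2]
  rw [integral_finsetSum _ (fun i _ => i1 i), integral_finsetSum _ (fun i _ => i2 i),
    ← Finset.sum_neg_distrib]
  exact Finset.sum_congr rfl fun i _ => key i

/-- time cutoff -/
def th (κ s : ℝ) : ℝ := (max (κ ^ 2 - (s + 1) ^ 2) 0) ^ 2
/-- space cutoff -/
def aa {N : ℕ} (ε : ℝ) (k : ℕ) (x : EE N) : ℝ := (max (1 - ε * ‖x‖ ^ 2) 0) ^ k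

theorem th_nonneg (κ s : ℝ) : 0 ≤ th κ s := by unfold th; positivity
theorem aa_nonneg {N : ℕ} (ε : ℝ) (k : ℕ) (x : EE N) : 0 ≤ aa ε k x := by unfold aa; positivity
theorem th_cont (κ : ℝ) : Continuous (th κ) := by unfold th; fun_prop
theorem aa_cont {N : ℕ} (ε : ℝ) (k : ℕ) : Continuous (aa ε k : EE N → ℝ) := by unfold aa; fun_prop
theorem th_contDiff (κ : ℝ) : ContDiff ℝ 1 (th κ) :=
  (pos_pow_contDiff 0).comp (f := fun s : ℝ => κ ^ 2 - (s + 1) ^ 2) (by fun_prop)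
theorem aa_contDiff {N : ℕ} (ε : ℝ) (k : ℕ) : ContDiff ℝ 1 (aa ε (k + 2) : EE N → ℝ) :=
  (pos_pow_contDiff k).comp (f := fun x : EE N => 1 - ε * ‖x‖ ^ 2)
    (contDiff_const.sub (contDiff_const.mul (contDiff_norm_sq ℝ)))

theorem th_deriv (κ s : ℝ) : HasDerivAt (th κ) (-(4 * (s + 1) * max (κ ^ 2 - (s + 1) ^ 2) 0)) s := by
  have h1 : HasDerivAt (fun s : ℝ => κ ^ 2 - (s + 1) ^ 2) (-(2 * (s + 1))) s := by
    have := ((((hasDerivAt_id s).add_const 1).pow 2).const_sub (κ ^ 2))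
    simpa using this
  have := (pos_pow_deriv 0 (κ ^ 2 - (s + 1) ^ 2)).comp s h1
  refine this.congr_deriv ?_
  push_cast
  simp only [zero_add, pow_one]
  ring

theorem aa_deriv {N : ℕ} (ε : ℝ) (k : ℕ) (x : EE N) :
    HasFDerivAt (aa ε (k + 2)) ((-(2 * ε * (k + 2) * aa ε (k + 1) x)) • innerSL ℝ x) x := by
  have h1 : HasFDerivAt (fun x : EE N => 1 - ε * ‖x‖ ^ 2) (-(ε • (2 • innerSL ℝ x))) x :=
    ((hasStrictFDerivAt_norm_sq x).hasFDerivAt.const_mul ε).const_sub 1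
  have := (pos_pow_deriv k (1 - ε * ‖x‖ ^ 2)).comp_hasFDerivAt x h1
  refine this.congr_fderiv ?_
  ext y
  simp [aa]
  ring

theorem cut_off {N : ℕ} {κ ε : ℝ} (hκ : 0 < κ) (hε : 0 < ε) {p : PP N}
    (hp : p ∉ Metric.closedBall (0 : PP N) (κ + 2 + 1 / ε)) :
    max (κ ^ 2 - (p.1 + 1) ^ 2) 0 = 0 ∨ max (1 - ε * ‖p.2‖ ^ 2) 0 = 0 := by
  by_contra hcon
  push Not at hcon
  apply hp
  have h1 : (p.1 + 1) ^ 2 < κ ^ 2 := by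
    by_contra h; exact hcon.1 (max_eq_right (by linarith))
  have h2 : ε * ‖p.2‖ ^ 2 < 1 := by
    by_contra h; exact hcon.2 (max_eq_right (by linarith))
  have h3 := abs_lt_of_sq_lt_sq h1 hκ.le
  rw [abs_lt] at h3
  have hε' : 0 < 1 / ε := by positivity
  have h4 : ‖p.2‖ ^ 2 < 1 / ε := by rw [lt_div_iff₀ hε]; linarith
  rw [mem_closedBall_zero_iff, Prod.norm_def]
  refine max_le ?_ ?_
  · rw [Real.norm_eq_abs, abs_le]; constructor <;> linarith [h3.1, h3.2]
  · nlinarith [norm_nonneg p.2]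

structure Sol (N : ℕ) (m q C : ℝ) (w u0 : EE N → ℝ) (v : PP N → ℝ) : Prop where
  hm : 1 < m
  hq : 0 < q
  hw : Continuous w
  hv : Measurable v
  hv0 : ∀ p, 0 ≤ v p
  hvC : ∀ p, v p ≤ C
  hu : Measurable u0
  hu0 : ∀ x, 0 ≤ u0 x
  huC : ∀ x, u0 x ≤ C
  ex : ∃ g : PP N → EE N, Measurable g ∧
    (∀ r, MemLp ((Metric.closedBall (0 : PP N) r).indicator g) 2) ∧
    (∀ ψ : PP N → ℝ, ContDiff ℝ 1 ψ → HasCompactSupport ψ → ∀ i : Fin N,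
        ∫ p, (Om N).indicator (fun p => v p ^ m) p * fderiv ℝ ψ p (0, EuclideanSpace.single i 1)
          = - ∫ p, g p i * ψ p) ∧
    (∀ ψ : PP N → ℝ, ContDiff ℝ 1 ψ → HasCompactSupport ψ →
        ∫ p, (Om N).indicator (fun p => v p - u0 p.2) p * fderiv ℝ ψ p (1, 0)
          = ∫ p, (fderiv ℝ ψ p (0, g p) + (Om N).indicator (fun p => w p.2 * v p ^ q) p * ψ p))

structure Bar (N : ℕ) (m q s0 : ℝ) (w u0 : EE N → ℝ) (v V Y : PP N → ℝ) (X : PP N → EE N) : Prop where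
  hV : ContDiff ℝ 1 V
  hV0 : ∀ p, 0 ≤ V p
  hXc : Continuous X
  hX : ∀ p y, fderiv ℝ V p (0, y) = inner ℝ (X p) y
  hYc : Continuous Y
  hY : ∀ ψ : PP N → ℝ, ContDiff ℝ 1 ψ → HasCompactSupport ψ →
      ∫ p, fderiv ℝ ψ p (0, X p) = - ∫ p, Y p * ψ p
  hs0 : 0 < s0
  hinit : ∀ᵐ p : PP N, p.1 ∈ Icc 0 s0 → u0 p.2 ^ m ≤ V p
  hpt : ∀ᵐ p : PP N, p ∈ Om N → 0 ≤ fderiv ℝ V p (1, 0) * DD m (V p) (v p)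
      + (w p.2 * v p ^ q - Y p) * bet (v p ^ m - V p)

theorem Phi_deriv {N : ℕ} (κ ε : ℝ) (k : ℕ) (p : PP N) :
    HasFDerivAt (fun p : PP N => th κ p.1 * aa ε (k + 2) p.2)
      (th κ p.1 • ((-(2 * ε * (k + 2) * aa ε (k + 1) p.2)) • innerSL ℝ p.2).comp
          (ContinuousLinearMap.snd ℝ ℝ (EE N))
        + aa ε (k + 2) p.2 • ((-(4 * (p.1 + 1) * max (κ ^ 2 - (p.1 + 1) ^ 2) 0)) •
          ContinuousLinearMap.fst ℝ ℝ (EE N))) p := by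
  have h1 : HasFDerivAt (fun p : PP N => th κ p.1) _ p :=
    HasDerivAt.comp_hasFDerivAt (h₂ := th κ) (f := fun p : PP N => p.1) p (th_deriv κ p.1)
      (hasFDerivAt_fst (𝕜 := ℝ) (E := ℝ) (F := EE N))
  have h2 : HasFDerivAt (fun p : PP N => aa ε (k + 2) p.2) _ p :=
    (aa_deriv ε k p.2).comp p hasFDerivAt_snd
  exact h1.mul h2

def Xi {N : ℕ} (κ ε : ℝ) (k : ℕ) (p : PP N) : EE N :=
  (-(2 * ε * (k + 3) * (th κ p.1 * aa ε (k + 2) p.2))) • p.2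

def Lam {N : ℕ} (κ ε : ℝ) (k : ℕ) (p : PP N) : ℝ :=
  th κ p.1 * (-(2 * ε * (k + 3) * N * aa ε (k + 2) p.2)
    + 4 * ε ^ 2 * (k + 3) * (k + 2) * aa ε (k + 1) p.2 * ‖p.2‖ ^ 2)

theorem Xi_cont {N : ℕ} (κ ε : ℝ) (k : ℕ) : Continuous (Xi (N := N) κ ε k) := by
  have h1 : Continuous (fun p : PP N => th κ p.1) := (th_cont κ).comp continuous_fst
  have h2 : Continuous (fun p : PP N => aa ε (k + 2) p.2) := (aa_cont ε _).comp continuous_snd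
  unfold Xi; fun_prop

theorem Lam_cont {N : ℕ} (κ ε : ℝ) (k : ℕ) : Continuous (Lam (N := N) κ ε k) := by
  have h1 : Continuous (fun p : PP N => th κ p.1) := (th_cont κ).comp continuous_fst
  have h2 : ∀ k, Continuous (fun p : PP N => aa ε k p.2) := fun k => (aa_cont ε _).comp continuous_snd
  have := h2 (k+1)
  have := h2 (k+2)
  unfold Lam; fun_prop

theorem Lam_ibp {N : ℕ} {κ ε : ℝ} (k : ℕ) {r : ℝ}
    (hr : ∀ p ∉ Metric.closedBall (0 : PP N) r, Xi κ ε k p = 0)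
    (Θ : PP N → ℝ) (hΘ : ContDiff ℝ 1 Θ) :
    ∫ p, fderiv ℝ Θ p (0, Xi κ ε k p) = - ∫ p, Θ p * Lam κ ε k p := by
  have hD : ∀ (i : Fin N) (p : PP N), HasFDerivAt (fun p : PP N => Xi κ ε k p i) _ p := fun i p =>
    (((Phi_deriv κ ε k p).const_mul (2 * ε * (k + 3))).neg).mul
      (((EuclideanSpace.proj (𝕜 := ℝ) i).hasFDerivAt (x := p.2)).comp p hasFDerivAt_snd)
  have hval : ∀ (i : Fin N) (p : PP N), fderiv ℝ (fun p : PP N => Xi κ ε k p i) p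
      (0, EuclideanSpace.single i 1) = -(2 * ε * (k + 3)) * (th κ p.1 * aa ε (k + 2) p.2) +
        4 * ε ^ 2 * (k + 3) * (k + 2) * th κ p.1 * aa ε (k + 1) p.2 * (p.2 i) ^ 2 := by
    intro i p
    rw [(hD i p).fderiv]
    simp [EuclideanSpace.inner_single_right]
    ring
  refine div_ibp (L := fun i p => fderiv ℝ (fun p : PP N => Xi κ ε k p i) p) (r := r) (Xi_cont κ ε k)
    (fun i p => (hD i p).differentiableAt.hasFDerivAt) ?_ ?_ hΘ (Or.inr hr)
  · intro i
    simp only [hval]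
    have h1 : Continuous (fun p : PP N => th κ p.1) := (th_cont κ).comp continuous_fst
    have h2 : ∀ k, Continuous (fun p : PP N => aa ε k p.2) := fun k => (aa_cont ε _).comp continuous_snd
    have := h2 (k+1)
    have := h2 (k+2)
    fun_prop
  · intro p
    simp only [hval, Lam]
    rw [Finset.sum_add_distrib, Finset.sum_const, ← Finset.mul_sum, EuclideanSpace.norm_sq_eq]
    simp
    ring

theorem step_ineq {N : ℕ} {m q C s0 : ℝ} {w u0 : EE N → ℝ} {v V Y : PP N → ℝ} {X : PP N → EE N}
    (S : Sol N m q C w u0 v) (B : Bar N m q s0 w u0 v V Y X) {κ ε : ℝ} (hκ : 0 < κ) (hε : 0 < ε)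
    (k : ℕ) :
    4 / κ ^ 2 * (∫ p, (Om N).indicator (fun p => BB m (V p) (v p) * (th κ p.1 * aa ε (k + 3) p.2)) p)
      ≤ (m * C ^ (m - 1) * (4 * (k + 3) * (k + 2) * ε)) *
      ∫ p, (Om N).indicator (fun p => BB m (V p) (v p) * (th κ p.1 * aa ε (k + 1) p.2)) p := by
  obtain ⟨g, hgm, hg, W1, W2⟩ := S.ex
  have hm := S.hm
  have hcV := B.hV.continuous
  have hth : ∀ p : PP N, max (κ ^ 2 - (p.1 + 1) ^ 2) 0 = 0 → th κ p.1 = 0 := fun p h => by simp [th, h]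
  have haa : ∀ (j : ℕ) (p : PP N), max (1 - ε * ‖p.2‖ ^ 2) 0 = 0 → aa ε (j + 1) p.2 = 0 :=
    fun j p h => by simp [aa, h]
  have hoff : ∀ (j : ℕ), ∀ p ∉ Metric.closedBall (0 : PP N) (κ + 2 + 1 / ε),
      th κ p.1 * aa ε (j + 1) p.2 = 0 := by
    intro j p hp
    rcases cut_off hκ hε hp with h | h
    · rw [hth p h, zero_mul]
    · rw [haa j p h, mul_zero]
  have hΞr : ∀ p ∉ Metric.closedBall (0 : PP N) (κ + 2 + 1 / ε), Xi κ ε k p = 0 := by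
    intro p hp
    unfold Xi
    rw [hoff (k + 1) p hp]; simp
  have hΛr : ∀ p ∉ Metric.closedBall (0 : PP N) (κ + 2 + 1 / ε), Lam κ ε k p = 0 := by
    intro p hp
    unfold Lam
    rcases cut_off hκ hε hp with h | h
    · rw [hth p h, zero_mul]
    · rw [haa k p h, haa (k + 1) p h]; simp
  have hdt : ∀ p : PP N, fderiv ℝ (fun p : PP N => th κ p.1 * aa ε (k + 3) p.2) p (1, 0) =
      - (aa ε (k + 3) p.2 * (4 * (p.1 + 1) * max (κ ^ 2 - (p.1 + 1) ^ 2) 0)) := by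
    intro p
    have := (Phi_deriv κ ε (k + 1) p).fderiv
    rw [show k + 1 + 2 = k + 3 from rfl] at this
    rw [this]
    simp
  have hΦ : ContDiff ℝ 1 (fun p : PP N => th κ p.1 * aa ε (k + 3) p.2) :=
    ((th_contDiff κ).comp contDiff_fst).mul ((aa_contDiff ε (k + 1)).comp contDiff_snd)
  have hk := key_ineq (r0 := κ + 2 + 1 / ε) (Φ := fun p : PP N => th κ p.1 * aa ε (k + 3) p.2)
    (Ξ := Xi κ ε k) (Λ := Lam κ ε k) hm S.hq S.hw S.hv S.hv0 S.hvC S.hu S.hu0 S.huC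
    hgm hg W1 W2 B.hV B.hV0 B.hXc B.hX B.hYc B.hY B.hs0 B.hinit B.hpt hΦ
    (fun p => mul_nonneg (th_nonneg _ _) (aa_nonneg _ _ _)) (hoff (k + 2)) (Xi_cont κ ε k) hΞr
    (fun p y => by
      have := (Phi_deriv κ ε (k + 1) p).fderiv
      rw [show k + 1 + 2 = k + 3 from rfl] at this
      rw [this]
      simp [Xi, inner_smul_left]
      ring) (Lam_cont κ ε k) hΛr (Lam_ibp k hΞr)
  have cx : Continuous (fun z : PP N × ℝ => z.2 ^ m - V z.1) :=
    ((rpow_cont hm).comp continuous_snd).sub (hcV.comp continuous_fst)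
  have cB : Continuous (fun z : PP N × ℝ => BB m (V z.1) z.2) :=
    (BB_cont hm).comp ((hcV.comp continuous_fst).prodMk continuous_snd)
  have cth : Continuous (fun z : PP N × ℝ => th κ z.1.1) :=
    (th_cont κ).comp (continuous_fst.comp continuous_fst)
  have caa : ∀ j, Continuous (fun z : PP N × ℝ => aa ε j z.1.2) := fun j =>
    (aa_cont ε j).comp (continuous_snd.comp continuous_fst)
  have iB : ∀ j : ℕ, Integrable ((Om N).indicator
      (fun p => BB m (V p) (v p) * (th κ p.1 * aa ε (j + 1) p.2))) := fun j =>
    int_H (r := κ + 2 + 1 / ε) (H := fun p x => BB m (V p) x * (th κ p.1 * aa ε (j + 1) p.2)) S.hv S.hv0 S.hvC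
      (cB.mul (cth.mul (caa _))) (fun p hp x => by simp only [hoff j p hp, mul_zero])
  have iG : Integrable ((Om N).indicator (fun p => Gam (v p ^ m - V p) * Lam κ ε k p)) :=
    int_H (r := κ + 2 + 1 / ε) (H := fun p x => Gam (x ^ m - V p) * Lam κ ε k p) S.hv S.hv0 S.hvC
      ((Gam_cont.comp cx).mul ((Lam_cont κ ε k).comp continuous_fst))
      (fun p hp x => by simp only [hΛr p hp, mul_zero])
  have iD : Integrable ((Om N).indicator (fun p => BB m (V p) (v p) *
      fderiv ℝ (fun p : PP N => th κ p.1 * aa ε (k + 3) p.2) p (1, 0))) :=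
    int_H (r := κ + 2 + 1 / ε) (H := fun p x => BB m (V p) x *
      fderiv ℝ (fun p : PP N => th κ p.1 * aa ε (k + 3) p.2) p (1, 0)) S.hv S.hv0 S.hvC
      (cB.mul (((hΦ.continuous_fderiv one_ne_zero).clm_apply continuous_const).comp continuous_fst))
      (fun p hp x => by simp only [fderiv_off (hoff (k + 2)) p hp, zero_apply, mul_zero])
  have hle1 : 4 / κ ^ 2 * (∫ p, (Om N).indicator
      (fun p => BB m (V p) (v p) * (th κ p.1 * aa ε (k + 3) p.2)) p) ≤
      - ∫ p, (Om N).indicator (fun p => BB m (V p) (v p) *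
        fderiv ℝ (fun p : PP N => th κ p.1 * aa ε (k + 3) p.2) p (1, 0)) p := by
    rw [← integral_const_mul, ← integral_neg]
    refine integral_mono ((iB (k + 2)).const_mul _) iD.neg fun p => ?_
    by_cases hp : p ∈ Om N
    · simp only [indicator_of_mem hp, hdt]
      have hp1 : 0 < p.1 := hp
      have h1 := mul_nonneg (BB_nonneg (m := m) (V := V p) (S.hv0 p)) (aa_nonneg ε (k + 3) p.2)
      have h2 : 4 / κ ^ 2 * th κ p.1 ≤ 4 * (p.1 + 1) * max (κ ^ 2 - (p.1 + 1) ^ 2) 0 := by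
        unfold th
        have hM0 : 0 ≤ max (κ ^ 2 - (p.1 + 1) ^ 2) 0 := le_max_right _ _
        have hM1 : max (κ ^ 2 - (p.1 + 1) ^ 2) 0 ≤ κ ^ 2 :=
          max_le (by nlinarith [sq_nonneg (p.1 + 1)]) (by positivity)
        have hκ2 : 0 < κ ^ 2 := by positivity
        rw [div_mul_eq_mul_div, div_le_iff₀ hκ2]
        nlinarith [mul_le_mul_of_nonneg_left hM1 hM0, mul_nonneg hp1.le (mul_nonneg hM0 hκ2.le)]
      calc _ = (BB m (V p) (v p) * aa ε (k + 3) p.2) * (4 / κ ^ 2 * th κ p.1) := by ring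
        _ ≤ (BB m (V p) (v p) * aa ε (k + 3) p.2) * _ := mul_le_mul_of_nonneg_left h2 h1
        _ = _ := by ring
    · simp only [indicator_of_notMem hp, mul_zero, neg_zero, le_refl]
  have hle2 : ∫ p, (Om N).indicator (fun p => Gam (v p ^ m - V p) * Lam κ ε k p) p ≤
      (m * C ^ (m - 1) * (4 * (k + 3) * (k + 2) * ε)) *
      ∫ p, (Om N).indicator (fun p => BB m (V p) (v p) * (th κ p.1 * aa ε (k + 1) p.2)) p := by
    rw [← integral_const_mul]
    refine integral_mono iG ((iB k).const_mul _) fun p => ?_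
    by_cases hp : p ∈ Om N
    · simp only [indicator_of_mem hp]
      have h1 := Gam_le_BB hm (B.hV0 p) (S.hv0 p) (S.hvC p)
      have ht := th_nonneg κ p.1
      have ha := aa_nonneg ε (k + 1) p.2
      have h2 : Lam κ ε k p ≤ 4 * (k + 3) * (k + 2) * ε * (th κ p.1 * aa ε (k + 1) p.2) := by
        unfold Lam
        have h3 : 0 ≤ 2 * ε * (k + 3) * N * aa ε (k + 2) p.2 := by
          have := aa_nonneg ε (k + 2) p.2
          positivity
        have h4 : aa ε (k + 1) p.2 * (ε * ‖p.2‖ ^ 2) ≤ aa ε (k + 1) p.2 * 1 := by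
          rcases le_or_gt (ε * ‖p.2‖ ^ 2) 1 with h | h
          · exact mul_le_mul_of_nonneg_left h ha
          · rw [haa k p (max_eq_right (by linarith))]; simp
        have h5 : (0:ℝ) ≤ 4 * ε * (k + 3) * (k + 2) := by positivity
        calc _ ≤ th κ p.1 * (4 * ε ^ 2 * (k + 3) * (k + 2) * aa ε (k + 1) p.2 * ‖p.2‖ ^ 2) :=
              mul_le_mul_of_nonneg_left (by linarith) ht
          _ = th κ p.1 * ((4 * ε * (k + 3) * (k + 2)) * (aa ε (k + 1) p.2 * (ε * ‖p.2‖ ^ 2))) := by ring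
          _ ≤ th κ p.1 * ((4 * ε * (k + 3) * (k + 2)) * (aa ε (k + 1) p.2 * 1)) :=
              mul_le_mul_of_nonneg_left (mul_le_mul_of_nonneg_left h4 h5) ht
          _ = _ := by ring
      have h6 : 0 ≤ 4 * (k + 3) * (k + 2) * ε * (th κ p.1 * aa ε (k + 1) p.2) := by positivity
      calc _ ≤ Gam (v p ^ m - V p) * _ := mul_le_mul_of_nonneg_left h2 (Gam_nonneg _)
        _ ≤ _ * _ := mul_le_mul_of_nonneg_right h1 h6
        _ = _ := by ring
    · simp only [indicator_of_notMem hp, mul_zero, le_refl]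
  exact hle1.trans (hk.trans hle2)

theorem BB_le {m V r C : ℝ} (hm : 1 < m) (hV : 0 ≤ V) (hr : 0 ≤ r) (hC : r ≤ C) :
    BB m V r ≤ C * bet (C ^ m) := by
  have h := BB_convex hm (V := V) hr le_rfl
  have h0 : BB m V 0 = 0 := by simp [BB]
  rw [h0, sub_zero, sub_zero] at h
  refine h.trans (mul_le_mul hC (bet_mono ?_) (bet_nonneg _) (hr.trans hC))
  have := Real.rpow_le_rpow hr hC (by linarith : 0 ≤ m)
  linarith

def yy {N : ℕ} (m κ : ℝ) (V v : PP N → ℝ) (ε : ℝ) (k : ℕ) : ℝ :=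
  ∫ p, (Om N).indicator (fun p => BB m (V p) (v p) * (th κ p.1 * aa ε k p.2)) p

theorem yy_iter {N : ℕ} {m q C s0 : ℝ} {w u0 : EE N → ℝ} {v V Y : PP N → ℝ} {X : PP N → EE N}
    (S : Sol N m q C w u0 v) (B : Bar N m q s0 w u0 v V Y X) {κ : ℝ} (hκ : 0 < κ) (i : ℕ) :
    ∃ K, 0 ≤ K ∧ ∀ ε, 0 < ε → yy m κ V v ε (2 * i + 1) ≤ K * ε ^ i * yy m κ V v ε 1 := by
  have hC0 : 0 ≤ C := (S.hv0 0).trans (S.hvC 0)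
  have hm := S.hm
  have hL : 0 ≤ m * C ^ (m - 1) := mul_nonneg (by linarith) (Real.rpow_nonneg hC0 _)
  induction i with
  | zero => exact ⟨1, zero_le_one, fun ε _ => by simp⟩
  | succ i ih =>
    obtain ⟨K, hK, h⟩ := ih
    refine ⟨κ ^ 2 / 4 * (m * C ^ (m - 1) * (4 * ((2 * i : ℕ) + 3) * ((2 * i : ℕ) + 2))) * K, by positivity,
      fun ε hε => ?_⟩
    have h1 := step_ineq S B hκ hε (2 * i)
    have h2 := h ε hε
    change 4 / κ ^ 2 * yy m κ V v ε (2 * i + 3) ≤ _ * yy m κ V v ε (2 * i + 1) at h1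
    have hκ2 : 0 < κ ^ 2 := by positivity
    rw [div_mul_eq_mul_div, div_le_iff₀ hκ2] at h1
    rw [show 2 * (i + 1) + 1 = 2 * i + 3 by ring]
    have h3 : 0 ≤ m * C ^ (m - 1) * (4 * ((2 * i : ℕ) + 3) * ((2 * i : ℕ) + 2) * ε) := by positivity
    have h4 := mul_le_mul_of_nonneg_left h2 h3
    have h5 := mul_le_mul_of_nonneg_right h4 hκ2.le
    have h6 := h1.trans h5
    have : yy m κ V v ε (2 * i + 3) ≤ (m * C ^ (m - 1) * (4 * ((2 * i : ℕ) + 3) * ((2 * i : ℕ) + 2) * ε) *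
      (K * ε ^ i * yy m κ V v ε 1) * κ ^ 2) / 4 := by linarith
    refine this.trans (le_of_eq ?_)
    rw [pow_succ]; ring

theorem th_le {κ s : ℝ} : th κ s ≤ (κ ^ 2) ^ 2 := by
  unfold th
  have : max (κ ^ 2 - (s + 1) ^ 2) 0 ≤ κ ^ 2 :=
    max_le (by nlinarith [sq_nonneg (s + 1)]) (by positivity)
  gcongr

theorem yy_one {N : ℕ} {m C : ℝ} {v V : PP N → ℝ} (hm : 1 < m) 
    (hv0 : ∀ p, 0 ≤ v p) (hvC : ∀ p, v p ≤ C) (hV0 : ∀ p, 0 ≤ V p) {κ : ℝ} (hκ : 0 < κ) :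
    ∃ K, 0 ≤ K ∧ ∀ n : ℝ, 1 ≤ n → yy m κ V v (1 / n ^ 2) 1 ≤ K * n ^ N := by
  have hC0 : 0 ≤ C := (hv0 0).trans (hvC 0)
  have hbC := bet_nonneg (C ^ m)
  refine ⟨C * bet (C ^ m) * (κ ^ 2) ^ 2 * (κ * (volume (Metric.closedBall (0 : EE N) 1)).toReal), by positivity,
    fun n hn => ?_⟩
  have hn0 : 0 < n := by linarith
  set M := C * bet (C ^ m) * (κ ^ 2) ^ 2 with hM
  have hM0 : 0 ≤ M := by positivity
  have hS : MeasurableSet ((Icc 0 κ) ×ˢ (Metric.closedBall (0 : EE N) n)) :=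
    measurableSet_Icc.prod Metric.isClosed_closedBall.measurableSet
  have hvol : (volume : Measure (PP N)) ((Icc 0 κ) ×ˢ (Metric.closedBall (0 : EE N) n)) =
      ENNReal.ofReal κ * (ENNReal.ofReal (n ^ N) * volume (Metric.closedBall (0 : EE N) 1)) := by
    rw [Measure.volume_eq_prod, Measure.prod_prod, Real.volume_Icc, sub_zero,
      Measure.addHaar_closedBall' _ _ hn0.le, finrank_euclideanSpace_fin]
  have hfin : (volume : Measure (PP N)) ((Icc 0 κ) ×ˢ (Metric.closedBall (0 : EE N) n)) ≠ ⊤ :=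
    (isCompact_Icc.prod (isCompact_closedBall _ _)).measure_ne_top
  have hint : Integrable (((Icc 0 κ) ×ˢ (Metric.closedBall (0 : EE N) n)).indicator (fun _ => M)) := by
    rw [integrable_indicator_iff hS]
    exact integrableOn_const hfin
  have hle : yy m κ V v (1 / n ^ 2) 1 ≤
      ∫ p, ((Icc 0 κ) ×ˢ (Metric.closedBall (0 : EE N) n)).indicator (fun _ => M) p := by
    unfold yy
    refine integral_mono_of_nonneg (ae_of_all _ fun p => indicator_nonneg (fun p _ =>
      mul_nonneg (BB_nonneg (hv0 p)) (mul_nonneg (th_nonneg _ _) (aa_nonneg _ _ _))) p) hint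
      (ae_of_all _ fun p => ?_)
    by_cases hp : p ∈ Om N
    · rw [indicator_of_mem hp]
      have hp1 : 0 < p.1 := hp
      have ha1 : aa (1 / n ^ 2) 1 p.2 ≤ 1 := by
        unfold aa
        rw [pow_one]
        exact max_le (by have : 0 ≤ 1 / n ^ 2 * ‖p.2‖ ^ 2 := by positivity
                         linarith) zero_le_one
      by_cases hp' : p ∈ (Icc 0 κ) ×ˢ (Metric.closedBall (0 : EE N) n)
      · rw [indicator_of_mem hp', hM, mul_assoc (C)]
        have h1 := BB_le hm (hV0 p) (hv0 p) (hvC p)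
        calc _ ≤ (C * bet (C ^ m)) * ((κ ^ 2) ^ 2 * 1) :=
              mul_le_mul h1 (mul_le_mul th_le ha1 (aa_nonneg _ _ _) (by positivity))
                (mul_nonneg (th_nonneg _ _) (aa_nonneg _ _ _)) (by positivity)
          _ = _ := by ring
      · rw [indicator_of_notMem hp']
        apply le_of_eq
        by_cases h1 : p.1 ≤ κ
        · have h2 : n < ‖p.2‖ := by
            by_contra h
            exact hp' ⟨⟨hp1.le, h1⟩, by rw [mem_closedBall_zero_iff]; exact not_lt.1 h⟩
          have : aa (1 / n ^ 2) 1 p.2 = 0 := by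
            unfold aa
            rw [pow_one]
            apply max_eq_right
            rw [one_div_mul_eq_div, sub_nonpos, one_le_div (by positivity)]
            gcongr
          rw [this]; simp
        · have : th κ p.1 = 0 := by
            unfold th
            rw [max_eq_right (by nlinarith)]; simp
          rw [this]; simp
    · rw [indicator_of_notMem hp]
      exact indicator_nonneg (fun _ _ => hM0) p
  refine hle.trans (le_of_eq ?_)
  rw [integral_indicator hS, setIntegral_const, Measure.real, hvol, smul_eq_mul,
    ENNReal.toReal_mul, ENNReal.toReal_mul, ENNReal.toReal_ofReal hκ.le,
    ENNReal.toReal_ofReal (by positivity)]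
  ring

theorem comparison {N : ℕ} {m q C s0 : ℝ} {w u0 : EE N → ℝ} {v V Y : PP N → ℝ} {X : PP N → EE N}
    (S : Sol N m q C w u0 v) (B : Bar N m q s0 w u0 v V Y X) :
    ∀ᵐ p : PP N, p ∈ Om N → v p ^ m ≤ V p := by
  have hm := S.hm
  have hmain : ∀ j : ℕ, ∀ᵐ p : PP N, p ∈ Om N → ‖p.2‖ ≤ j →
      BB m (V p) (v p) * th (j + 2) p.1 = 0 := by
    intro j
    set κ : ℝ := j + 2 with hκd
    have hκ : 0 < κ := by positivity
    obtain ⟨K, hK, h1⟩ := yy_iter S B hκ (N + 1)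
    obtain ⟨K', hK', h2⟩ := yy_one (m := m) (V := V) hm S.hv0 S.hvC B.hV0 hκ
    set k := 2 * (N + 1) + 1 with hk
    set F : PP N → ℝ := (Om N ∩ {p | ‖p.2‖ ≤ j}).indicator
      (fun p => BB m (V p) (v p) * th κ p.1) with hF
    have hS : MeasurableSet (Om N ∩ {p : PP N | ‖p.2‖ ≤ j}) :=
      (measurableSet_Om N).inter (measurableSet_le (by fun_prop) measurable_const)
    have hFm : Measurable F := by
      refine Measurable.indicator ?_ hS
      exact ((BB_cont hm).measurable.comp (B.hV.continuous.measurable.prodMk S.hv)).mul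
        ((th_cont κ).measurable.comp measurable_fst)
    have hF0 : ∀ p, 0 ≤ F p := fun p => indicator_nonneg (fun p _ =>
      mul_nonneg (BB_nonneg (S.hv0 p)) (th_nonneg _ _)) p
    have hFle : ∀ n : ℝ, 1 ≤ n → 2 * j ≤ n → ∀ p, F p ≤ (4 / 3) ^ k *
        (Om N).indicator (fun p => BB m (V p) (v p) * (th κ p.1 * aa (1 / n ^ 2) k p.2)) p := by
      intro n hn hnj p
      by_cases hp : p ∈ Om N ∩ {p : PP N | ‖p.2‖ ≤ j}
      · rw [hF, indicator_of_mem hp, indicator_of_mem hp.1]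
        have hpj : ‖p.2‖ ≤ j := hp.2
        have ha : (3 / 4 : ℝ) ^ k ≤ aa (1 / n ^ 2) k p.2 := by
          unfold aa
          refine pow_le_pow_left₀ (by norm_num) (le_max_of_le_left ?_) k
          have : 1 / n ^ 2 * ‖p.2‖ ^ 2 ≤ 1 / 4 := by
            rw [one_div_mul_eq_div, div_le_iff₀ (by positivity)]
            nlinarith [norm_nonneg p.2]
          linarith
        have e : (4 / 3 : ℝ) ^ k * (3 / 4) ^ k = 1 := by rw [← mul_pow]; norm_num
        have hb := mul_nonneg (BB_nonneg (m := m) (V := V p) (S.hv0 p)) (th_nonneg κ p.1)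
        calc _ = (BB m (V p) (v p) * th κ p.1) * ((4 / 3 : ℝ) ^ k * (3 / 4) ^ k) := by rw [e, mul_one]
          _ ≤ (BB m (V p) (v p) * th κ p.1) * ((4 / 3 : ℝ) ^ k * aa (1 / n ^ 2) k p.2) := by gcongr
          _ = _ := by ring
      · rw [hF, indicator_of_notMem hp]
        exact mul_nonneg (by positivity) (indicator_nonneg (fun p _ =>
          mul_nonneg (BB_nonneg (S.hv0 p)) (mul_nonneg (th_nonneg _ _) (aa_nonneg _ _ _))) p)
    have hyint : ∀ n : ℝ, 1 ≤ n → Integrable ((Om N).indicator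
        (fun p => BB m (V p) (v p) * (th κ p.1 * aa (1 / n ^ 2) k p.2))) := by
      intro n hn
      refine int_H (r := κ + 2 + 1 / (1 / n ^ 2))
        (H := fun p x => BB m (V p) x * (th κ p.1 * aa (1 / n ^ 2) k p.2)) S.hv S.hv0 S.hvC ?_ ?_
      · exact ((BB_cont hm).comp ((B.hV.continuous.comp continuous_fst).prodMk continuous_snd)).mul
          (((th_cont κ).comp (continuous_fst.comp continuous_fst)).mul
            ((aa_cont _ k).comp (continuous_snd.comp continuous_fst)))
      · intro p hp x
        rcases cut_off hκ (by positivity) hp with h | h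
        · simp [th, h]
        · have : aa (1 / n ^ 2) k p.2 = 0 := by
            unfold aa
            rw [h, hk, pow_succ, mul_zero]
          simp only [this, mul_zero]
    have hFi : Integrable F := by
      refine ((hyint (max 1 (2 * j)) (le_max_left _ _)).const_mul ((4 / 3) ^ k)).mono'
        hFm.aestronglyMeasurable (ae_of_all _ fun p => ?_)
      rw [Real.norm_of_nonneg (hF0 p)]
      exact hFle _ (le_max_left _ _) (le_max_right _ _) p
    have hbound : ∀ n : ℝ, 1 ≤ n → 2 * j ≤ n → ∫ p, F p ≤ ((4 / 3) ^ k * (K * K')) / n := by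
      intro n hn hnj
      have hn0 : 0 < n := by linarith
      have a1 : ∫ p, F p ≤ (4 / 3) ^ k * yy m κ V v (1 / n ^ 2) k := by
        unfold yy
        rw [← integral_const_mul]
        exact integral_mono hFi ((hyint n hn).const_mul _) (hFle n hn hnj)
      have a2 := h1 (1 / n ^ 2) (by positivity)
      have a3 : K * (1 / n ^ 2) ^ (N + 1) * yy m κ V v (1 / n ^ 2) 1 ≤
          K * (1 / n ^ 2) ^ (N + 1) * (K' * n ^ N) := by
        gcongr
        exact h2 n hn
      have a4 : (1 / n ^ 2) ^ (N + 1) * n ^ N ≤ 1 / n := by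
        rw [div_pow, one_pow, one_div_mul_eq_div, div_le_div_iff₀ (by positivity) hn0, one_mul,
          ← pow_succ, ← pow_mul]
        exact pow_le_pow_right₀ hn (by omega)
      calc _ ≤ (4 / 3) ^ k * yy m κ V v (1 / n ^ 2) k := a1
        _ ≤ (4 / 3) ^ k * (K * (1 / n ^ 2) ^ (N + 1) * (K' * n ^ N)) := by
          gcongr
          exact a2.trans a3
        _ = (4 / 3) ^ k * (K * K') * ((1 / n ^ 2) ^ (N + 1) * n ^ N) := by ring
        _ ≤ (4 / 3) ^ k * (K * K') * (1 / n) := by gcongr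
        _ = _ := by ring
    have hz : ∫ p, F p = 0 := by
      refine le_antisymm ?_ (integral_nonneg hF0)
      have ht : Tendsto (fun n : ℝ => ((4 / 3) ^ k * (K * K')) / n) atTop (𝓝 0) :=
        tendsto_const_nhds.div_atTop tendsto_id
      refine ge_of_tendsto ht ?_
      filter_upwards [eventually_ge_atTop 1, eventually_ge_atTop (2 * j : ℝ)] with n a b
      exact hbound n a b
    rw [integral_eq_zero_iff_of_nonneg hF0 hFi] at hz
    filter_upwards [hz] with p hp h3 h4
    have := hp
    rw [hF, indicator_of_mem (show p ∈ Om N ∩ {p : PP N | ‖p.2‖ ≤ j} from ⟨h3, h4⟩)] at this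
    exact this
  filter_upwards [ae_all_iff.2 hmain] with p hp hpO
  obtain ⟨j, hj⟩ := exists_nat_ge (max ‖p.2‖ p.1)
  have h1 := hp j hpO ((le_max_left _ _).trans hj)
  have hp1 : 0 < p.1 := hpO
  have hpj := (le_max_right _ _).trans hj
  have hth : th (j + 2) p.1 ≠ 0 := by
    unfold th
    have : 0 < ((j : ℝ) + 2) ^ 2 - (p.1 + 1) ^ 2 := by nlinarith
    rw [max_eq_left this.le]; positivity
  have hB := (mul_eq_zero.1 h1).resolve_right hth
  have hG := Gam_le_BB hm (B.hV0 p) (S.hv0 p) (S.hvC p)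
  rw [hB, mul_zero] at hG
  by_contra hcon
  push Not at hcon
  have : 0 < Gam (v p ^ m - V p) := by
    unfold Gam
    have : 0 < max (v p ^ m - V p) 0 := lt_max_of_lt_left (by linarith)
    positivity
  linarith

theorem coord_le {N : ℕ} (x : EE N) (i : Fin N) : |x i| ≤ ‖x‖ := by
  simpa using PiLp.norm_apply_le x i

theorem normpow_cont {N : ℕ} {e : ℝ} (he : 0 < e) : Continuous (fun x : EE N => ‖x‖ ^ e) :=
  continuous_norm.rpow_const fun _ => Or.inr he.le

theorem npd {N : ℕ} {e : ℝ} (he : 0 < e) (i : Fin N) (x : EE N) :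
    HasFDerivAt (fun x : EE N => ‖x‖ ^ e * x i)
      ((e * ‖x‖ ^ (e - 2) * x i) • innerSL ℝ x + ‖x‖ ^ e • EuclideanSpace.proj (𝕜 := ℝ) i) x := by
  by_cases hx : x = 0
  · subst hx
    have hz : ((e * ‖(0 : EE N)‖ ^ (e - 2) * (0 : EE N) i) • innerSL ℝ (0 : EE N)
      + ‖(0 : EE N)‖ ^ e • EuclideanSpace.proj (𝕜 := ℝ) i : EE N →L[ℝ] ℝ) = 0 := by
      rw [norm_zero, Real.zero_rpow he.ne']; simp
    rw [hz, hasFDerivAt_iff_isLittleO_nhds_zero, Asymptotics.isLittleO_iff]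
    intro c hc
    have ht : Tendsto (fun x : EE N => ‖x‖ ^ e) (𝓝 0) (𝓝 0) := by
      have := (normpow_cont (N := N) he).tendsto 0
      simpa [Real.zero_rpow he.ne'] using this
    filter_upwards [ht.eventually_le_const hc] with h hh
    have h1 : 0 ≤ ‖h‖ ^ e := Real.rpow_nonneg (norm_nonneg _) _
    simp only [zero_add, PiLp.zero_apply, mul_zero, sub_zero, zero_apply, norm_mul, Real.norm_eq_abs]
    rw [abs_of_nonneg h1]
    exact mul_le_mul hh (coord_le h i) (abs_nonneg _) hc.le
  · have hn : 0 < ‖x‖ := norm_pos_iff.2 hx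
    have h1 : HasFDerivAt (fun x : EE N => (‖x‖ ^ 2) ^ (e / 2)) _ x :=
      ((hasStrictFDerivAt_norm_sq x).hasFDerivAt).rpow_const (Or.inl (by positivity))
    have e1 : ∀ (y : EE N) (d : ℝ), (‖y‖ ^ 2) ^ (d / 2) = ‖y‖ ^ d := by
      intro y d
      rw [← Real.rpow_natCast_mul (norm_nonneg y)]; congr 1; push_cast; ring
    simp only [e1] at h1
    have h2 := h1.mul ((EuclideanSpace.proj (𝕜 := ℝ) i).hasFDerivAt (x := x))
    refine h2.congr_fderiv ?_
    rw [show e / 2 - 1 = (e - 2) / 2 by ring, e1]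
    ext y
    simp
    ring

theorem npc {N : ℕ} {e : ℝ} (he : 0 < e) (i : Fin N) :
    Continuous (fun x : EE N => ‖x‖ ^ (e - 2) * (x i) ^ 2) := by
  rw [continuous_iff_continuousAt]
  intro x
  by_cases hx : x = 0
  · subst hx
    have ht : Tendsto (fun x : EE N => ‖x‖ ^ e) (𝓝 0) (𝓝 0) := by
      have := (normpow_cont (N := N) he).tendsto 0
      simpa [Real.zero_rpow he.ne'] using this
    unfold ContinuousAt
    simp only [PiLp.zero_apply, ne_eq, OfNat.ofNat_ne_zero, not_false_eq_true, zero_pow, mul_zero]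
    refine squeeze_zero (fun y => by positivity) (fun y => ?_) ht
    by_cases hy : y = 0
    · subst hy; simp [Real.zero_rpow he.ne']
    have hn : 0 < ‖y‖ := norm_pos_iff.2 hy
    have h1 : (y i) ^ 2 ≤ ‖y‖ ^ 2 := sq_le_sq' (by linarith [(abs_le.1 (coord_le y i)).1]) (abs_le.1 (coord_le y i)).2
    calc _ ≤ ‖y‖ ^ (e - 2) * ‖y‖ ^ 2 := by gcongr
      _ = ‖y‖ ^ e := by rw [← Real.rpow_natCast, ← Real.rpow_add hn]; congr 1; push_cast; ring
  · have hn : 0 < ‖x‖ := norm_pos_iff.2 hx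
    have : ContinuousAt (fun x : EE N => ‖x‖ ^ (e - 2)) x :=
      continuous_norm.continuousAt.rpow_const (Or.inl hn.ne')
    exact this.mul (by fun_prop)

theorem np_ibp {N : ℕ} {e c : ℝ} (he : 0 < e) (ψ : PP N → ℝ) (hψ : ContDiff ℝ 1 ψ)
    (hc : HasCompactSupport ψ) :
    ∫ p : PP N, fderiv ℝ ψ p (0, (c * ‖p.2‖ ^ e) • p.2) =
      - ∫ p, (c * (e + N) * ‖p.2‖ ^ e) * ψ p := by
  obtain ⟨r, hr⟩ := hc.isCompact.isBounded.subset_closedBall (0 : PP N)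
  have hD : ∀ (i : Fin N) (p : PP N), HasFDerivAt (𝕜 := ℝ) (fun p : PP N => ((c * ‖p.2‖ ^ e) • p.2 : EE N) i)
      (c • (((e * ‖p.2‖ ^ (e - 2) * p.2 i) • innerSL ℝ p.2 + ‖p.2‖ ^ e • EuclideanSpace.proj (𝕜 := ℝ) i).comp
        (ContinuousLinearMap.snd ℝ ℝ (EE N))) : PP N →L[ℝ] ℝ) p := by
    intro i p
    have h1 := ((npd he i p.2).comp p (hasFDerivAt_snd (𝕜 := ℝ) (E := ℝ) (F := EE N))).const_mul c
    refine h1.congr_of_eventuallyEq (Eventually.of_forall fun p => ?_)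
    simp [mul_assoc]
  have hval : ∀ (i : Fin N) (p : PP N), fderiv ℝ (fun p : PP N => ((c * ‖p.2‖ ^ e) • p.2) i) p
      (0, EuclideanSpace.single i 1) = c * (e * (‖p.2‖ ^ (e - 2) * (p.2 i) ^ 2) + ‖p.2‖ ^ e) := by
    intro i p
    rw [(hD i p).fderiv]
    simp [EuclideanSpace.inner_single_right]
    ring
  have := div_ibp (X := fun p : PP N => (c * ‖p.2‖ ^ e) • p.2) (Θ := ψ)
    (Y := fun p => c * (e + N) * ‖p.2‖ ^ e) (r := r)
    (L := fun i p => fderiv ℝ (fun p : PP N => ((c * ‖p.2‖ ^ e) • p.2) i) p)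
    ((continuous_const.mul ((normpow_cont he).comp continuous_snd)).smul continuous_snd)
    (fun i p => (hD i p).differentiableAt.hasFDerivAt)
    (fun i => by
      simp only [hval]
      have h1 : Continuous (fun p : PP N => ‖p.2‖ ^ (e - 2) * (p.2 i) ^ 2) := (npc he i).comp continuous_snd
      have h2 : Continuous (fun p : PP N => ‖p.2‖ ^ e) := (normpow_cont he).comp continuous_snd
      exact continuous_const.mul ((continuous_const.mul h1).add h2))
    (fun p => by
      simp only [hval]
      rw [← Finset.mul_sum, Finset.sum_add_distrib, ← Finset.mul_sum, ← Finset.mul_sum]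
      have : ∑ i, (p.2 i) ^ 2 = ‖p.2‖ ^ 2 := by rw [EuclideanSpace.norm_sq_eq]; simp
      rw [this]
      by_cases hp : p.2 = 0
      · simp [hp, Real.zero_rpow he.ne']
      have hn : 0 < ‖p.2‖ := norm_pos_iff.2 hp
      have : ‖p.2‖ ^ (e - 2) * ‖p.2‖ ^ 2 = ‖p.2‖ ^ e := by
        rw [← Real.rpow_natCast, ← Real.rpow_add hn]; congr 1; push_cast; ring
      rw [this]
      simp
      ring)
    hψ (Or.inl fun p hp => by
      by_contra h
      exact hp (hr (subset_tsupport _ h)))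
  rw [this]
  congr 1
  exact integral_congr_ae (ae_of_all _ fun p => mul_comm _ _)

theorem ae_lift {N : ℕ} {P : EE N → Prop} (h : ∀ᵐ x, P x) : ∀ᵐ p : PP N, P p.2 :=
  Measure.quasiMeasurePreserving_snd.ae h

theorem step_const {N : ℕ} {m q C M : ℝ} {w u0 : EE N → ℝ} {v : PP N → ℝ}
    (S : Sol N m q C w u0 v) (hw0 : ∀ x, 0 ≤ w x) (hM : 0 ≤ M) (h : ∀ᵐ x, u0 x ≤ M) :
    ∀ᵐ p : PP N, p ∈ Om N → v p ≤ M := by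
  have hm0 : 0 < m := by linarith [S.hm]
  have B : Bar N m q 1 w u0 v (fun _ => M ^ m) (fun _ => 0) (fun _ => 0) :=
    { hV := contDiff_const
      hV0 := fun _ => Real.rpow_nonneg hM _
      hXc := continuous_const
      hX := fun p y => by simp
      hYc := continuous_const
      hY := fun ψ _ _ => by
        have : ∀ p : PP N, fderiv ℝ ψ p ((0 : ℝ), (0 : EE N)) = 0 := fun p => map_zero _
        simp [this]
      hs0 := one_pos
      hinit := by
        filter_upwards [ae_lift h] with p hp _
        exact Real.rpow_le_rpow (S.hu0 _) hp hm0.le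
      hpt := ae_of_all _ fun p _ => by
        have h1 : 0 ≤ w p.2 * v p ^ q * bet (v p ^ m - M ^ m) :=
          mul_nonneg (mul_nonneg (hw0 _) (Real.rpow_nonneg (S.hv0 _) _)) (bet_nonneg _)
        simpa using h1 }
  filter_upwards [comparison S B] with p hp hO
  exact (Real.rpow_le_rpow_iff (S.hv0 p) hM hm0).1 (hp hO)

theorem V_fderiv {N : ℕ} {b c : ℝ} (hb : 1 < b) (p : PP N) :
    HasFDerivAt (fun p : PP N => c * ‖p.2‖ ^ b)
      (c • ((b * ‖p.2‖ ^ (b - 2)) • innerSL ℝ p.2).comp (ContinuousLinearMap.snd ℝ ℝ (EE N))) p :=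
  ((hasFDerivAt_norm_rpow p.2 hb).comp p (hasFDerivAt_snd (𝕜 := ℝ) (E := ℝ) (F := EE N))).const_mul c

theorem step_pow {N : ℕ} {m q C σ a A R : ℝ} {u0 : EE N → ℝ} {v : PP N → ℝ}
    (S : Sol N m q C (fun x => ‖x‖ ^ σ) u0 v) (hN : 1 ≤ N) (ha0 : 0 < a) (hA0 : 0 < A) (hR0 : 0 < R)
    (hσ0 : 0 < σ) (ham : 2 < a * m) (hexp : 0 ≤ a * (m - q) - σ - 2)
    (hAR : A ^ (m - q) * R ^ (a * (m - q) - σ - 2) ≤ 1 / (a * m * (a * m + N - 2)))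
    (hu0loc : ∀ᵐ x : EE N, ‖x‖ < R → u0 x ≤ A * ‖x‖ ^ a)
    (hu0sup : ∀ᵐ x : EE N, u0 x ≤ A * R ^ a)
    (hbd : ∀ᵐ p : PP N, p ∈ Om N → v p ≤ A * R ^ a) :
    ∀ᵐ p : PP N, p ∈ Om N → v p ≤ A * ‖p.2‖ ^ a := by
  have hm0 : 0 < m := by linarith [S.hm]
  have hN' : (1:ℝ) ≤ N := by exact_mod_cast hN
  have hVp : ∀ x : EE N, (A * ‖x‖ ^ a) ^ m = A ^ m * ‖x‖ ^ (a * m) := fun x => by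
    rw [Real.mul_rpow hA0.le (by positivity), ← Real.rpow_mul (norm_nonneg _)]
  have he : 0 < a * m - 2 := by linarith
  have hpr : 0 < a * m * (a * m + N - 2) := by
    apply _root_.mul_pos (by positivity); linarith
  have B : Bar N m q 1 (fun x => ‖x‖ ^ σ) u0 v (fun p => A ^ m * ‖p.2‖ ^ (a * m))
      (fun p => (A ^ m * (a * m)) * ((a * m - 2) + N) * ‖p.2‖ ^ (a * m - 2))
      (fun p => ((A ^ m * (a * m)) * ‖p.2‖ ^ (a * m - 2)) • p.2) :=
    { hV := contDiff_const.mul ((contDiff_norm_rpow (E := EE N) (by linarith : 1 < a * m)).comp contDiff_snd)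
      hV0 := fun _ => by positivity
      hXc := (continuous_const.mul ((normpow_cont he).comp continuous_snd)).smul continuous_snd
      hX := fun p y => by
        rw [(V_fderiv (by linarith : 1 < a * m) p).fderiv]
        simp [inner_smul_left]
        ring
      hYc := continuous_const.mul ((normpow_cont he).comp continuous_snd)
      hY := fun ψ h1 h2 => np_ibp he ψ h1 h2
      hs0 := one_pos
      hinit := by
        filter_upwards [ae_lift hu0loc, ae_lift hu0sup] with p h1 h2 _
        rw [← hVp]
        refine Real.rpow_le_rpow (S.hu0 _) ?_ hm0.le
        rcases lt_or_ge ‖p.2‖ R with h | h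
        · exact h1 h
        · exact h2.trans (by gcongr)
      hpt := by
        filter_upwards [hbd] with p hp hO
        rw [(V_fderiv (by linarith : 1 < a * m) p).fderiv]
        simp only [smul_apply, ContinuousLinearMap.comp_apply, ContinuousLinearMap.coe_snd', map_zero,
          smul_zero, zero_mul, zero_add]
        rcases le_or_gt (v p ^ m) (A ^ m * ‖p.2‖ ^ (a * m)) with h | h
        · rw [bet_of_nonpos (by linarith), mul_zero]
        refine mul_nonneg ?_ (bet_nonneg _)
        rw [← hVp] at h
        have h1 : A * ‖p.2‖ ^ a < v p := (Real.rpow_lt_rpow_iff (by positivity) (S.hv0 _) hm0).1 h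
        have h2 : ‖p.2‖ < R := by
          by_contra h3
          push Not at h3
          have : A * R ^ a ≤ A * ‖p.2‖ ^ a := by gcongr
          linarith [hp hO]
        have h3 : ‖p.2‖ ^ σ * (A * ‖p.2‖ ^ a) ^ q ≤ ‖p.2‖ ^ σ * v p ^ q := by
          have := S.hq
          gcongr
        refine sub_nonneg.2 (le_trans ?_ h3)
        rcases eq_or_lt_of_le (norm_nonneg p.2) with h0 | h0
        · rw [← h0, Real.zero_rpow he.ne', Real.zero_rpow hσ0.ne']; simp
        rw [Real.mul_rpow hA0.le (by positivity), ← Real.rpow_mul (norm_nonneg _)]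
        have h4 : ‖p.2‖ ^ (a * (m - q) - σ - 2) ≤ R ^ (a * (m - q) - σ - 2) := by gcongr
        have h5 : A ^ (m - q) * ‖p.2‖ ^ (a * (m - q) - σ - 2) * (a * m * (a * m + N - 2)) ≤ 1 := by
          rw [le_div_iff₀ hpr] at hAR
          refine le_trans ?_ hAR
          gcongr
        have e1 : A ^ m = A ^ q * A ^ (m - q) := by rw [← Real.rpow_add hA0]; congr 1; ring
        have e2 : ‖p.2‖ ^ (a * m - 2) = ‖p.2‖ ^ σ * ‖p.2‖ ^ (a * q) * ‖p.2‖ ^ (a * (m - q) - σ - 2) := by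
          rw [← Real.rpow_add h0, ← Real.rpow_add h0]; congr 1; ring
        rw [e1, e2]
        have h6 : 0 ≤ ‖p.2‖ ^ σ * (A ^ q * ‖p.2‖ ^ (a * q)) := by positivity
        calc _ = ‖p.2‖ ^ σ * (A ^ q * ‖p.2‖ ^ (a * q)) *
              (A ^ (m - q) * ‖p.2‖ ^ (a * (m - q) - σ - 2) * (a * m * (a * m + N - 2))) := by ring
          _ ≤ _ := mul_le_of_le_one_right h6 h5 }
  filter_upwards [comparison S B] with p hp hO
  have := hp hO
  rw [← hVp] at this
  exact (Real.rpow_le_rpow_iff (S.hv0 p) (by positivity) hm0).1 this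

theorem step_ode {N : ℕ} {m q C M c b : ℝ} {w u0 : EE N → ℝ} {v : PP N → ℝ}
    (S : Sol N m q C w u0 v) (hw0 : ∀ x, 0 ≤ w x) (hM : 0 < M) (hc : 0 < c) (hb0 : 0 < b) (hb : b < 1)
    (h0 : ∀ᵐ x, u0 x ≤ M)
    (habs : ∀ᵐ p : PP N, p ∈ Om N → c * v p ^ b ≤ w p.2 * v p ^ q) :
    ∃ T : ℝ, 0 < T ∧ ∀ᵐ p : PP N, T ≤ p.1 → v p = 0 := by
  have hm0 : 0 < m := by linarith [S.hm]
  obtain ⟨k, hk⟩ := exists_nat_ge (m / (1 - b))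
  set n : ℝ := (k : ℝ) + 2 with hn
  have hn2 : 0 < n := by positivity
  have hnm : 0 ≤ n * (1 - b) / m - 1 := by
    rw [div_le_iff₀ (by linarith)] at hk
    rw [sub_nonneg, one_le_div hm0]
    nlinarith
  have hn' : ((k + 2 : ℕ) : ℝ) = n := by push_cast; rfl
  set Y0 : ℝ := (2 * M ^ m) ^ (1 / n) with hY0
  set Y1 : ℝ := (M ^ m) ^ (1 / n) with hY1
  have hMm : 0 < M ^ m := by positivity
  have hY0p : 0 < Y0 := by positivity
  have hY1p : 0 < Y1 := by positivity
  have h01 : Y1 < Y0 := Real.rpow_lt_rpow hMm.le (by linarith) (by positivity)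
  have hY1n : Y1 ^ (k + 2) = M ^ m := by
    rw [← Real.rpow_natCast, hn', hY1, ← Real.rpow_mul hMm.le]
    rw [one_div_mul_cancel hn2.ne', Real.rpow_one]
  set κ : ℝ := c * m / n / Y0 ^ (n * (1 - b) / m - 1) with hκ
  have hκp : 0 < κ := by positivity
  have hκe : κ * n / m * Y0 ^ (n * (1 - b) / m - 1) = c := by
    rw [hκ]; field_simp
  set y : ℝ → ℝ := fun s => max (Y0 - κ * s) 0 with hy
  have hVd : ∀ p : PP N, HasFDerivAt (fun p : PP N => (y p.1) ^ (k + 2))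
      ((n * (y p.1) ^ (k + 1)) • ((-κ) • ContinuousLinearMap.fst ℝ ℝ (EE N))) p := by
    intro p
    have h2 : HasFDerivAt (fun p : PP N => Y0 - κ * p.1) ((-κ) • ContinuousLinearMap.fst ℝ ℝ (EE N)) p := by
      have := (((hasFDerivAt_fst (𝕜 := ℝ) (E := ℝ) (F := EE N) (p := p)).const_mul κ).const_sub Y0)
      refine this.congr_fderiv ?_
      ext <;> simp
    exact HasDerivAt.comp_hasFDerivAt (f := fun p : PP N => Y0 - κ * p.1) p (pos_pow_deriv k _) h2
  have B : Bar N m q ((Y0 - Y1) / κ) w u0 v (fun p => (y p.1) ^ (k + 2)) (fun _ => 0) (fun _ => 0) :=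
    { hV := (pos_pow_contDiff k).comp (contDiff_const.sub (contDiff_const.mul contDiff_fst))
      hV0 := fun p => pow_nonneg (le_max_right _ _) _
      hXc := continuous_const
      hX := fun p z => by
        rw [(hVd p).fderiv]; simp
      hYc := continuous_const
      hY := fun ψ _ _ => by
        have : ∀ p : PP N, fderiv ℝ ψ p ((0 : ℝ), (0 : EE N)) = 0 := fun p => map_zero _
        simp [this]
      hs0 := div_pos (by linarith) hκp
      hinit := by
        filter_upwards [ae_lift h0] with p hp hs
        have h1 : κ * p.1 ≤ Y0 - Y1 := by
          have := hs.2; rw [le_div_iff₀ hκp] at this; linarith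
        have h2 : Y1 ≤ y p.1 := le_trans (by linarith) (le_max_left _ _)
        calc u0 p.2 ^ m ≤ M ^ m := Real.rpow_le_rpow (S.hu0 _) hp hm0.le
          _ = Y1 ^ (k + 2) := hY1n.symm
          _ ≤ _ := by gcongr
      hpt := by
        filter_upwards [habs] with p hp hO
        have hp := hp hO
        rw [(hVd p).fderiv]
        simp only [smul_apply, ContinuousLinearMap.coe_fst', smul_eq_mul, mul_one, sub_zero]
        have hyy : 0 ≤ y p.1 := le_max_right _ _
        have hwb : 0 ≤ w p.2 * v p ^ q * bet (v p ^ m - y p.1 ^ (k + 2)) :=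
          mul_nonneg (mul_nonneg (hw0 _) (Real.rpow_nonneg (S.hv0 _) _)) (bet_nonneg _)
        rcases eq_or_lt_of_le hyy with hz | hz
        · rw [← hz] at hwb ⊢
          simpa using hwb
        rcases le_or_gt (v p ^ m) (y p.1 ^ (k + 2)) with h | h
        · rw [DD_zero S.hm (S.hv0 p) h]; simpa using hwb
        have hyY : y p.1 ≤ Y0 := by
          have : 0 < p.1 := hO
          have : 0 ≤ κ * p.1 := by positivity
          exact max_le (by linarith) hY0p.le
        generalize y p.1 = z at *
        set ξ : ℝ := z ^ (n / m) with hξ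
        have hξp : 0 < ξ := by positivity
        have hξm : ξ ^ m = z ^ (k + 2) := by
          rw [hξ, ← Real.rpow_mul hz.le, div_mul_cancel₀ _ hm0.ne', ← hn', Real.rpow_natCast]
        rw [← hξm] at h ⊢
        have hξv : ξ < v p := (Real.rpow_lt_rpow_iff hξp.le (S.hv0 _) hm0).1 h
        have hDb := DD_le_bet S.hm hξp.le (S.hv0 p)
        have e1 : z ^ (k + 1) = ξ ^ (m - 1) * z ^ (n / m - 1) := by
          rw [hξ, ← Real.rpow_mul hz.le, ← Real.rpow_add hz, ← Real.rpow_natCast]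
          congr 1
          push_cast
          field_simp
          rw [hn]; ring
        have e2 : z ^ (n / m - 1) = ξ ^ b * z ^ (n * (1 - b) / m - 1) := by
          rw [hξ, ← Real.rpow_mul hz.le, ← Real.rpow_add hz]
          congr 1
          field_simp
          ring
        have hb1 := bet_nonneg (v p ^ m - ξ ^ m)
        have hvb : 0 ≤ v p ^ b := Real.rpow_nonneg (S.hv0 p) _
        have key : κ * n * z ^ (k + 1) * DD m (ξ ^ m) (v p) ≤ w p.2 * v p ^ q * bet (v p ^ m - ξ ^ m) := by
          calc κ * n * z ^ (k + 1) * DD m (ξ ^ m) (v p)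
              = κ * n / m * z ^ (n / m - 1) * (m * ξ ^ (m - 1) * DD m (ξ ^ m) (v p)) := by
                rw [e1]; field_simp
            _ ≤ κ * n / m * z ^ (n / m - 1) * bet (v p ^ m - ξ ^ m) := by gcongr
            _ ≤ κ * n / m * (v p ^ b * Y0 ^ (n * (1 - b) / m - 1)) * bet (v p ^ m - ξ ^ m) := by
                rw [e2]
                have hvb' : ξ ^ b ≤ v p ^ b := by gcongr
                gcongr
            _ = c * v p ^ b * bet (v p ^ m - ξ ^ m) := by rw [← hκe]; ring
            _ ≤ _ := by gcongr
        linarith }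
  refine ⟨Y0 / κ, by positivity, ?_⟩
  filter_upwards [comparison S B] with p hp hT
  have hTp : 0 < Y0 / κ := by positivity
  have h1 := hp (show p ∈ Om N from lt_of_lt_of_le hTp hT)
  have h2 : y p.1 = 0 := by
    rw [div_le_iff₀ hκp] at hT
    exact max_eq_right (by linarith)
  rw [h2] at h1
  by_contra hne
  have : 0 < v p := lt_of_le_of_ne (S.hv0 p) (Ne.symm hne)
  have : 0 < v p ^ m := by positivity
  simp at h1
  linarith

theorem final_core
    (N : ℕ) (hN : 1 ≤ N) (m q σ : ℝ) (hm : 1 < m) (hq0 : 0 < q) (hq1 : q < 1)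
    (hσ : 2 * (1 - q) / (m - 1) ≤ σ)
    (a A R : ℝ) (ha0 : 0 < a) (hA0 : 0 < A) (hR0 : 0 < R)
    (ha : σ / (1 - q) < a)
    (hAR : A ^ (m - q) * R ^ (a * (m - q) - σ - 2) ≤ 1 / (a * m * (a * m + N - 2)))
    (u0 : EuclideanSpace ℝ (Fin N) → ℝ) (hu0 : IsBddNonneg N u0)
    (hu0loc : ∀ᵐ x : EuclideanSpace ℝ (Fin N), ‖x‖ < R → u0 x ≤ A * ‖x‖ ^ a)
    (hu0sup : ∀ᵐ x : EuclideanSpace ℝ (Fin N), u0 x ≤ A * R ^ a)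
    (u : ℝ → EuclideanSpace ℝ (Fin N) → ℝ)
    (hu : IsWeakSolution N m q (fun x => ‖x‖ ^ σ) u0 u) :
    VanishesInFiniteTime N u := by
  have hm1 : 0 < m - 1 := by linarith
  have hq' : 0 < 1 - q := by linarith
  have hσ0 : 0 < σ := lt_of_lt_of_le (by positivity) hσ
  have hw : Continuous (fun x : EE N => ‖x‖ ^ σ) := normpow_cont hσ0
  have hw0 : ∀ x : EE N, 0 ≤ (fun x : EE N => ‖x‖ ^ σ) x := fun x => by positivity
  obtain ⟨g, hg1, -, hg3, hW1, hW2⟩ := ws_extract (by linarith) hq0 hw hw0 hu0 hu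
  obtain ⟨hum, hupos, ⟨C, hC⟩, -⟩ := hu
  obtain ⟨hu0m, hu0p, C0, hC0⟩ := hu0
  have S : Sol N m q (max C C0) (fun x => ‖x‖ ^ σ) u0 (fun p => u p.1 p.2) :=
    { hm := hm, hq := hq0, hw := hw, hv := hum, hv0 := fun p => hupos _ _,
      hvC := fun p => (hC _ _).trans (le_max_left _ _)
      hu := hu0m, hu0 := hu0p, huC := fun x => (hC0 x).trans (le_max_right _ _)
      ex := ⟨g, hg1, hg3, hW1, hW2⟩ }
  rw [div_lt_iff₀ hq'] at ha
  rw [div_le_iff₀ hm1] at hσ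
  have ham1 : 2 < a * (m - 1) := by
    have : 2 * (1 - q) < a * (m - 1) * (1 - q) := by nlinarith
    exact lt_of_mul_lt_mul_right this hq'.le
  have hMp : 0 < A * R ^ a := by positivity
  have s1 := step_const S hw0 hMp.le hu0sup
  have s2 := step_pow S hN ha0 hA0 hR0 hσ0 (by nlinarith) (by nlinarith) hAR hu0loc hu0sup s1
  have hσa : σ / a < 1 - q := by rw [div_lt_iff₀ ha0]; linarith
  obtain ⟨T, hT, hTv⟩ := step_ode (c := A ^ (-(σ / a))) (b := q + σ / a) S hw0 hMp (by positivity)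
    (by positivity) (by linarith) hu0sup (by
      filter_upwards [s2] with p hp hO
      have hp := hp hO
      have hv := hupos p.1 p.2
      generalize u p.1 p.2 = z at *
      rcases eq_or_lt_of_le hv with h | h
      · rw [← h, Real.zero_rpow (by positivity), Real.zero_rpow hq0.ne']; simp
      rw [Real.rpow_add h]
      have h1 : z ^ (σ / a) ≤ A ^ (σ / a) * ‖p.2‖ ^ σ := by
        calc z ^ (σ / a) ≤ (A * ‖p.2‖ ^ a) ^ (σ / a) := by gcongr
          _ = _ := by
            rw [Real.mul_rpow hA0.le (by positivity), ← Real.rpow_mul (norm_nonneg _),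
              mul_div_cancel₀ _ ha0.ne']
      calc A ^ (-(σ / a)) * (z ^ q * z ^ (σ / a))
          ≤ A ^ (-(σ / a)) * (z ^ q * (A ^ (σ / a) * ‖p.2‖ ^ σ)) := by gcongr
        _ = (A ^ (-(σ / a)) * A ^ (σ / a)) * (‖p.2‖ ^ σ * z ^ q) := by ring
        _ = _ := by rw [← Real.rpow_add hA0, neg_add_cancel, Real.rpow_zero, one_mul])
  refine ⟨T, hT, ?_⟩
  have hTv' : ∀ᵐ p ∂((volume : Measure ℝ).prod (volume : Measure (EE N))), T ≤ p.1 → u p.1 p.2 = 0 := hTv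
  filter_upwards [Measure.ae_ae_of_ae_prod hTv'] with t ht hTt
  filter_upwards [ht] with x hx
  exact hx hTt

/-- **Theorem 1.3 (finite time extinction for σ ≥ σ\*).**
Let `N ≥ 1`, `m > 1`, `q ∈ (0,1)` and `σ ≥ 2(1−q)/(m−1)`. Let `a, A, R > 0` satisfy
`a > σ/(1−q)` and `A^{m−q} R^{a(m−q)−σ−2} ≤ 1/(am(am+N−2))`. Let `u₀ ∈ L^∞(ℝᴺ)` be
non-negative with `u₀(x) ≤ A|x|^a` a.e. in `B(0,R)` and `‖u₀‖_∞ ≤ A R^a`.  Then every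
non-negative weak solution of `∂ₜ u = Δ(uᵐ) − |x|^σ u^q` with `u(0) = u₀` vanishes in
finite time. -/
theorem finite_time_extinction_supercritical
    (N : ℕ) (hN : 1 ≤ N) (m q σ : ℝ) (hm : 1 < m) (hq0 : 0 < q) (hq1 : q < 1)
    (hσ : 2 * (1 - q) / (m - 1) ≤ σ)
    (a A R : ℝ) (ha0 : 0 < a) (hA0 : 0 < A) (hR0 : 0 < R)
    (ha : σ / (1 - q) < a)
    (hAR : A ^ (m - q) * R ^ (a * (m - q) - σ - 2) ≤ 1 / (a * m * (a * m + N - 2)))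
    (u0 : EuclideanSpace ℝ (Fin N) → ℝ) (hu0 : IsBddNonneg N u0)
    (hu0loc : ∀ᵐ x : EuclideanSpace ℝ (Fin N), ‖x‖ < R → u0 x ≤ A * ‖x‖ ^ a)
    (hu0sup : ∀ᵐ x : EuclideanSpace ℝ (Fin N), u0 x ≤ A * R ^ a)
    (u : ℝ → EuclideanSpace ℝ (Fin N) → ℝ)
    (hu : IsWeakSolution N m q (fun x => ‖x‖ ^ σ) u0 u) :
    VanishesInFiniteTime N u := by
  exact final_core N hN m q σ hm hq0 hq1 hσ a A R ha0 hA0 hR0 ha hAR u0 hu0 hu0loc hu0sup u hu
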